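/- If a torus T^k acts effectively on a connected smooth manifold M and a subtorus T^l ⊆ T^k acts maximally on M (i.e., there is a point whose T^l-isotropy group has dimension dim(M) − l), then T^l = T^k. -/

import Mathlib

/-- The `k`-torus `T^k = ℝ^k/ℤ^k`, realized coordinatewise. -/
abbrev Torus (k : ℕ) : Type := Fin k → AddCircle (1 : ℝ)

/-- The dimension of a subset (e.g. a closed subgroup) `H` of a topological
abelian group: the largest `d` such that a `d`-torus embeds continuously into
`H` as a subgroup. -/
noncomputable def torusDim {G : Type*} [AddCommGroup G] [TopologicalSpace G]
    (H : Set G) : ℕ :=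
  sSup {d : ℕ | ∃ f : Torus d →+ G,
    Continuous f ∧ Function.Injective f ∧ Set.range f ⊆ H}

/-! ## Chains on finite lists, modulo two -/

namespace InfChain

open Filter Topology Finsupp

noncomputable section

/-- Formal sums, modulo two, of finite lists of points. -/
abbrev LC (E : Type*) := List E →₀ ZMod 2

/-- Formal sums supported on a set of lists. -/
abbrev sp {E : Type*} (S : Set (List E)) : Submodule (ZMod 2) (LC E) :=
  Finsupp.supported (ZMod 2) (ZMod 2) S

section CharTwo

variable {V : Type*} [AddCommGroup V] [Module (ZMod 2) V]

lemma add_self2 (v : V) : v + v = 0 := ZModModule.add_self v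

lemma neg2 (v : V) : -v = v := ZModModule.neg_eq_self v

lemma two_zsmul_eq_zero (v : V) : (2 : ℤ) • v = 0 := by rw [two_smul, add_self2]

lemma eq_of_add_eq_zero2 {v w : V} (h : v + w = 0) : v = w := by
  rw [eq_neg_of_add_eq_zero_left h, neg2]

lemma add_eq_zero2 {v w : V} : v + w = 0 ↔ v = w :=
  ⟨eq_of_add_eq_zero2, fun h => by rw [h, add_self2]⟩

end CharTwo

section Level

variable {E : Type*}

/-- The basis element of a list. -/
abbrev bs (σ : List E) : LC E := Finsupp.single σ 1

lemma bs_mem {S : Set (List E)} {σ : List E} (h : σ ∈ S) : bs σ ∈ sp S :=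
  Finsupp.single_mem_supported _ _ h

lemma map_mem_of_sp {V : Type*} [AddCommGroup V] [Module (ZMod 2) V] (T : LC E →ₗ[ZMod 2] V)
    {S : Set (List E)} {P : Submodule (ZMod 2) V} (h : ∀ σ ∈ S, T (bs σ) ∈ P) {c : LC E}
    (hc : c ∈ sp S) : T c ∈ P := by
  have h1 : sp S ≤ P.comap T := by
    rw [sp, Finsupp.supported_eq_span_single, Submodule.span_le]
    rintro _ ⟨σ, hσ, rfl⟩
    exact h σ hσ
  exact h1 hc

lemma hom_ext' {V : Type*} [AddCommGroup V] [Module (ZMod 2) V] {T T' : LC E →ₗ[ZMod 2] V}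
    (h : ∀ σ, T (bs σ) = T' (bs σ)) : T = T' := by
  apply Finsupp.lhom_ext'
  intro σ
  apply LinearMap.ext_ring
  simpa using h σ

/-- Prepend a vertex. -/
def cone (v : E) : LC E →ₗ[ZMod 2] LC E := Finsupp.lmapDomain _ _ (List.cons v)

@[simp] lemma cone_bs (v : E) (σ : List E) : cone v (bs σ) = bs (v :: σ) := by
  simp [cone, Finsupp.mapDomain_single]

/-- The boundary of a list. -/
def bdL : List E → LC E
  | [] => 0
  | v :: l => bs l + cone v (bdL l)

/-- The augmented boundary operator. -/
def bd : LC E →ₗ[ZMod 2] LC E := Finsupp.linearCombination (ZMod 2) bdL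

@[simp] lemma bd_bs (σ : List E) : bd (bs σ) = bdL σ := by
  simp [bd, Finsupp.linearCombination_single]

lemma bd_cone (v : E) (c : LC E) : bd (cone v c) = c + cone v (bd c) := by
  have : bd ∘ₗ cone v = LinearMap.id + cone v ∘ₗ bd := by
    apply hom_ext'
    intro σ
    simp [bdL]
  exact LinearMap.congr_fun this c

lemma bd_bd (c : LC E) : bd (bd c) = 0 := by
  have : bd ∘ₗ bd = (0 : LC E →ₗ[ZMod 2] LC E) := by
    apply hom_ext'
    intro σ
    induction σ with
    | nil => simp [bdL]
    | cons v l ih =>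
      simp only [LinearMap.comp_apply, bd_bs, LinearMap.zero_apply] at ih ⊢
      simp [bdL, bd_cone, ih, ZModModule.add_self]
  exact LinearMap.congr_fun this c

/-- The chain map induced by a map of vertices. -/
def lmap (f : E → E) : LC E →ₗ[ZMod 2] LC E := Finsupp.lmapDomain _ _ (List.map f)

@[simp] lemma lmap_bs (f : E → E) (σ : List E) : lmap f (bs σ) = bs (σ.map f) := by
  simp [lmap, Finsupp.mapDomain_single]

lemma lmap_cone (f : E → E) (v : E) (c : LC E) : lmap f (cone v c) = cone (f v) (lmap f c) := by
  have : lmap f ∘ₗ cone v = cone (f v) ∘ₗ lmap f := by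
    apply hom_ext'
    intro σ
    simp
  exact LinearMap.congr_fun this c

lemma bd_lmap (f : E → E) (c : LC E) : bd (lmap f c) = lmap f (bd c) := by
  have : bd ∘ₗ lmap f = lmap f ∘ₗ bd := by
    apply hom_ext'
    intro σ
    induction σ with
    | nil => simp [bdL]
    | cons v l ih =>
      simp only [LinearMap.comp_apply, bd_bs, lmap_bs] at ih ⊢
      simp [bdL, lmap_cone, ih]
  exact LinearMap.congr_fun this c

lemma lmap_lmap (f f' : E → E) (c : LC E) : lmap f (lmap f' c) = lmap (f ∘ f') c := by
  have : lmap f ∘ₗ lmap f' = lmap (f ∘ f') := by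
    apply hom_ext'
    intro σ
    simp
  exact LinearMap.congr_fun this c

lemma lmap_id (c : LC E) : lmap id c = c := by
  have : lmap (id : E → E) = LinearMap.id := by
    apply hom_ext'
    intro σ
    simp
  exact LinearMap.congr_fun this c

/-- The prism of a list between two maps. -/
def prismL (f f' : E → E) : List E → LC E
  | [] => 0
  | v :: l => bs (f v :: f' v :: l.map f') + cone (f v) (prismL f f' l)

/-- The prism operator between two maps. -/
def prism (f f' : E → E) : LC E →ₗ[ZMod 2] LC E := Finsupp.linearCombination (ZMod 2) (prismL f f')

@[simp] lemma prism_bs (f f' : E → E) (σ : List E) : prism f f' (bs σ) = prismL f f' σ := by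
  simp [prism, Finsupp.linearCombination_single]

lemma prism_cone (f f' : E → E) (v : E) (c : LC E) :
    prism f f' (cone v c) = cone (f v) (cone (f' v) (lmap f' c)) + cone (f v) (prism f f' c) := by
  have : prism f f' ∘ₗ cone v =
      cone (f v) ∘ₗ cone (f' v) ∘ₗ lmap f' + cone (f v) ∘ₗ prism f f' := by
    apply hom_ext'
    intro σ
    simp [prismL]
  exact LinearMap.congr_fun this c

lemma bd_prism (f f' : E → E) (c : LC E) :
    bd (prism f f' c) + prism f f' (bd c) = lmap f c + lmap f' c := by
  have : bd ∘ₗ prism f f' + prism f f' ∘ₗ bd = lmap f + lmap f' := by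
    apply hom_ext'
    intro σ
    induction σ with
    | nil => simp [bdL, prismL, ZModModule.add_self]
    | cons v l ih =>
      simp only [LinearMap.comp_apply, bd_bs, lmap_bs, LinearMap.add_apply, prism_bs] at ih ⊢
      have h1 : bd (prismL f f' l) = prism f f' (bdL l) + bs (l.map f) + bs (l.map f') := by
        rw [add_assoc, ← ih, add_comm (bd _), ← add_assoc, ZModModule.add_self, zero_add]
      have h2 : lmap f' (bdL l) = bdL (l.map f') := by
        rw [← bd_bs, ← bd_lmap, lmap_bs, bd_bs]
      simp only [prismL, bdL, map_add, bd_cone, prism_bs, prism_cone, h1, h2, cone_bs, bd_bs,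
        List.map_cons]
      rw [← add_eq_zero2]
      abel_nf
      simp only [two_zsmul_eq_zero, add_zero]
  exact LinearMap.congr_fun this c

lemma lmap_prism (g f f' : E → E) (c : LC E) :
    lmap g (prism f f' c) = prism (g ∘ f) (g ∘ f') c := by
  have : lmap g ∘ₗ prism f f' = prism (g ∘ f) (g ∘ f') := by
    apply hom_ext'
    intro σ
    induction σ with
    | nil => simp [prismL]
    | cons v l ih =>
      simp only [LinearMap.comp_apply, prism_bs] at ih ⊢
      simp [prismL, lmap_cone, ih]
  exact LinearMap.congr_fun this c

lemma prism_lmap (g f f' : E → E) (c : LC E) :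
    prism f f' (lmap g c) = prism (f ∘ g) (f' ∘ g) c := by
  have : prism f f' ∘ₗ lmap g = prism (f ∘ g) (f' ∘ g) := by
    apply hom_ext'
    intro σ
    induction σ with
    | nil => simp [prismL]
    | cons v l ih =>
      simp only [LinearMap.comp_apply, prism_bs, lmap_bs] at ih ⊢
      simp [prismL, ih]
  exact LinearMap.congr_fun this c

open Classical in
/-- Restriction of a chain to a set of lists. -/
def restr (D : Set (List E)) : LC E →ₗ[ZMod 2] LC E :=
  Finsupp.linearCombination (ZMod 2) (fun σ => if σ ∈ D then bs σ else 0)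

open Classical in
@[simp] lemma restr_bs (D : Set (List E)) (σ : List E) :
    restr D (bs σ) = if σ ∈ D then bs σ else 0 := by
  simp [restr, Finsupp.linearCombination_single]

open Classical in
lemma restr_apply (D : Set (List E)) (c : LC E) (σ : List E) :
    restr D c σ = if σ ∈ D then c σ else 0 := by
  have : Finsupp.lapply σ ∘ₗ restr D =
      (if σ ∈ D then Finsupp.lapply σ else 0 : LC E →ₗ[ZMod 2] ZMod 2) := by
    apply hom_ext'
    intro τ
    by_cases h : τ = σ
    · subst h
      split_ifs with h' <;> simp [h']
    · by_cases h1 : σ ∈ D <;> by_cases h2 : τ ∈ D <;> simp [h, h1, h2]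
  have h2 := LinearMap.congr_fun this c
  simp only [LinearMap.comp_apply, Finsupp.lapply_apply] at h2
  rw [h2]
  split_ifs <;> simp

lemma restr_mem (D S : Set (List E)) {c : LC E} (hc : c ∈ sp S) : restr D c ∈ sp (S ∩ D) := by
  classical
  refine map_mem_of_sp _ (fun σ hσ => ?_) hc
  rw [restr_bs]
  split_ifs with h
  · exact bs_mem ⟨hσ, h⟩
  · exact zero_mem _

lemma restr_eq_self {D : Set (List E)} {c : LC E} (hc : c ∈ sp D) : restr D c = c := by
  classical
  ext σ
  rw [restr_apply]
  split_ifs with h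
  · rfl
  · exact ((Finsupp.mem_supported' _ _).1 hc σ h).symm

lemma restr_lmap {g : E → E} {D : Set (List E)} (hD : ∀ σ, σ.map g ∈ D ↔ σ ∈ D) (c : LC E) :
    restr D (lmap g c) = lmap g (restr D c) := by
  classical
  have : restr D ∘ₗ lmap g = lmap g ∘ₗ restr D := by
    apply hom_ext'
    intro σ
    simp only [LinearMap.comp_apply, lmap_bs, restr_bs, hD]
    split_ifs <;> simp
  exact LinearMap.congr_fun this c

/-! ### Supports of the basic operators -/

lemma bdL_mem (σ : List E) :
    bdL σ ∈ sp {τ | τ.length + 1 = σ.length ∧ ∀ v ∈ τ, v ∈ σ} := by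
  induction σ with
  | nil => exact zero_mem _
  | cons v l ih =>
    refine add_mem (bs_mem ⟨rfl, fun u hu => List.mem_cons_of_mem _ hu⟩) ?_
    refine map_mem_of_sp _ (fun τ hτ => ?_) ih
    rw [cone_bs]
    refine bs_mem ⟨by simpa using hτ.1, fun u hu => ?_⟩
    rcases List.mem_cons.1 hu with rfl | hu
    · exact List.mem_cons_self
    · exact List.mem_cons_of_mem _ (hτ.2 u hu)

lemma prismL_mem (f f' : E → E) (σ : List E) :
    prismL f f' σ ∈ sp {τ | τ.length = σ.length + 1 ∧ ∀ u ∈ τ, ∃ v ∈ σ, u = f v ∨ u = f' v} := by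
  induction σ with
  | nil => exact zero_mem _
  | cons v l ih =>
    refine add_mem (bs_mem ⟨by simp, fun u hu => ?_⟩) ?_
    · simp only [List.mem_cons, List.mem_map] at hu ⊢
      rcases hu with rfl | rfl | ⟨w, hw, rfl⟩
      · exact ⟨v, Or.inl rfl, Or.inl rfl⟩
      · exact ⟨v, Or.inl rfl, Or.inr rfl⟩
      · exact ⟨w, Or.inr hw, Or.inr rfl⟩
    refine map_mem_of_sp _ (fun τ hτ => ?_) ih
    rw [cone_bs]
    refine bs_mem ⟨by simpa using hτ.1, fun u hu => ?_⟩
    rcases List.mem_cons.1 hu with rfl | hu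
    · exact ⟨v, List.mem_cons_self, Or.inl rfl⟩
    · obtain ⟨w, hw, h⟩ := hτ.2 u hu
      exact ⟨w, List.mem_cons_of_mem _ hw, h⟩

/-- The prism operator of a finite sequence of maps. -/
def homot (F : ℕ → E → E) (N : ℕ) : LC E →ₗ[ZMod 2] LC E :=
  ∑ k ∈ Finset.range N, prism (F k) (F (k + 1))

lemma bd_homot (F : ℕ → E → E) (N : ℕ) (c : LC E) :
    bd (homot F N c) + homot F N (bd c) = lmap (F 0) c + lmap (F N) c := by
  induction N with
  | zero => simp [homot, ZModModule.add_self]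
  | succ N ih =>
    have h := bd_prism (F N) (F (N + 1)) c
    simp only [homot, Finset.sum_range_succ, LinearMap.add_apply, map_add] at ih ⊢
    rw [add_add_add_comm, ih, h, add_assoc, ← add_assoc (lmap (F N) c), ZModModule.add_self,
      zero_add]

lemma homot_mem (F : ℕ → E → E) (N : ℕ) (σ : List E) :
    homot F N (bs σ) ∈ sp {τ | τ.length = σ.length + 1 ∧
      ∃ k < N, ∀ u ∈ τ, ∃ v ∈ σ, u = F k v ∨ u = F (k + 1) v} := by
  simp only [homot, LinearMap.sum_apply, prism_bs]
  refine sum_mem fun k hk => ?_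
  refine Finsupp.supported_mono ?_ (prismL_mem _ _ _)
  exact fun τ hτ => ⟨hτ.1, k, Finset.mem_range.1 hk, hτ.2⟩

lemma lmap_homot {g : E → E} {F : ℕ → E → E} (N : ℕ) (h : ∀ k y, g (F k y) = F k (g y))
    (c : LC E) : lmap g (homot F N c) = homot F N (lmap g c) := by
  have h' : ∀ k, g ∘ F k = F k ∘ g := fun k => funext (h k)
  simp only [homot, LinearMap.sum_apply, map_sum, lmap_prism, prism_lmap, h']

end Level

end

end InfChain

/-! ## Smith theory of an involution on a complex modulo two -/

namespace InfChain

section Abstract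

variable {V : Type*} [AddCommGroup V] [Module (ZMod 2) V]

/-- Every cycle in degree `ℓ` bounds. -/
def Van (d : V →ₗ[ZMod 2] V) (S : ℕ → Submodule (ZMod 2) V) (ℓ : ℕ) : Prop :=
  ∀ z ∈ S ℓ, d z = 0 → ∃ w ∈ S (ℓ + 1), d w = z

/-- The homology in degree `ℓ` has exactly one nonzero element. -/
def One (d : V →ₗ[ZMod 2] V) (S : ℕ → Submodule (ZMod 2) V) (ℓ : ℕ) : Prop :=
  ∃ z₀ ∈ S ℓ, d z₀ = 0 ∧ (¬ ∃ w ∈ S (ℓ + 1), d w = z₀) ∧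
    ∀ z ∈ S ℓ, d z = 0 → (∃ w ∈ S (ℓ + 1), d w = z) ∨ ∃ w ∈ S (ℓ + 1), d w = z + z₀

/-- The homology is that of a sphere, concentrated in degree `m`. -/
def Pure (d : V →ₗ[ZMod 2] V) (S : ℕ → Submodule (ZMod 2) V) (m : ℕ) : Prop :=
  One d S m ∧ ∀ ℓ, ℓ ≠ m → Van d S ℓ

lemma One.not_van {d : V →ₗ[ZMod 2] V} {S : ℕ → Submodule (ZMod 2) V} {ℓ : ℕ} (h : One d S ℓ) :
    ¬ Van d S ℓ := by
  obtain ⟨z, hz, dz, hn, -⟩ := h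
  exact fun hv => hn (hv z hz dz)

lemma Pure.unique {d : V →ₗ[ZMod 2] V} {S : ℕ → Submodule (ZMod 2) V} {m r : ℕ}
    (h : Pure d S m) (h' : Pure d S r) : m = r := by
  by_contra hne
  exact h.1.not_van (h'.2 m hne)

/-- The data of Smith theory: `b = 1 + g` for an involution `g` of the complex `S` with fixed
subcomplex `F`. -/
structure Smith (d b : V →ₗ[ZMod 2] V) (S F : ℕ → Submodule (ZMod 2) V) : Prop where
  zero : S 0 = ⊥
  dd : ∀ v, d (d v) = 0
  bb : ∀ v, b (b v) = 0
  db : ∀ v, d (b v) = b (d v)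
  dS : ∀ ℓ, ∀ s ∈ S (ℓ + 1), d s ∈ S ℓ
  bS : ∀ ℓ, ∀ s ∈ S ℓ, b s ∈ S ℓ
  FS : ∀ ℓ, F ℓ ≤ S ℓ
  dF : ∀ ℓ, ∀ s ∈ F (ℓ + 1), d s ∈ F ℓ
  bF : ∀ ℓ, ∀ s ∈ F ℓ, b s = 0
  split : ∀ ℓ, ∀ s ∈ S ℓ, b s = 0 → ∃ t ∈ S ℓ, ∃ f ∈ F ℓ, s = b t + f
  inter : ∀ ℓ, ∀ t ∈ S ℓ, b t ∈ F ℓ → b t = 0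
  nil : ∀ ℓ, ∀ c : ℕ → V, (∀ k, c k ∈ S (ℓ + 1 + k)) → (∃ s ∈ S ℓ, d (c 0) = b s) →
    (∀ k, d (c (k + 1)) = b (c k)) → ∃ u ∈ S (ℓ + 1), d (b u) = d (c 0)

/-- The image of `b`. -/
abbrev im (b : V →ₗ[ZMod 2] V) (S : ℕ → Submodule (ZMod 2) V) : ℕ → Submodule (ZMod 2) V :=
  fun ℓ => (S ℓ).map b

namespace Smith

variable {d b : V →ₗ[ZMod 2] V} {S F : ℕ → Submodule (ZMod 2) V}

lemma d_zero (h : Smith d b S F) {v : V} (hv : v ∈ S 0) : v = 0 := by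
  rw [h.zero] at hv
  exact (Submodule.mem_bot _).1 hv

/-- A cycle in `S` mapped to a boundary by `b` splits. -/
lemma split_of (h : Smith d b S F) {ℓ : ℕ} {c u : V} (hc : c ∈ S ℓ) (hu : u ∈ S (ℓ + 1))
    (e : b c = d (b u)) : ∃ t ∈ S ℓ, ∃ f ∈ F ℓ, c = d u + b t + f := by
  have hb : b (c + d u) = 0 := by rw [map_add, e, h.db, add_self2]
  obtain ⟨t, ht, f, hf, he⟩ := h.split ℓ _ (add_mem hc (h.dS _ _ hu)) hb
  refine ⟨t, ht, f, hf, ?_⟩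
  rw [add_assoc, ← he, add_comm c, ← add_assoc, add_self2, zero_add]

/-- The two components of a cycle are cycles. -/
lemma d_comp (h : Smith d b S F) {ℓ : ℕ} {t f : V} (ht : t ∈ S ℓ) (hf : f ∈ F ℓ)
    (e : d (b t + f) = 0) : d (b t) = 0 ∧ d f = 0 := by
  rcases ℓ with _ | ℓ
  · rw [h.d_zero ht, h.d_zero (h.FS _ hf)]
    simp
  have e1 : b (d t) = d f := by
    rw [map_add, h.db] at e
    exact eq_of_add_eq_zero2 e
  have e2 := h.inter ℓ (d t) (h.dS _ _ ht) (e1 ▸ h.dF _ _ hf)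
  exact ⟨by rw [h.db, e2], by rw [← e1, e2]⟩

lemma comp_eq (h : Smith d b S F) {ℓ : ℕ} {t t' f f' : V} (ht : t ∈ S ℓ) (ht' : t' ∈ S ℓ)
    (hf : f ∈ F ℓ) (hf' : f' ∈ F ℓ) (e : b t + f = b t' + f') : b t = b t' ∧ f = f' := by
  have e1 : b (t + t') = f + f' := by
    rw [map_add, ← add_eq_zero2]
    rw [← add_eq_zero2] at e
    rw [← e]; abel
  have e2 := h.inter ℓ _ (add_mem ht ht') (e1 ▸ add_mem hf hf')
  refine ⟨?_, ?_⟩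
  · rw [map_add] at e2
    exact eq_of_add_eq_zero2 e2
  · rw [e2] at e1
    exact eq_of_add_eq_zero2 e1.symm

/-- If the image vanishes one degree up, then image and fixed part inject in homology. -/
lemma inj (h : Smith d b S F) {ℓ : ℕ} (hv : Van d (im b S) (ℓ + 1)) {t f w : V}
    (ht : t ∈ S ℓ) (hf : f ∈ F ℓ) (hw : w ∈ S (ℓ + 1)) (e : d w = b t + f) :
    (∃ u ∈ S (ℓ + 1), d (b u) = b t) ∧ ∃ u ∈ F (ℓ + 1), d u = f := by
  have e1 : d (b w) = 0 := by rw [h.db, e, map_add, h.bb, h.bF _ _ hf, add_zero]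
  obtain ⟨_, ⟨u, hu, rfl⟩, e2⟩ := hv (b w) ⟨w, hw, rfl⟩ e1
  obtain ⟨t', ht', f', hf', e3⟩ := h.split_of hw hu e2.symm
  have e4 : d w = b (d t') + d f' := by rw [e3, map_add, map_add, h.dd, zero_add, h.db]
  obtain ⟨e5, e6⟩ := h.comp_eq (h.dS _ _ ht') ht (h.dF _ _ hf') hf (e4.symm.trans e)
  exact ⟨⟨t', ht', by rw [h.db, e5]⟩, f', hf', e6⟩

lemma van_im (h : Smith d b S F) {m : ℕ} (hv : ∀ ℓ, m < ℓ → Van d S ℓ) {ℓ : ℕ} (hl : m < ℓ) :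
    Van d (im b S) ℓ := by
  rintro _ ⟨s, hs, rfl⟩ hz
  obtain ⟨c₀, hc₀, e₀⟩ := hv ℓ hl (b s) (h.bS _ _ hs) hz
  have step : ∀ k, ∀ c : V, ∃ c' : V, c ∈ S (ℓ + 1 + k) → d (b c) = 0 →
      c' ∈ S (ℓ + 1 + (k + 1)) ∧ d c' = b c := by
    intro k c
    by_cases hc : c ∈ S (ℓ + 1 + k) ∧ d (b c) = 0
    · obtain ⟨c', h1, h2⟩ := hv (ℓ + 1 + k) (by omega) (b c) (h.bS _ _ hc.1) hc.2
      exact ⟨c', fun _ _ => ⟨h1, h2⟩⟩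
    · exact ⟨0, fun h1 h2 => absurd ⟨h1, h2⟩ hc⟩
  choose nx hnx using step
  let c : ℕ → V := fun k => Nat.rec c₀ nx k
  have hc : ∀ k, c k ∈ S (ℓ + 1 + k) ∧ d (b (c k)) = 0 := by
    intro k
    induction k with
    | zero => exact ⟨hc₀, by rw [h.db]; change b (d c₀) = 0; rw [e₀, h.bb]⟩
    | succ k ih =>
      have h1 := hnx k (c k) ih.1 ih.2
      refine ⟨h1.1, ?_⟩
      rw [h.db]
      change b (d (nx k (c k))) = 0
      rw [h1.2, h.bb]
  obtain ⟨u, hu, e⟩ := h.nil ℓ c (fun k => (hc k).1) ⟨s, hs, e₀⟩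
    (fun k => (hnx k (c k) (hc k).1 (hc k).2).2)
  exact ⟨b u, ⟨u, hu, rfl⟩, by rw [e]; exact e₀⟩

lemma van_fix (h : Smith d b S F) {m : ℕ} (hv : ∀ ℓ, m < ℓ → Van d S ℓ) {ℓ : ℕ} (hl : m < ℓ) :
    Van d F ℓ := by
  intro f hf df
  obtain ⟨c, hc, e⟩ := hv ℓ hl f (h.FS _ hf) df
  exact (h.inj (t := 0) (h.van_im hv (Nat.lt_succ_of_lt hl)) (zero_mem _) hf hc
    (by simpa using e)).2

/-- One step down the Smith sequence. -/
lemma step (h : Smith d b S F) {j : ℕ} (hS : Van d S j)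
    (h0 : ∀ s ∈ S (j + 1), d s = 0 → ∃ u ∈ S (j + 2), d (b u) = b s)
    (hA : One d (im b S) (j + 1)) :
    (One d (im b S) j ∧ Van d F j) ∨ (Van d (im b S) j ∧ One d F j) := by
  obtain ⟨_, ⟨c₀, hc₀, rfl⟩, dz₀, hn, huniq⟩ := hA
  have hk : b (d c₀) = 0 := by rw [← h.db, dz₀]
  obtain ⟨t₀, ht₀, f₀, hf₀, e₀⟩ := h.split j _ (h.dS _ _ hc₀) hk
  obtain ⟨dt₀, df₀⟩ := h.d_comp ht₀ hf₀ (by rw [← e₀, h.dd])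
  have key : ∀ t ∈ S j, ∀ f ∈ F j, d (b t) = 0 → d f = 0 →
      ((∃ u ∈ S (j + 1), d (b u) = b t) ∧ ∃ u ∈ F (j + 1), d u = f) ∨
      ((∃ u ∈ S (j + 1), d (b u) = b t + b t₀) ∧ ∃ u ∈ F (j + 1), d u = f + f₀) := by
    intro t ht f hf dt df
    obtain ⟨c, hc, e⟩ := hS (b t + f) (add_mem (h.bS _ _ ht) (h.FS _ hf))
      (by rw [map_add, dt, df, add_zero])
    have e1 : d (b c) = 0 := by rw [h.db, e, map_add, h.bb, h.bF _ _ hf, add_zero]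
    rcases huniq (b c) ⟨c, hc, rfl⟩ e1 with ⟨_, ⟨u, hu, rfl⟩, e2⟩ | ⟨_, ⟨u, hu, rfl⟩, e2⟩
    · left
      obtain ⟨t', ht', f', hf', e3⟩ := h.split_of hc hu e2.symm
      have e4 : d c = b (d t') + d f' := by rw [e3, map_add, map_add, h.dd, zero_add, h.db]
      obtain ⟨e5, e6⟩ := h.comp_eq (h.dS _ _ ht') ht (h.dF _ _ hf') hf (e4.symm.trans e)
      exact ⟨⟨t', ht', by rw [h.db, e5]⟩, f', hf', e6⟩
    · right
      obtain ⟨t', ht', f', hf', e3⟩ := h.split_of (add_mem hc hc₀) hu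
        (by rw [map_add]; exact e2.symm)
      have e4 : d (c + c₀) = b (d t') + d f' := by
        rw [e3, map_add, map_add, h.dd, zero_add, h.db]
      have e7 : d (c + c₀) = b (t + t₀) + (f + f₀) := by
        rw [map_add, e, e₀, map_add]; abel
      obtain ⟨e5, e6⟩ := h.comp_eq (h.dS _ _ ht') (add_mem ht ht₀) (h.dF _ _ hf')
        (add_mem hf hf₀) (e4.symm.trans e7)
      exact ⟨⟨t', ht', by rw [h.db, e5, map_add]⟩, f', hf', e6⟩
  have hnot : ¬ ((∃ u ∈ S (j + 1), d (b u) = b t₀) ∧ ∃ u ∈ F (j + 1), d u = f₀) := by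
    rintro ⟨⟨u, hu, eu⟩, v, hv, ev⟩
    have hs : c₀ + (b u + v) ∈ S (j + 1) := add_mem hc₀ (add_mem (h.bS _ _ hu) (h.FS _ hv))
    obtain ⟨w, hw, ew⟩ := h0 _ hs (by rw [map_add, map_add, eu, ev, e₀, add_self2])
    refine hn ⟨b w, ⟨w, hw, rfl⟩, ?_⟩
    rw [ew, map_add, map_add, h.bb, h.bF _ _ hv, add_zero, add_zero]
  by_cases ht : ∃ u ∈ S (j + 1), d (b u) = b t₀
  · right
    have hf : ¬ ∃ u ∈ F (j + 1), d u = f₀ := fun h' => hnot ⟨ht, h'⟩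
    refine ⟨?_, f₀, hf₀, df₀, hf, ?_⟩
    · rintro _ ⟨t, ht', rfl⟩ dt
      rcases key t ht' 0 (zero_mem _) dt (map_zero _) with ⟨⟨u, hu, e⟩, -⟩ | ⟨-, h2⟩
      · exact ⟨b u, ⟨u, hu, rfl⟩, e⟩
      · exact absurd (by simpa using h2) hf
    · intro f hf' df
      rcases key 0 (zero_mem _) f hf' (by simp) df with ⟨-, h2⟩ | ⟨-, h2⟩
      · exact Or.inl h2
      · exact Or.inr h2
  · left
    have hf : ∃ u ∈ F (j + 1), d u = f₀ := by
      rcases key 0 (zero_mem _) f₀ hf₀ (by simp) df₀ with ⟨-, h2⟩ | ⟨h2, -⟩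
      · exact h2
      · exact absurd (by simpa using h2) ht
    refine ⟨⟨b t₀, ⟨t₀, ht₀, rfl⟩, dt₀, ?_, ?_⟩, ?_⟩
    · rintro ⟨_, ⟨u, hu, rfl⟩, e⟩
      exact ht ⟨u, hu, e⟩
    · rintro _ ⟨t, ht', rfl⟩ dt
      rcases key t ht' 0 (zero_mem _) dt (map_zero _) with ⟨⟨u, hu, e⟩, -⟩ | ⟨⟨u, hu, e⟩, -⟩
      · exact Or.inl ⟨b u, ⟨u, hu, rfl⟩, e⟩
      · exact Or.inr ⟨b u, ⟨u, hu, rfl⟩, e⟩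
    · intro f hf' df
      rcases key 0 (zero_mem _) f hf' (by simp) df with ⟨-, h2⟩ | ⟨h2, -⟩
      · exact h2
      · exact absurd (by simpa using h2) ht

/-- Below the top degree, if both parts vanish in one degree then they vanish one degree lower. -/
lemma van_step (h : Smith d b S F) {j : ℕ} (hS : Van d S j) (hA : Van d (im b S) (j + 1)) :
    Van d (im b S) j ∧ Van d F j := by
  constructor
  · rintro _ ⟨t, ht, rfl⟩ dt
    obtain ⟨c, hc, e⟩ := hS (b t) (h.bS _ _ ht) dt
    obtain ⟨⟨u, hu, e1⟩, -⟩ := h.inj (f := 0) hA ht (zero_mem _) hc (by simpa using e)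
    exact ⟨b u, ⟨u, hu, rfl⟩, e1⟩
  · intro f hf df
    obtain ⟨c, hc, e⟩ := hS f (h.FS _ hf) df
    exact (h.inj (t := 0) hA (zero_mem _) hf hc (by simpa using e)).2

lemma van_below (h : Smith d b S F) {j : ℕ} (hS : ∀ ℓ < j, Van d S ℓ) (hA : Van d (im b S) j) :
    (∀ ℓ ≤ j, Van d (im b S) ℓ) ∧ ∀ ℓ < j, Van d F ℓ := by
  induction j with
  | zero =>
    refine ⟨fun ℓ hl => ?_, fun ℓ hl => absurd hl (Nat.not_lt_zero _)⟩
    rw [Nat.le_zero.1 hl]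
    exact hA
  | succ j ih =>
    have h1 := h.van_step (hS j (Nat.lt_succ_self j)) hA
    obtain ⟨h2, h3⟩ := ih (fun ℓ hl => hS ℓ (Nat.lt_succ_of_lt hl)) h1.1
    refine ⟨fun ℓ hl => ?_, fun ℓ hl => ?_⟩
    · rcases Nat.lt_or_ge j ℓ with hl' | hl'
      · rw [show ℓ = j + 1 by omega]
        exact hA
      · exact h2 ℓ hl'
    · rcases Nat.lt_or_ge ℓ j with hl' | hl'
      · exact h3 ℓ hl'
      · rw [show ℓ = j by omega]
        exact h1.2

/-- The main theorem of Smith theory for a homology sphere. -/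
theorem main (h : Smith d b S F) {m : ℕ} (hP : Pure d S m) :
    ∃ r, 1 ≤ r ∧ r ≤ m ∧ Pure d F r ∧ (∀ ℓ, ℓ ≤ r ∨ m < ℓ → Van d (im b S) ℓ) ∧
      (∀ ℓ, r < ℓ → ℓ ≤ m → One d (im b S) ℓ) ∧
      (r < m → ∀ s ∈ S m, d s = 0 → ∃ t ∈ S m, ∃ w ∈ S (m + 1), d w = s + b t) := by
  have hvS : ∀ ℓ, m < ℓ → Van d S ℓ := fun ℓ hl => hP.2 ℓ (by omega)
  have hvA := fun ℓ (hl : m < ℓ) => h.van_im hvS hl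
  have hvF := fun ℓ (hl : m < ℓ) => h.van_fix hvS hl
  have hVS0 : Van d S 0 := by
    intro z hz _
    exact ⟨0, zero_mem _, by rw [h.d_zero hz, map_zero]⟩
  have hVA0 : Van d (im b S) 0 := by
    rintro _ ⟨z, hz, rfl⟩ _
    exact ⟨0, zero_mem _, by rw [h.d_zero hz, map_zero, map_zero]⟩
  have hVF0 : Van d F 0 := by
    intro z hz _
    exact ⟨0, zero_mem _, by rw [h.d_zero (h.FS _ hz), map_zero]⟩
  have hm : m ≠ 0 := by
    rintro rfl
    exact hP.1.not_van hVS0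
  obtain ⟨z₀, hz₀, dz₀, hn₀, hu₀⟩ := hP.1
  have hinj := fun {t f w : V} => h.inj (t := t) (f := f) (w := w) (hvA (m + 1) (Nat.lt_succ_self m))
  by_cases hA : Van d (im b S) m
  · have hlow := h.van_below (fun ℓ hl => hP.2 ℓ (by omega)) hA
    refine ⟨m, by omega, le_rfl, ⟨?_, ?_⟩, ?_, ?_, ?_⟩
    · obtain ⟨_, ⟨u, hu, rfl⟩, e⟩ := hA (b z₀) ⟨z₀, hz₀, rfl⟩ (by rw [h.db, dz₀, map_zero])
      obtain ⟨t, ht, f, hf, e1⟩ := h.split_of hz₀ hu e.symm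
      obtain ⟨dt, df⟩ := h.d_comp ht hf (by
        rw [← dz₀, e1, map_add, map_add, map_add, h.dd, zero_add])
      obtain ⟨_, ⟨u', hu', rfl⟩, e'⟩ := hA (b t) ⟨t, ht, rfl⟩ dt
      have e2 : z₀ = d (u + b u') + f := by rw [map_add, e', e1]
      have hU : u + b u' ∈ S (m + 1) := add_mem hu (h.bS _ _ hu')
      refine ⟨f, hf, df, ?_, ?_⟩
      · rintro ⟨w, hw, rfl⟩
        exact hn₀ ⟨_, add_mem hU (h.FS _ hw), by rw [e2, map_add]⟩
      · intro φ hφ dφ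
        rcases hu₀ φ (h.FS _ hφ) dφ with ⟨w, hw, e3⟩ | ⟨w, hw, e3⟩
        · left
          exact (hinj (t := 0) (zero_mem _) hφ hw (by simpa using e3)).2
        · right
          refine (hinj (t := 0) (zero_mem _) (add_mem hφ hf) (add_mem hw hU) ?_).2
          rw [map_add d w, e3, e2, map_zero, zero_add, ← add_eq_zero2]
          abel_nf
          simp only [two_zsmul_eq_zero, add_zero]
    · intro ℓ hl
      rcases Nat.lt_or_gt_of_ne hl with hl | hl
      · exact hlow.2 ℓ hl
      · exact hvF ℓ hl
    · rintro ℓ (hl | hl)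
      · exact hlow.1 ℓ hl
      · exact hvA ℓ hl
    · intro ℓ h1 h2
      omega
    · intro h'
      omega
  · simp only [Van] at hA
    push Not at hA
    obtain ⟨_, ⟨t₀, ht₀, rfl⟩, dt₀, hnt₀⟩ := hA
    have hbn : ¬ ∃ w ∈ S (m + 1), d w = b t₀ := by
      rintro ⟨w, hw, e⟩
      obtain ⟨⟨u, hu, e1⟩, -⟩ := hinj (f := 0) ht₀ (zero_mem _) hw (by simpa using e)
      exact hnt₀ (b u) ⟨u, hu, rfl⟩ e1
    have hgen : ∀ s ∈ S m, d s = 0 →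
        (∃ w ∈ S (m + 1), d w = s) ∨ ∃ w ∈ S (m + 1), d w = s + b t₀ := by
      intro s hs ds
      rcases hu₀ s hs ds with h1 | ⟨w, hw, e⟩
      · exact Or.inl h1
      · right
        rcases hu₀ (b t₀) (h.bS _ _ ht₀) dt₀ with h2 | ⟨w', hw', e'⟩
        · exact absurd h2 hbn
        · refine ⟨w + w', add_mem hw hw', ?_⟩
          rw [map_add, e, e', ← add_eq_zero2]
          abel_nf
          simp only [two_zsmul_eq_zero, add_zero]
    have hOne : One d (im b S) m := by
      refine ⟨b t₀, ⟨t₀, ht₀, rfl⟩, dt₀, ?_, ?_⟩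
      · rintro ⟨_, ⟨u, hu, rfl⟩, e⟩
        exact hnt₀ (b u) ⟨u, hu, rfl⟩ e
      · rintro _ ⟨t, ht, rfl⟩ dt
        rcases hgen (b t) (h.bS _ _ ht) dt with ⟨w, hw, e⟩ | ⟨w, hw, e⟩
        · obtain ⟨⟨u, hu, e1⟩, -⟩ := hinj (f := 0) ht (zero_mem _) hw (by simpa using e)
          exact Or.inl ⟨b u, ⟨u, hu, rfl⟩, e1⟩
        · obtain ⟨⟨u, hu, e1⟩, -⟩ := hinj (t := t + t₀) (f := 0) (add_mem ht ht₀) (zero_mem _) hw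
            (by simpa using e)
          exact Or.inr ⟨b u, ⟨u, hu, rfl⟩, by rw [e1, map_add]⟩
    have hFm : Van d F m := by
      intro f hf df
      rcases hgen f (h.FS _ hf) df with ⟨w, hw, e⟩ | ⟨w, hw, e⟩
      · exact (hinj (t := 0) (zero_mem _) hf hw (by simpa using e)).2
      · exact (hinj ht₀ hf hw (by rw [e, add_comm])).2
    have hzero : ∀ j, j < m → ∀ s ∈ S (j + 1), d s = 0 → ∃ u ∈ S (j + 2), d (b u) = b s := by
      intro j hj s hs ds
      rcases Nat.lt_or_ge (j + 1) m with hj' | hj'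
      · obtain ⟨w, hw, e⟩ := hP.2 (j + 1) (by omega) s hs ds
        exact ⟨w, hw, by rw [h.db, e]⟩
      · obtain rfl : m = j + 1 := by omega
        rcases hgen s hs ds with ⟨w, hw, e⟩ | ⟨w, hw, e⟩
        · exact ⟨w, hw, by rw [h.db, e]⟩
        · exact ⟨w, hw, by rw [h.db, e, map_add, h.bb, add_zero]⟩
    have main : ∀ k ≤ m, One d (im b S) k → (∀ ℓ, k ≤ ℓ → Van d F ℓ) → (∀ ℓ, k ≤ ℓ → ℓ ≤ m →
        One d (im b S) ℓ) → ∃ r, 1 ≤ r ∧ r < k ∧ Pure d F r ∧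
          (∀ ℓ ≤ r, Van d (im b S) ℓ) ∧ (∀ ℓ, r < ℓ → ℓ ≤ m → One d (im b S) ℓ) := by
      intro k
      induction k with
      | zero => exact fun _ h1 => absurd hVA0 h1.not_van
      | succ k ih =>
        intro hk h1 h2 h3
        rcases h.step (hP.2 k (by omega)) (hzero k (by omega)) h1 with ⟨h4, h5⟩ | ⟨h4, h5⟩
        · obtain ⟨r, h6, h7, h8⟩ := ih (by omega) h4 (fun ℓ hl => by
            rcases Nat.eq_or_lt_of_le hl with rfl | hl
            · exact h5
            · exact h2 ℓ hl) (fun ℓ hl hl' => by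
            rcases Nat.eq_or_lt_of_le hl with rfl | hl
            · exact h4
            · exact h3 ℓ hl hl')
          exact ⟨r, h6, by omega, h8⟩
        · have hlow := h.van_below (fun ℓ hl => hP.2 ℓ (by omega)) h4
          refine ⟨k, ?_, by omega, ⟨h5, ?_⟩, hlow.1, fun ℓ hl hl' => h3 ℓ hl hl'⟩
          · rcases k with _ | k
            · exact absurd hVF0 h5.not_van
            · omega
          · intro ℓ hl
            rcases Nat.lt_or_gt_of_ne hl with hl | hl
            · exact hlow.2 ℓ hl
            · exact h2 ℓ hl
    obtain ⟨r, h1, h2, h3, h4, h5⟩ := main m le_rfl hOne (fun ℓ hl => by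
      rcases Nat.eq_or_lt_of_le hl with rfl | hl
      · exact hFm
      · exact hvF ℓ hl) (fun ℓ hl hl' => by
      rw [show ℓ = m by omega]
      exact hOne)
    refine ⟨r, h1, by omega, h3, ?_, h5, ?_⟩
    · rintro ℓ (hl | hl)
      · exact h4 ℓ hl
      · exact hvA ℓ hl
    · intro _ s hs ds
      rcases hgen s hs ds with ⟨w, hw, e⟩ | ⟨w, hw, e⟩
      · exact ⟨0, zero_mem _, w, hw, by simpa using e⟩
      · exact ⟨t₀, ht₀, w, hw, e⟩

/-- If the involution is homotopic to the identity, the dimension cannot drop by one. -/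
theorem drop_ne_one (h : Smith d b S F) {r : ℕ} (hS : Pure d S (r + 1)) (hF : Pure d F r)
    (P : V →ₗ[ZMod 2] V) (hP : ∀ v, d (P v) + P (d v) = b v)
    (hPS : ∀ ℓ, ∀ s ∈ S ℓ, P s ∈ S (ℓ + 1)) (hPF : ∀ ℓ, ∀ s ∈ F ℓ, P s ∈ F (ℓ + 1)) : False := by
  obtain ⟨f, hf, df, hn, -⟩ := hF.1
  obtain ⟨c, hc, e⟩ := hS.2 r (by omega) f (h.FS _ hf) df
  have h1 : d (P f) = 0 := by
    have := hP f
    rwa [df, map_zero, add_zero, h.bF _ _ hf] at this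
  obtain ⟨u, hu, eu⟩ := hF.2 (r + 1) (by omega) (P f) (hPF _ _ hf) h1
  have h2 : d (P c + u) = b c := by rw [map_add, eu, ← e, hP]
  obtain ⟨⟨w, hw, ew⟩, -⟩ := h.inj (f := 0) (h.van_im (fun ℓ hl => hS.2 ℓ (by omega))
    (show r + 1 < r + 1 + 1 by omega)) hc (zero_mem _) (add_mem (hPS _ _ hc) (h.FS _ hu))
    (by simpa using h2)
  obtain ⟨t, ht, f', hf', e3⟩ := h.split_of hc hw ew.symm
  have e4 : b (d t) + d f' = b 0 + f := by
    rw [map_zero, zero_add, ← e, e3, map_add, map_add, h.dd, zero_add, h.db]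
  obtain ⟨-, e5⟩ := h.comp_eq (h.dS _ _ ht) (zero_mem _) (h.dF _ _ hf') hf e4
  exact hn ⟨f', hf', e5⟩

/-- Two commuting involutions whose fixed sets, and whose common fixed set, all have the same
dimension. -/
theorem rank_two {a : V →ₗ[ZMod 2] V} {F' F'' : ℕ → Submodule (ZMod 2) V}
    (hab : ∀ v, a (b v) = b (a v))
    (h : Smith d a S F) (h' : Smith d b (im a S) F') (h'' : Smith d a (im b S) F'')
    (hF' : ∀ ℓ, Van d F' ℓ) (hF'' : ∀ ℓ, Van d F'' ℓ) (hbS : ∀ ℓ, ∀ s ∈ S ℓ, b s ∈ S ℓ)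
    {m r : ℕ} (hS : Pure d S m) (hF : Pure d F r) : m = r := by
  obtain ⟨r', -, hrm, hr', hvA, hoA, hsurj⟩ := h.main hS
  obtain rfl := hF.unique hr'
  by_contra hne
  have hlt : r < m := by omega
  have hvB : ∀ ℓ, m < ℓ → Van d (im b (im a S)) ℓ := fun ℓ hl =>
    h'.van_im (m := m) (fun ℓ hl => hvA ℓ (Or.inr hl)) hl
  -- correcting an element of the image to a cycle
  have corr : ∀ ℓ, Van d (im b (im a S)) ℓ → ∀ s ∈ im a S (ℓ + 1), d (b s) = 0 →
      ∃ s' ∈ im a S (ℓ + 1), d s' = 0 ∧ b s' = b s := by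
    intro ℓ hv s hs e
    obtain ⟨t, ht, f, hf, e1⟩ := h'.split ℓ _ (h'.dS _ _ hs) (by rw [← h'.db, e])
    obtain ⟨dt, df⟩ := h'.d_comp ht hf (by rw [← e1, h'.dd])
    obtain ⟨φ, hφ, eφ⟩ := hF' ℓ f hf df
    obtain ⟨_, ⟨u, hu, rfl⟩, eu⟩ := hv (b t) ⟨t, ht, rfl⟩ dt
    refine ⟨s + (b u + φ), add_mem hs (add_mem (h'.bS _ _ hu) (h'.FS _ hφ)), ?_, ?_⟩
    · rw [map_add, map_add, eu, eφ, e1, add_self2]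
    · rw [map_add, map_add, h'.bb, h'.bF _ _ hφ, add_zero, add_zero]
  have hlow : ∀ ℓ ≤ r, Van d (im b (im a S)) ℓ := by
    intro ℓ
    induction ℓ with
    | zero =>
      rintro - _ ⟨s, hs, rfl⟩ -
      rw [h'.d_zero hs]
      exact ⟨0, zero_mem _, by simp⟩
    | succ ℓ ih =>
      rintro hl _ ⟨s, hs, rfl⟩ e
      obtain ⟨s', hs', e1, e2⟩ := corr ℓ (ih (by omega)) s hs e
      obtain ⟨w, hw, ew⟩ := hvA (ℓ + 1) (Or.inl hl) s' hs' e1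
      exact ⟨b w, ⟨w, hw, rfl⟩, by rw [h'.db, ew, e2]⟩
  have top : ∃ z ∈ im b (im a S) m, d z = 0 ∧ ¬ ∃ w ∈ im a S (m + 1), d w = z := by
    obtain ⟨p, hp, dp, hn, -⟩ := hoA m hlt le_rfl
    by_cases hb : ∃ u ∈ im a S (m + 1), d (b u) = b p
    · obtain ⟨u, hu, e⟩ := hb
      obtain ⟨t, ht, f, hf, e1⟩ := h'.split_of hp hu e.symm
      obtain ⟨dt, df⟩ := h'.d_comp ht hf (by
        rw [← dp, e1, map_add, map_add, map_add, h'.dd, zero_add])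
      obtain ⟨φ, hφ, eφ⟩ := hF' m f hf df
      refine ⟨b t, ⟨t, ht, rfl⟩, dt, ?_⟩
      rintro ⟨w, hw, ew⟩
      refine hn ⟨u + w + φ, add_mem (add_mem hu hw) (h'.FS _ hφ), ?_⟩
      rw [map_add, map_add, ew, eφ, ← e1]
    · refine ⟨b p, ⟨p, hp, rfl⟩, by rw [h'.db, dp, map_zero], ?_⟩
      rintro ⟨w, hw, ew⟩
      exact hb (h'.inj (f := 0) (hvB (m + 1) (by omega)) hp (zero_mem _) hw
        (by simpa using ew)).1
  have down : ∀ j, r < j → j < m →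
      (∃ z ∈ im b (im a S) (j + 1), d z = 0 ∧ ¬ ∃ w ∈ im a S (j + 2), d w = z) →
      ∃ z ∈ im b (im a S) j, d z = 0 ∧ ¬ ∃ w ∈ im a S (j + 1), d w = z := by
    rintro j hrj hjm ⟨_, ⟨_, ⟨c, hc, rfl⟩, rfl⟩, dz, hz⟩
    have hbc : b c ∈ im b S (j + 1) := ⟨c, hc, rfl⟩
    obtain ⟨_, ⟨t, ht, rfl⟩, f, hf, e1⟩ := h''.split j _ (h''.dS _ _ hbc)
      (by rw [← h''.db, hab, dz])
    have htb : b t ∈ im b S j := ⟨t, ht, rfl⟩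
    obtain ⟨dt, df⟩ := h''.d_comp htb hf (by rw [← e1, h.dd])
    obtain ⟨φ, hφ, eφ⟩ := hF'' j f hf df
    refine ⟨a (b t), ⟨a t, ⟨t, ht, rfl⟩, (hab t).symm⟩, dt, ?_⟩
    rintro ⟨_, ⟨e, he, rfl⟩, ee⟩
    have hφS : φ ∈ S (j + 1) := by
      obtain ⟨y, hy, rfl⟩ := h''.FS _ hφ
      exact hbS _ _ hy
    have hs : b c + φ + a e ∈ S (j + 1) :=
      add_mem (add_mem (hbS _ _ hc) hφS) (h.bS _ _ he)
    have ds : d (b c + φ + a e) = 0 := by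
      rw [map_add, map_add, ee, eφ, e1, ← add_eq_zero2.2 (rfl : a (b t) + f = a (b t) + f)]
      abel_nf
    have as : a (b c + φ + a e) = b (a c) := by
      rw [map_add, map_add, h.bb, h''.bF _ _ hφ, add_zero, add_zero, hab]
    rcases Nat.lt_or_ge (j + 1) m with hj | hj
    · obtain ⟨w, hw, ew⟩ := hS.2 (j + 1) (by omega) _ hs ds
      exact hz ⟨a w, ⟨w, hw, rfl⟩, by rw [h.db, ew, as]⟩
    · obtain rfl : m = j + 1 := by omega
      obtain ⟨t', -, w, hw, ew⟩ := hsurj hlt _ hs ds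
      exact hz ⟨a w, ⟨w, hw, rfl⟩, by rw [h.db, ew, map_add, h.bb, as, add_zero]⟩
  have all : ∀ k, k < m - r → ∃ z ∈ im b (im a S) (m - k), d z = 0 ∧
      ¬ ∃ w ∈ im a S (m - k + 1), d w = z := by
    intro k
    induction k with
    | zero => exact fun _ => top
    | succ k ih =>
      intro hk
      have hj : m - k = m - (k + 1) + 1 := by omega
      have := ih (by omega)
      rw [hj] at this
      exact down _ (by omega) (by omega) this
  have hbot := all (m - r - 1) (by omega)
  rw [show m - (m - r - 1) = r + 1 by omega] at hbot
  obtain ⟨_, ⟨s, hs, rfl⟩, dz, hz⟩ := hbot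
  obtain ⟨s', hs', e1, e2⟩ := corr r (hlow r le_rfl) s hs dz
  obtain ⟨z₁, -, -, -, hu⟩ := hoA (r + 1) (by omega) (by omega)
  have hbs : b s ∈ im a S (r + 1) := h'.bS _ _ hs
  have fin1 : ∀ w ∈ im a S (r + 2), d w = s' → False := fun w hw ew =>
    hz ⟨b w, h'.bS _ _ hw, by rw [h'.db, ew, e2]⟩
  rcases hu s' hs' e1 with ⟨w, hw, ew⟩ | ⟨w, hw, ew⟩
  · exact fin1 w hw ew
  · rcases hu (b s) hbs dz with ⟨w', hw', ew'⟩ | ⟨w', hw', ew'⟩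
    · exact hz ⟨w', hw', ew'⟩
    · have e3 : d (w + w') = s' + b s := by
        rw [map_add, ew, ew', ← add_eq_zero2]
        abel_nf
        simp only [two_zsmul_eq_zero, add_zero]
      refine hz ⟨b (w + w'), h'.bS _ _ (add_mem hw hw'), ?_⟩
      rw [h'.db, e3, map_add, h'.bb, add_zero, e2]

end Smith

end Abstract

end InfChain

/-! ## Germs of infinitesimal chains -/

namespace InfChain

open Filter Topology

noncomputable section

/-- A fixed nonprincipal ultrafilter on the natural numbers. -/
abbrev UF : Ultrafilter ℕ := hyperfilter ℕ

lemma UF_le : (UF : Filter ℕ) ≤ atTop := Nat.hyperfilter_le_atTop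

section Germ

variable {E : Type*} [NormedAddCommGroup E]

/-- Lists all of whose vertices have norm at least `δ`. -/
def Far (E : Type*) [NormedAddCommGroup E] (δ : ℝ) : Set (List E) := {σ | ∀ v ∈ σ, δ ≤ ‖v‖}

lemma Far_anti {δ δ' : ℝ} (h : δ ≤ δ') : Far E δ' ⊆ Far E δ := fun _ hσ v hv => h.trans (hσ v hv)

/-- Sequences of chains that stay away from the origin. -/
def nullSeq (E : Type*) [NormedAddCommGroup E] : Submodule (ZMod 2) (ℕ → LC E) where
  carrier := {c | ∃ δ > 0, ∀ᶠ i in (UF : Filter ℕ), c i ∈ sp (Far E δ)}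
  add_mem' := by
    rintro c c' ⟨δ, hδ, h⟩ ⟨δ', hδ', h'⟩
    refine ⟨min δ δ', lt_min hδ hδ', ?_⟩
    filter_upwards [h, h'] with i hi hi'
    exact add_mem (Finsupp.supported_mono (Far_anti (min_le_left _ _)) hi)
      (Finsupp.supported_mono (Far_anti (min_le_right _ _)) hi')
  zero_mem' := ⟨1, one_pos, Eventually.of_forall fun _ => zero_mem _⟩
  smul_mem' := by
    rintro r c ⟨δ, hδ, h⟩
    exact ⟨δ, hδ, h.mono fun i hi => Submodule.smul_mem _ _ hi⟩

/-- Germs at the origin of sequences of chains. -/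
abbrev Ger (E : Type*) [NormedAddCommGroup E] := (ℕ → LC E) ⧸ nullSeq E

/-- The germ of a sequence. -/
abbrev mk : (ℕ → LC E) →ₗ[ZMod 2] Ger E := (nullSeq E).mkQ

lemma mk_surj (v : Ger E) : ∃ c, mk c = v := (nullSeq E).mkQ_surjective v

lemma mk_eq_zero {c : ℕ → LC E} :
    mk c = 0 ↔ ∃ δ > 0, ∀ᶠ i in (UF : Filter ℕ), c i ∈ sp (Far E δ) :=
  Submodule.Quotient.mk_eq_zero _

lemma mk_eq {c c' : ℕ → LC E} :
    mk c = mk c' ↔ ∃ δ > 0, ∀ᶠ i in (UF : Filter ℕ), c i + c' i ∈ sp (Far E δ) := by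
  rw [← add_eq_zero2, ← map_add, mk_eq_zero]
  rfl

lemma mk_congr {c c' : ℕ → LC E} (h : ∀ᶠ i in (UF : Filter ℕ), c i = c' i) : mk c = mk c' := by
  rw [mk_eq]
  refine ⟨1, one_pos, h.mono fun i hi => ?_⟩
  rw [hi, add_self2]
  exact zero_mem _

/-- Sequences of operators that respect distance from the origin. -/
def Pres (T : ℕ → LC E →ₗ[ZMod 2] LC E) : Prop :=
  ∀ δ > 0, ∃ δ' > 0, ∀ᶠ i in (UF : Filter ℕ), ∀ σ ∈ Far E δ, T i (bs σ) ∈ sp (Far E δ')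

/-- The operator on germs induced by a sequence of operators. -/
def op (T : ℕ → LC E →ₗ[ZMod 2] LC E) (h : Pres T) : Ger E →ₗ[ZMod 2] Ger E :=
  (nullSeq E).mapQ (nullSeq E) (LinearMap.pi fun i => T i ∘ₗ LinearMap.proj i) <| by
    rintro c ⟨δ, hδ, hc⟩
    obtain ⟨δ', hδ', h'⟩ := h δ hδ
    refine ⟨δ', hδ', ?_⟩
    filter_upwards [hc, h'] with i h1 h2
    exact map_mem_of_sp _ h2 h1

lemma op_mk (T : ℕ → LC E →ₗ[ZMod 2] LC E) (h : Pres T) (c : ℕ → LC E) :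
    op T h (mk c) = mk (fun i => T i (c i)) := rfl

/-- Lists of given length in `X` of diameter less than `ε`. -/
def Sm (X : Set E) (ℓ : ℕ) (ε : ℝ) : Set (List E) :=
  {σ | σ.length = ℓ ∧ ∀ v ∈ σ, v ∈ X ∧ ∀ u ∈ σ, dist u v < ε}

/-- Small lists close to the origin. -/
def Nr (X : Set E) (ℓ : ℕ) (ε ρ : ℝ) : Set (List E) := Sm X ℓ ε ∩ {σ | ∀ v ∈ σ, ‖v‖ < ρ}

lemma Sm_mono {X Y : Set E} {ℓ : ℕ} {ε ε' : ℝ} (h : X ⊆ Y) (he : ε ≤ ε') :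
    Sm X ℓ ε ⊆ Sm Y ℓ ε' :=
  fun _ hσ => ⟨hσ.1, fun v hv => ⟨h (hσ.2 v hv).1, fun u hu => ((hσ.2 v hv).2 u hu).trans_le he⟩⟩

/-- Sequences of chains in `X` whose mesh tends to zero. -/
def Adm (X : Set E) (ℓ : ℕ) : Submodule (ZMod 2) (ℕ → LC E) where
  carrier := {c | ∀ ε > 0, ∀ᶠ i in (UF : Filter ℕ), c i ∈ sp (Sm X ℓ ε)}
  add_mem' := fun hc hc' ε hε => by
    filter_upwards [hc ε hε, hc' ε hε] with i h h'
    exact add_mem h h'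
  zero_mem' := fun _ _ => Eventually.of_forall fun _ => zero_mem _
  smul_mem' := fun _ _ hc ε hε => (hc ε hε).mono fun _ hi => Submodule.smul_mem _ _ hi

/-- Germs of infinitesimal chains in `X`. -/
def Ch (X : Set E) (ℓ : ℕ) : Submodule (ZMod 2) (Ger E) := (Adm X ℓ).map mk

lemma Ch_mono {X Y : Set E} (h : X ⊆ Y) (ℓ : ℕ) : Ch X ℓ ≤ Ch Y ℓ :=
  Submodule.map_mono fun _ hc ε hε =>
    (hc ε hε).mono fun _ hi => Finsupp.supported_mono (Sm_mono h le_rfl) hi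

lemma mk_mem_Ch {X : Set E} {ℓ : ℕ} {c : ℕ → LC E}
    (h : ∀ ε > 0, ∀ᶠ i in (UF : Filter ℕ), c i ∈ sp (Sm X ℓ ε)) : mk c ∈ Ch X ℓ := ⟨c, h, rfl⟩

lemma Ch_zero (X : Set E) : Ch X 0 = ⊥ := by
  rw [eq_bot_iff]
  rintro _ ⟨c, hc, rfl⟩
  rw [Submodule.mem_bot, mk_eq_zero]
  refine ⟨1, one_pos, (hc 1 one_pos).mono fun i hi => Finsupp.supported_mono ?_ hi⟩
  intro σ hσ
  rw [List.eq_nil_of_length_eq_zero hσ.1]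
  intro v hv
  simp at hv

/-- A germ has a representative close to the origin. -/
lemma exists_near {X : Set E} {ℓ : ℕ} {z : Ger E} (hz : z ∈ Ch X ℓ) {ρ : ℝ} (hρ : 0 < ρ) :
    ∃ c, mk c = z ∧ ∀ ε > 0, ∀ᶠ i in (UF : Filter ℕ), c i ∈ sp (Nr X ℓ ε ρ) := by
  classical
  obtain ⟨c, hc, rfl⟩ := hz
  refine ⟨fun i => restr {σ | ∃ v ∈ σ, ‖v‖ < ρ / 2} (c i), ?_, ?_⟩
  · rw [mk_eq]
    refine ⟨ρ / 2, by positivity, Eventually.of_forall fun i => ?_⟩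
    rw [Finsupp.mem_supported']
    intro σ hσ
    rw [Finsupp.add_apply, restr_apply, if_pos, add_self2]
    simpa [Far] using hσ
  · intro ε hε
    filter_upwards [hc (min ε (ρ / 2)) (by positivity)] with i hi
    refine Finsupp.supported_mono ?_ (restr_mem _ _ hi)
    rintro σ ⟨hσ, v, hv, hvρ⟩
    refine ⟨Sm_mono subset_rfl (min_le_left _ _) hσ, fun u hu => ?_⟩
    have h1 : dist u v < ρ / 2 := ((hσ.2 v hv).2 u hu).trans_le (min_le_right _ _)
    rw [dist_eq_norm] at h1
    have h2 := norm_add_le (u - v) v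
    rw [sub_add_cancel] at h2
    linarith

lemma op_mem_Ch {T : ℕ → LC E →ₗ[ZMod 2] LC E} (h : Pres T) {X X' : Set E} {ℓ ℓ' : ℕ} {ρ : ℝ}
    (hρ : 0 < ρ) (hT : ∀ ε > 0, ∃ ε' > 0, ∀ᶠ i in (UF : Filter ℕ), ∀ σ ∈ Nr X ℓ ε' ρ,
      T i (bs σ) ∈ sp (Sm X' ℓ' ε)) {z : Ger E} (hz : z ∈ Ch X ℓ) : op T h z ∈ Ch X' ℓ' := by
  obtain ⟨c, rfl, hc⟩ := exists_near hz hρ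
  rw [op_mk]
  refine mk_mem_Ch fun ε hε => ?_
  obtain ⟨ε', hε', h'⟩ := hT ε hε
  filter_upwards [hc ε' hε', h'] with i h1 h2
  exact map_mem_of_sp _ h2 h1

/-! ### The boundary -/

lemma pres_bd : Pres (E := E) fun _ => bd := fun δ hδ => ⟨δ, hδ, Eventually.of_forall fun _ σ hσ => by
  rw [bd_bs]
  refine Finsupp.supported_mono ?_ (bdL_mem σ)
  exact fun τ hτ v hv => hσ v (hτ.2 v hv)⟩

/-- The boundary operator on germs. -/
def dV : Ger E →ₗ[ZMod 2] Ger E := op _ pres_bd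

lemma dV_mk (c : ℕ → LC E) : dV (mk c) = mk (fun i => bd (c i)) := rfl

lemma dV_dV (v : Ger E) : dV (dV v) = 0 := by
  obtain ⟨c, rfl⟩ := mk_surj v
  simp only [dV_mk, bd_bd]
  exact map_zero mk

lemma dV_mem {X : Set E} {ℓ : ℕ} {z : Ger E} (hz : z ∈ Ch X (ℓ + 1)) : dV z ∈ Ch X ℓ := by
  refine op_mem_Ch _ one_pos (fun ε hε => ⟨ε, hε, Eventually.of_forall fun _ σ hσ => ?_⟩) hz
  rw [bd_bs]
  refine Finsupp.supported_mono ?_ (bdL_mem σ)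
  rintro τ ⟨h1, h2⟩
  have h3 := hσ.1.1
  exact ⟨by omega, fun v hv => ⟨(hσ.1.2 v (h2 v hv)).1, fun u hu =>
    (hσ.1.2 v (h2 v hv)).2 u (h2 u hu)⟩⟩

/-! ### Restriction -/

lemma pres_restr (D : Set (List E)) : Pres (fun _ => restr D) := fun δ hδ =>
  ⟨δ, hδ, Eventually.of_forall fun _ _ hσ =>
    Finsupp.supported_mono Set.inter_subset_left (restr_mem D _ (bs_mem hσ))⟩

/-- Restriction to a set of lists on germs. -/
def resV (D : Set (List E)) : Ger E →ₗ[ZMod 2] Ger E := op _ (pres_restr D)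

lemma resV_mk (D : Set (List E)) (c : ℕ → LC E) :
    resV D (mk c) = mk (fun i => restr D (c i)) := rfl

lemma resV_mem {D : Set (List E)} {X Y : Set E} {ℓ : ℕ}
    (hY : ∀ σ ∈ D, (∀ v ∈ σ, v ∈ X) → ∀ v ∈ σ, v ∈ Y) {z : Ger E} (hz : z ∈ Ch X ℓ) :
    resV D z ∈ Ch Y ℓ := by
  refine op_mem_Ch _ one_pos (fun ε hε => ⟨ε, hε, Eventually.of_forall fun _ σ hσ => ?_⟩) hz
  refine Finsupp.supported_mono ?_ (restr_mem D _ (bs_mem hσ))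
  rintro τ ⟨h1, h2⟩
  exact ⟨h1.1.1, fun v hv => ⟨hY τ h2 (fun u hu => (h1.1.2 u hu).1) v hv, (h1.1.2 v hv).2⟩⟩

lemma resV_eq_self {D : Set (List E)} {X : Set E} {ℓ : ℕ} (hD : ∀ σ, (∀ v ∈ σ, v ∈ X) → σ ∈ D)
    {z : Ger E} (hz : z ∈ Ch X ℓ) : resV D z = z := by
  obtain ⟨c, hc, rfl⟩ := hz
  rw [resV_mk]
  refine mk_congr ((hc 1 one_pos).mono fun i hi => restr_eq_self ?_)
  exact Finsupp.supported_mono (fun σ hσ => hD σ fun v hv => (hσ.2 v hv).1) hi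

lemma Ch_inter {X Y : Set E} {ℓ : ℕ} {z : Ger E} (hX : z ∈ Ch X ℓ) (hY : z ∈ Ch Y ℓ) :
    z ∈ Ch (X ∩ Y) ℓ := by
  have h : resV {σ | ∀ v ∈ σ, v ∈ Y} z = z := resV_eq_self (fun _ h => h) hY
  rw [← h]
  refine resV_mem (X := X) ?_ hX; intro σ h1 h2 v hv; exact ⟨h2 v hv, h1 v hv⟩

/-! ### Sequences of maps -/

/-- Sequences of maps that respect distance from the origin. -/
def FarMap (f : ℕ → E → E) : Prop :=
  ∀ δ > 0, ∃ δ' > 0, ∀ᶠ i in (UF : Filter ℕ), ∀ y, δ ≤ ‖y‖ → δ' ≤ ‖f i y‖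

lemma FarMap.pres {f : ℕ → E → E} (hf : FarMap f) : Pres fun i => lmap (f i) := fun δ hδ => by
  obtain ⟨δ', hδ', h⟩ := hf δ hδ
  refine ⟨δ', hδ', h.mono fun i hi σ hσ => ?_⟩
  rw [lmap_bs]
  refine bs_mem fun v hv => ?_
  obtain ⟨u, hu, rfl⟩ := List.mem_map.1 hv
  exact hi u (hσ u hu)

/-- The operator on germs induced by a sequence of maps. -/
def mapV (f : ℕ → E → E) (hf : FarMap f) : Ger E →ₗ[ZMod 2] Ger E := op _ hf.pres

lemma mapV_mk (f : ℕ → E → E) (hf : FarMap f) (c : ℕ → LC E) :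
    mapV f hf (mk c) = mk (fun i => lmap (f i) (c i)) := rfl

lemma mapV_dV (f : ℕ → E → E) (hf : FarMap f) (v : Ger E) :
    mapV f hf (dV v) = dV (mapV f hf v) := by
  obtain ⟨c, rfl⟩ := mk_surj v
  simp only [dV_mk, mapV_mk, bd_lmap]

lemma mapV_mem {f : ℕ → E → E} (hf : FarMap f) {X X' : Set E} {ℓ : ℕ} {ρ : ℝ} (hρ : 0 < ρ)
    (h : ∀ ε > 0, ∃ ε' > 0, ∀ᶠ i in (UF : Filter ℕ), ∀ y ∈ X, ‖y‖ < ρ →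
      f i y ∈ X' ∧ ∀ y' ∈ X, ‖y'‖ < ρ → dist y y' < ε' → dist (f i y) (f i y') < ε)
    {z : Ger E} (hz : z ∈ Ch X ℓ) : mapV f hf z ∈ Ch X' ℓ := by
  refine op_mem_Ch _ hρ (fun ε hε => ?_) hz
  obtain ⟨ε', hε', h'⟩ := h ε hε
  refine ⟨ε', hε', h'.mono fun i hi σ hσ => ?_⟩
  rw [lmap_bs]
  refine bs_mem ⟨by rw [List.length_map, hσ.1.1], fun v hv => ?_⟩
  obtain ⟨v', hv', rfl⟩ := List.mem_map.1 hv
  have h1 := hi v' (hσ.1.2 v' hv').1 (hσ.2 v' hv')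
  refine ⟨h1.1, fun u hu => ?_⟩
  obtain ⟨u', hu', rfl⟩ := List.mem_map.1 hu
  rw [dist_comm]
  refine h1.2 u' (hσ.1.2 u' hu').1 (hσ.2 u' hu') ?_
  rw [dist_comm]
  exact (hσ.1.2 v' hv').2 u' hu'

lemma mapV_eq_self {f : ℕ → E → E} (hf : FarMap f) {X : Set E} {ℓ : ℕ} {ρ : ℝ} (hρ : 0 < ρ)
    (h : ∀ᶠ i in (UF : Filter ℕ), ∀ y ∈ X, ‖y‖ < ρ → f i y = y)
    {z : Ger E} (hz : z ∈ Ch X ℓ) : mapV f hf z = z := by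
  obtain ⟨c, rfl, hc⟩ := exists_near hz hρ
  rw [mapV_mk]
  refine mk_congr ?_
  filter_upwards [h, hc 1 one_pos] with i h1 h2
  have : lmap (f i) (c i) + c i ∈ (⊥ : Submodule (ZMod 2) (LC E)) := by
    refine map_mem_of_sp (lmap (f i) + LinearMap.id) (fun σ hσ => ?_) h2
    have : σ.map (f i) = σ := by
      rw [List.map_congr_left (g := id) fun v hv => h1 v (hσ.1.2 v hv).1 (hσ.2 v hv), List.map_id]
    simp [this, add_self2]
  exact eq_of_add_eq_zero2 ((Submodule.mem_bot _).1 this)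

/-- A sequence of maps moving everything away from the origin kills germs. -/
lemma mapV_eq_zero {f : ℕ → E → E} (hf : FarMap f) {X : Set E} {ℓ : ℕ} {ρ δ : ℝ} (hρ : 0 < ρ)
    (hδ : 0 < δ) (h : ∀ᶠ i in (UF : Filter ℕ), ∀ y ∈ X, ‖y‖ < ρ → δ ≤ ‖f i y‖)
    {z : Ger E} (hz : z ∈ Ch X ℓ) : mapV f hf z = 0 := by
  obtain ⟨c, rfl, hc⟩ := exists_near hz hρ
  rw [mapV_mk, mk_eq_zero]
  refine ⟨δ, hδ, ?_⟩
  filter_upwards [h, hc 1 one_pos] with i h1 h2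
  refine map_mem_of_sp _ (fun σ hσ => ?_) h2
  rw [lmap_bs]
  refine bs_mem fun v hv => ?_
  obtain ⟨u, hu, rfl⟩ := List.mem_map.1 hv
  exact h1 u (hσ.1.2 u hu).1 (hσ.2 u hu)

/-! ### Homotopies -/

/-- Sequences of finite sequences of maps that respect distance from the origin. -/
def FarHom (F : ℕ → ℕ → E → E) (N : ℕ → ℕ) : Prop :=
  ∀ δ > 0, ∃ δ' > 0, ∀ᶠ i in (UF : Filter ℕ), ∀ k ≤ N i, ∀ y, δ ≤ ‖y‖ → δ' ≤ ‖F i k y‖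

lemma FarHom.pres {F : ℕ → ℕ → E → E} {N : ℕ → ℕ} (hF : FarHom F N) :
    Pres fun i => homot (F i) (N i) := fun δ hδ => by
  obtain ⟨δ', hδ', h⟩ := hF δ hδ
  refine ⟨δ', hδ', h.mono fun i hi σ hσ => ?_⟩
  refine Finsupp.supported_mono ?_ (homot_mem _ _ _)
  rintro τ ⟨-, k, hk, h2⟩ u hu
  obtain ⟨v, hv, rfl | rfl⟩ := h2 u hu
  · exact hi k hk.le v (hσ v hv)
  · exact hi (k + 1) hk v (hσ v hv)

lemma FarHom.zero {F : ℕ → ℕ → E → E} {N : ℕ → ℕ} (hF : FarHom F N) : FarMap fun i => F i 0 :=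
  fun δ hδ => by
    obtain ⟨δ', hδ', h⟩ := hF δ hδ
    exact ⟨δ', hδ', h.mono fun i hi => hi 0 (Nat.zero_le _)⟩

lemma FarHom.last {F : ℕ → ℕ → E → E} {N : ℕ → ℕ} (hF : FarHom F N) :
    FarMap fun i => F i (N i) :=
  fun δ hδ => by
    obtain ⟨δ', hδ', h⟩ := hF δ hδ
    exact ⟨δ', hδ', h.mono fun i hi => hi (N i) le_rfl⟩

/-- The homotopy operator on germs. -/
def homV (F : ℕ → ℕ → E → E) (N : ℕ → ℕ) (hF : FarHom F N) : Ger E →ₗ[ZMod 2] Ger E :=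
  op _ hF.pres

lemma homV_mk (F : ℕ → ℕ → E → E) (N : ℕ → ℕ) (hF : FarHom F N) (c : ℕ → LC E) :
    homV F N hF (mk c) = mk (fun i => homot (F i) (N i) (c i)) := rfl

lemma dV_homV (F : ℕ → ℕ → E → E) (N : ℕ → ℕ) (hF : FarHom F N) (v : Ger E) :
    dV (homV F N hF v) + homV F N hF (dV v) = mapV _ hF.zero v + mapV _ hF.last v := by
  obtain ⟨c, rfl⟩ := mk_surj v
  simp only [dV_mk, homV_mk, mapV_mk, ← map_add]
  congr 1
  funext i
  exact bd_homot _ _ _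

lemma homV_mem {F : ℕ → ℕ → E → E} {N : ℕ → ℕ} (hF : FarHom F N) {X X' : Set E} {ℓ : ℕ}
    {ρ : ℝ} (hρ : 0 < ρ)
    (h : ∀ ε > 0, ∃ ε' > 0, ∀ᶠ i in (UF : Filter ℕ), ∀ k ≤ N i, ∀ y ∈ X, ‖y‖ < ρ →
      F i k y ∈ X' ∧ ∀ k' ≤ N i, k ≤ k' → k' ≤ k + 1 → ∀ y' ∈ X, ‖y'‖ < ρ → dist y y' < ε' →
        dist (F i k y) (F i k' y') < ε)
    {z : Ger E} (hz : z ∈ Ch X ℓ) : homV F N hF z ∈ Ch X' (ℓ + 1) := by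
  refine op_mem_Ch _ hρ (fun ε hε => ?_) hz
  obtain ⟨ε', hε', h'⟩ := h ε hε
  refine ⟨ε', hε', h'.mono fun i hi σ hσ => ?_⟩
  refine Finsupp.supported_mono ?_ (homot_mem _ _ _)
  rintro τ ⟨h1, k, hk, h2⟩
  have key : ∀ u ∈ τ, ∃ w ∈ σ, ∃ j, (j = k ∨ j = k + 1) ∧ u = F i j w := by
    intro u hu
    obtain ⟨w, hw, h3 | h3⟩ := h2 u hu
    · exact ⟨w, hw, k, Or.inl rfl, h3⟩
    · exact ⟨w, hw, k + 1, Or.inr rfl, h3⟩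
  refine ⟨by rw [h1, hσ.1.1], fun v hv => ?_⟩
  obtain ⟨v', hv', j, hj, rfl⟩ := key v hv
  refine ⟨(hi j (by omega) v' (hσ.1.2 v' hv').1 (hσ.2 v' hv')).1, fun u hu => ?_⟩
  obtain ⟨u', hu', j', hj', rfl⟩ := key u hu
  have hd := (hσ.1.2 v' hv').2 u' hu'
  rcases le_total j j' with hjj | hjj
  · rw [dist_comm]
    refine (hi j (by omega) v' (hσ.1.2 v' hv').1 (hσ.2 v' hv')).2 j' (by omega) hjj (by omega) u'
      (hσ.1.2 u' hu').1 (hσ.2 u' hu') ?_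
    rwa [dist_comm]
  · exact (hi j' (by omega) u' (hσ.1.2 u' hu').1 (hσ.2 u' hu')).2 j (by omega) hjj (by omega) v'
      (hσ.1.2 v' hv').1 (hσ.2 v' hv') hd

end Germ

/-- Choose a null sequence of thresholds for an eventually satisfied monotone condition. -/
lemma exists_threshold {P : ℝ → ℕ → Prop} (h : ∀ ε > 0, ∀ᶠ i in (UF : Filter ℕ), P ε i) :
    ∃ η : ℕ → ℝ, (∀ i, 0 < η i) ∧ (∀ ε > 0, ∀ᶠ i in (UF : Filter ℕ), η i < ε) ∧
      ∀ᶠ i in (UF : Filter ℕ), P (η i) i := by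
  classical
  have hpos : ∀ j : ℕ, (0 : ℝ) < 1 / ((j : ℝ) + 1) := fun j => Nat.one_div_pos_of_nat
  let Q : ℕ → ℕ → Prop := fun i j => P (1 / ((j : ℝ) + 1)) i
  refine ⟨fun i => 1 / ((Nat.findGreatest (Q i) i : ℝ) + 1), fun i => hpos _, fun ε hε => ?_, ?_⟩
  · obtain ⟨j, hj⟩ := exists_nat_one_div_lt hε
    filter_upwards [h _ (hpos j), UF_le (eventually_ge_atTop j)] with i h1 h2
    refine lt_of_le_of_lt ?_ hj
    exact Nat.one_div_le_one_div (Nat.le_findGreatest (P := Q i) h2 h1)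
  · filter_upwards [h _ (hpos 0)] with i hi
    exact Nat.findGreatest_spec (P := Q i) (Nat.zero_le i) hi

end

end InfChain

/-! ## Smith theory from selectors -/

namespace InfChain

section Selectors

variable {V : Type*} [AddCommGroup V] [Module (ZMod 2) V]

/-- Commuting operators underlying an instance of Smith theory: a differential `d`, an involution
`h`, a projection `ρ` onto the part spanned by simplices in the singular set, and a transfer `p`. -/
structure SmithBase (d h ρ p : V →ₗ[ZMod 2] V) : Prop where
  dd : ∀ v, d (d v) = 0
  hh : ∀ v, h (h v) = v
  dh : ∀ v, d (h v) = h (d v)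
  ρρ : ∀ v, ρ (ρ v) = ρ v
  ρh : ∀ v, ρ (h v) = h (ρ v)
  ρd : ∀ v, ρ (d (ρ v)) = d (ρ v)
  pd : ∀ v, d (p v) = p (d v)
  ph : ∀ v, h (p v) = p (h v)
  pρ : ∀ v, ρ (p v) = p (ρ v)
  kill : ∀ v, h (ρ (p v)) = ρ (p v)

/-- A selector `χ` chooses one element in each free orbit of the involution. -/
structure Selector (h ρ p χ : V →ₗ[ZMod 2] V) : Prop where
  hχ : ∀ v, h (χ v) + χ (h v) = h v + h (ρ v)
  χρ : ∀ v, χ (ρ v) = 0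
  pχ : ∀ v, χ (p v) = p (χ v)

variable {d h ρ p χ : V →ₗ[ZMod 2] V}

lemma SmithBase.sel_b (hB : SmithBase d h ρ p) (hS : Selector h ρ p χ) (v : V) :
    p v + h (p v) + h (χ (p v + h (p v))) = χ (p v + h (p v)) := by
  have h1 := hS.hχ (p v + h (p v))
  have h2 := hB.kill v
  have h3 : ρ (h (p v)) = ρ (p v) := by rw [hB.ρh, h2]
  rw [map_add h (p v) (h (p v)), hB.hh, map_add ρ, h3, add_self2, map_zero, add_zero,
    add_comm (h (p v)) (p v)] at h1
  rw [← add_eq_zero2] at h1 ⊢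
  rw [← h1]
  abel

lemma SmithBase.comm_b (hB : SmithBase d h ρ p) (hS : Selector h ρ p χ) (v : V) :
    ∃ f, ρ f = f ∧ d (χ (v + h v)) + χ (d (v + h v)) =
      (d (χ v) + χ (d v)) + h (d (χ v) + χ (d v)) + f := by
  refine ⟨h (d (ρ v) + ρ (d v)), ?_, ?_⟩
  · rw [hB.ρh, map_add, hB.ρd, hB.ρρ]
  · have h1 := congrArg d (hS.hχ v)
    have h2 := hS.hχ (d v)
    simp only [map_add, hB.dh] at h1 h2 ⊢
    have h3 : h (d (ρ v)) = h (d (χ v)) + d (χ (h v)) + h (d v) := by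
      rw [h1, ← add_eq_zero2]; abel_nf; simp only [two_zsmul_eq_zero, add_zero]
    have h4 : h (ρ (d v)) = h (χ (d v)) + χ (h (d v)) + h (d v) := by
      rw [h2, ← add_eq_zero2]; abel_nf; simp only [two_zsmul_eq_zero, add_zero]
    rw [h3, h4, ← add_eq_zero2]
    abel_nf
    simp only [two_zsmul_eq_zero, add_zero]

lemma SmithBase.sel_kill (hB : SmithBase d h ρ p) (hS : Selector h ρ p χ) {f : V} (hf : ρ f = f) :
    χ f = 0 ∧ d (χ f) + χ (d f) = 0 := by
  have h1 : χ f = 0 := by rw [← hf, hS.χρ]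
  refine ⟨h1, ?_⟩
  rw [h1, map_zero, zero_add, ← hf, ← hB.ρd, hS.χρ]

/-- The chain version of the nilpotency of the Smith operator. -/
theorem SmithBase.nil (hB : SmithBase d h ρ p) {ι : Type*} (C : ℕ → Submodule (ZMod 2) V)
    (Good : ι → Prop) (χ : ι → V →ₗ[ZMod 2] V) (hχ : ∀ j, Good j → Selector h ρ p (χ j))
    (hC : ∀ j, Good j → ∀ ℓ, ∀ c ∈ C ℓ, χ j c ∈ C ℓ) (IsC : List ι → ℕ → V → Prop)
    (hIC : ∀ Φ ℓ v, IsC Φ ℓ v → v ∈ C ℓ)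
    (hI : ∀ Φ j, Good j → ∀ ℓ v, IsC Φ (ℓ + 1) v →
      IsC (j :: Φ) ℓ (d (χ j v) + χ j (d v)))
    (Ψ : List ι) (hΨ : ∀ j ∈ Ψ, Good j) :
    ∀ (Φ : List ι) (ℓ : ℕ) (c : ℕ → V) (s : V), IsC Φ ℓ s → (∀ k, IsC Φ (ℓ + 1 + k) (c k)) →
    (∃ f, ρ f = f ∧ d (p (c 0)) = p s + h (p s) + f) →
    (∀ k, ∃ f, ρ f = f ∧ d (p (c (k + 1))) = p (c k) + h (p (c k)) + f) →
    ∃ t ∈ C (ℓ + 1), ∃ u, IsC (Ψ.reverse ++ Φ) ℓ u ∧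
      p s + h (p s) = d (p t + h (p t)) + (p u + h (p u)) := by
  induction Ψ with
  | nil => 
    intro Φ ℓ c s hs _ _ _
    exact ⟨0, zero_mem _, s, by simpa using hs, by simp⟩
  | cons j Ψ ih =>
    intro Φ ℓ c s hs hc h0 h1
    have hj := hΨ j (by simp)
    have hS := hχ j hj
    let D : V → V := fun v => d (χ j v) + χ j (d v)
    have hDp : ∀ v, D (p v) = p (D v) := fun v => by
      simp only [D, map_add, hS.pχ, hB.pd]
    have hdD : ∀ v, d (D v) = D (d v) := fun v => by
      simp only [D, map_add, hB.dd, map_zero, zero_add, add_zero]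
    have hDadd : ∀ v w, D (v + w) = D v + D w := fun v w => by
      simp only [D, map_add]; abel
    have hrel : ∀ v v' : V, (∃ f, ρ f = f ∧ d (p v') = p v + h (p v) + f) →
        ∃ f, ρ f = f ∧ d (p (D v')) = p (D v) + h (p (D v)) + f := by
      rintro v v' ⟨f, hf, hv⟩
      obtain ⟨f', hf', he⟩ := hB.comm_b hS (p v)
      refine ⟨f', hf', ?_⟩
      rw [← hDp, ← hDp, hdD, hv, hDadd]
      have : D f = 0 := (hB.sel_kill hS hf).2
      rw [this, add_zero]
      exact he
    obtain ⟨t, ht, u, hu, he⟩ := ih (fun i hi => hΨ i (by simp [hi])) (j :: Φ) ℓ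
      (fun k => D (c (k + 1))) (D (c 0)) (hI Φ j hj ℓ _ (hc 0))
      (fun k => hI Φ j hj (ℓ + 1 + k) _ (hc (k + 1)))
      (hrel _ _ (h1 0)) (fun k => hrel _ _ (h1 (k + 1)))
    refine ⟨χ j (c 0) + t, add_mem (hC j hj _ _ (hIC _ _ _ (hc 0))) ht, u, by simpa using hu, ?_⟩
    obtain ⟨f, hf, h0⟩ := h0
    have e1 : χ j (d (p (c 0))) = χ j (p s + h (p s)) := by
      rw [h0, map_add, (hB.sel_kill hS hf).1, add_zero]
    have e2 := hB.sel_b hS s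
    rw [← e1] at e2
    have e3 : p (D (c 0)) = d (p (χ j (c 0))) + χ j (d (p (c 0))) := by
      simp only [D, map_add, hB.pd, hS.pχ]
    have e4 : p s + h (p s) = χ j (d (p (c 0))) + h (χ j (d (p (c 0)))) := by
      generalize χ j (d (p (c 0))) = x at e2 ⊢
      rw [← add_eq_zero2] at e2 ⊢
      rw [← e2]
      abel
    rw [e3] at he
    have e5 : χ j (d (p (c 0))) + h (χ j (d (p (c 0)))) =
        d (p (χ j (c 0))) + h (d (p (χ j (c 0)))) + (d (p t + h (p t)) + (p u + h (p u))) := by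
      rw [← he, map_add, ← add_eq_zero2]; abel_nf; simp only [two_zsmul_eq_zero, add_zero]
    rw [e4, e5]
    simp only [map_add, hB.dh]
    abel

/-- Smith theory for the image of the transfer `p`. -/
theorem SmithBase.smith (hB : SmithBase d h ρ p) {ι : Type*} (C : ℕ → Submodule (ZMod 2) V)
    (hC0 : C 0 = ⊥) (hdC : ∀ ℓ, ∀ c ∈ C (ℓ + 1), d c ∈ C ℓ) (hhC : ∀ ℓ, ∀ c ∈ C ℓ, h c ∈ C ℓ)
    (hρC : ∀ ℓ, ∀ c ∈ C ℓ, ρ c ∈ C ℓ)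
    (Good : ι → Prop) (χ : ι → V →ₗ[ZMod 2] V) (hχ : ∀ j, Good j → Selector h ρ p (χ j))
    (hC : ∀ j, Good j → ∀ ℓ, ∀ c ∈ C ℓ, χ j c ∈ C ℓ) (IsC : List ι → ℕ → V → Prop)
    (hIC : ∀ Φ ℓ v, IsC Φ ℓ v → v ∈ C ℓ) (hCI : ∀ ℓ, ∀ v ∈ C ℓ, IsC [] ℓ v)
    (hI : ∀ Φ j, Good j → ∀ ℓ v, IsC Φ (ℓ + 1) v →
      IsC (j :: Φ) ℓ (d (χ j v) + χ j (d v)))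
    (Ψ : List ι) (hΨ : ∀ j ∈ Ψ, Good j) (hne : ∃ j, Good j)
    (hpush : ∀ ℓ u, IsC Ψ ℓ u → d (p u + h (p u)) = 0 →
      ∃ t ∈ C (ℓ + 1), p u + h (p u) = d (p t + h (p t))) :
    Smith d (LinearMap.id + h) (fun ℓ => (C ℓ).map p) (fun ℓ => ((C ℓ).map p).map ρ) where
  zero := by simp only [hC0, Submodule.map_bot]
  dd := hB.dd
  bb v := by
    simp only [LinearMap.add_apply, LinearMap.id_apply, map_add, hB.hh]
    abel_nf; simp only [two_zsmul_eq_zero, add_zero]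
  db v := by simp only [LinearMap.add_apply, LinearMap.id_apply, map_add, hB.dh]
  dS := by
    rintro ℓ _ ⟨c, hc, rfl⟩
    rw [hB.pd]
    exact ⟨_, hdC _ _ hc, rfl⟩
  bS := by
    rintro ℓ _ ⟨c, hc, rfl⟩
    rw [LinearMap.add_apply, LinearMap.id_apply, hB.ph, ← map_add]
    exact ⟨_, add_mem hc (hhC _ _ hc), rfl⟩
  FS := by
    rintro ℓ _ ⟨_, ⟨c, hc, rfl⟩, rfl⟩
    rw [hB.pρ]
    exact ⟨_, hρC _ _ hc, rfl⟩
  dF := by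
    rintro ℓ _ ⟨_, ⟨c, hc, rfl⟩, rfl⟩
    rw [← hB.ρd, hB.pρ, hB.pd]
    exact ⟨_, ⟨_, hdC _ _ (hρC _ _ hc), rfl⟩, rfl⟩
  bF := by
    rintro ℓ _ ⟨_, ⟨c, hc, rfl⟩, rfl⟩
    rw [LinearMap.add_apply, LinearMap.id_apply, hB.kill, add_self2]
  split := by
    rintro ℓ _ ⟨c, hc, rfl⟩ hb
    rw [LinearMap.add_apply, LinearMap.id_apply, add_eq_zero2] at hb
    obtain ⟨j, hj⟩ := hne
    refine ⟨χ j (p c), ?_, ρ (p c), ⟨_, ⟨c, hc, rfl⟩, rfl⟩, ?_⟩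
    · rw [(hχ j hj).pχ]
      exact ⟨_, hC j hj _ _ hc, rfl⟩
    · have h1 := (hχ j hj).hχ (p c)
      rw [hB.kill, ← hb] at h1
      rw [LinearMap.add_apply, LinearMap.id_apply, add_comm (χ j (p c)), h1, add_assoc,
        add_self2, add_zero]
  inter := by
    rintro ℓ _ ⟨c, hc, rfl⟩ ⟨_, ⟨c', hc', rfl⟩, he⟩
    have h1 : ρ (p c + h (p c)) = p c + h (p c) := by
      change ρ (p c') = p c + h (p c) at he
      rw [← he, hB.ρρ]
    change p c + h (p c) = 0
    rw [← h1, map_add, hB.ρh, hB.kill, add_self2]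
  nil := by
    intro ℓ c hc hs hr
    choose c' hc' hcc using hc
    obtain ⟨_, ⟨s, hsC, rfl⟩, hs⟩ := hs
    simp only [← hcc] at hr hs ⊢
    obtain ⟨t, ht, u, hu, he⟩ := hB.nil C Good χ hχ hC IsC hIC hI Ψ.reverse
      (fun j hj => hΨ j (by simpa using hj)) [] ℓ c' s (hCI _ _ hsC) (fun k => hCI _ _ (hc' k))
      ⟨0, map_zero _, by rw [add_zero]; exact hs⟩
      (fun k => ⟨0, map_zero _, by rw [add_zero]; exact hr k⟩)
    simp only [List.reverse_reverse, List.append_nil] at hu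
    have hs' : d (p (c' 0)) = p s + h (p s) := hs
    have hdu : d (p u + h (p u)) = 0 := by
      have h1 := congrArg d he
      rw [← hs', map_add, hB.dd, hB.dd, zero_add] at h1
      exact h1.symm
    obtain ⟨t', ht', he'⟩ := hpush ℓ u hu hdu
    refine ⟨p (t + t'), ⟨_, add_mem ht ht', rfl⟩, ?_⟩
    rw [hs', he, he', ← map_add]
    simp only [LinearMap.add_apply, LinearMap.id_apply, map_add]

end Selectors

end InfChain

/-! ## Involutions acting on germs of chains -/

namespace InfChain

open Filter Topology

noncomputable section

/-- Pointwise statements over a compact set, via ultralimits. -/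
lemma uf_forall {E : Type*} [TopologicalSpace E] {B : Set E} (hB : IsCompact B) {Q : ℕ → E → Prop}
    (h : ∀ s : ℕ → E, (∀ᶠ i in (UF : Filter ℕ), s i ∈ B) → ∀ x ∈ B,
      Tendsto s (UF : Filter ℕ) (𝓝 x) → ∀ᶠ i in (UF : Filter ℕ), Q i (s i)) :
    ∀ᶠ i in (UF : Filter ℕ), ∀ y ∈ B, Q i y := by
  classical
  by_contra hc
  rw [← Ultrafilter.eventually_not] at hc
  rcases B.eq_empty_or_nonempty with rfl | ⟨b, hb⟩
  · exact hc.exists.choose_spec fun y hy => absurd hy (Set.notMem_empty y)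
  have h1 : ∀ i, ∃ y ∈ B, (¬ ∀ y ∈ B, Q i y) → ¬ Q i y := fun i => by
    by_cases h2 : ∀ y ∈ B, Q i y
    · exact ⟨b, hb, fun h3 => absurd h2 h3⟩
    · have h3 := h2
      push Not at h3
      obtain ⟨y, hy, h4⟩ := h3
      exact ⟨y, hy, fun _ => h4⟩
  choose s hs h2 using h1
  obtain ⟨x, hx, hl⟩ := hB.ultrafilter_le_nhds (UF.map s) (by
    rw [le_principal_iff]
    exact Filter.mem_map.2 (Filter.univ_mem' hs))
  have h3 := h s (Eventually.of_forall hs) x hx hl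
  obtain ⟨i, h4, h5⟩ := (h3.and hc).exists
  exact h2 i h5 h4

variable {E : Type*} [NormedAddCommGroup E]

/-- An involution fixing the origin, continuous near the origin. -/
structure Inv (h : E → E) : Prop where
  invol : ∀ y, h (h y) = y
  zero : h 0 = 0
  cont : ∀ᶠ y in 𝓝 (0 : E), ContinuousAt h y

lemma Inv.id : Inv (id : E → E) := ⟨fun _ => rfl, rfl, Eventually.of_forall fun _ => continuousAt_id⟩

lemma Inv.comp {g h : E → E} (hg : Inv g) (hh : Inv h) (hc : ∀ y, g (h y) = h (g y)) :
    Inv (g ∘ h) where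
  invol y := by simp only [Function.comp_apply, hc (g (h y)), hg.invol, hh.invol]
  zero := by simp only [Function.comp_apply, hh.zero, hg.zero]
  cont := by
    have h1 : Tendsto h (𝓝 0) (𝓝 0) := by
      have := hh.cont.self_of_nhds
      rwa [ContinuousAt, hh.zero] at this
    filter_upwards [hh.cont, h1.eventually hg.cont] with y h2 h3
    exact ContinuousAt.comp h3 h2

lemma Inv.far {h : E → E} (hh : Inv h) : FarMap fun _ => h := by
  intro δ hδ
  have h1 := hh.cont.self_of_nhds
  rw [Metric.continuousAt_iff] at h1
  obtain ⟨δ', hδ', h2⟩ := h1 δ hδ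
  refine ⟨δ', hδ', Eventually.of_forall fun i y hy => ?_⟩
  by_contra! h3
  have h4 := @h2 (h y) (by simpa using h3)
  rw [hh.invol, hh.zero, dist_zero_right] at h4
  exact absurd hy (not_le.2 h4)

/-- Action of an involution on germs. -/
def Inv.V {h : E → E} (hh : Inv h) : Ger E →ₗ[ZMod 2] Ger E := mapV (fun _ => h) hh.far

lemma Inv.V_mk {h : E → E} (hh : Inv h) (c : ℕ → LC E) :
    hh.V (InfChain.mk c) = InfChain.mk fun i => lmap h (c i) := rfl

lemma Inv.V_V {h : E → E} (hh : Inv h) (v : Ger E) : hh.V (hh.V v) = v := by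
  obtain ⟨c, rfl⟩ := mk_surj v
  simp only [hh.V_mk, lmap_lmap]
  congr 1
  funext i
  have : h ∘ h = _root_.id := funext hh.invol
  rw [this, lmap_id]

lemma Inv.V_comm {g h : E → E} (hg : Inv g) (hh : Inv h) (hc : ∀ y, g (h y) = h (g y))
    (v : Ger E) : hg.V (hh.V v) = hh.V (hg.V v) := by
  obtain ⟨c, rfl⟩ := mk_surj v
  have : g ∘ h = h ∘ g := funext hc
  simp only [hh.V_mk, hg.V_mk, lmap_lmap, this]

lemma Inv.V_res {h : E → E} (hh : Inv h) {D : Set (List E)} (hD : ∀ σ, σ.map h ∈ D ↔ σ ∈ D)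
    (v : Ger E) : resV D (hh.V v) = hh.V (resV D v) := by
  obtain ⟨c, rfl⟩ := mk_surj v
  simp only [hh.V_mk, resV_mk, restr_lmap hD]

/-- A radius for a property holding near the origin. -/
lemma exists_closedBall {P : E → Prop} (h : ∀ᶠ y in 𝓝 (0 : E), P y) :
    ∃ R > 0, ∀ R' ≤ R, ∀ y ∈ Metric.closedBall (0 : E) R', P y := by
  obtain ⟨R, hR, h1⟩ := Metric.eventually_nhds_iff_ball.1 h
  exact ⟨R / 2, by positivity, fun R' hR' y hy => h1 y
    (Metric.closedBall_subset_ball (by linarith) hy)⟩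

lemma Inv.mem_Ch [ProperSpace E] {h : E → E} (hh : Inv h) {X X' : Set E} (hX : ∀ y ∈ X, h y ∈ X')
    {ℓ : ℕ} {z : Ger E} (hz : z ∈ Ch X ℓ) : hh.V z ∈ Ch X' ℓ := by
  obtain ⟨R, hR, h1⟩ := exists_closedBall hh.cont
  have hu : UniformContinuousOn h (Metric.closedBall 0 R) :=
    (isCompact_closedBall _ _).uniformContinuousOn_of_continuous
      fun y hy => (h1 R le_rfl y hy).continuousWithinAt
  refine mapV_mem _ hR (fun ε hε => ?_) hz
  obtain ⟨ε', hε', h2⟩ := Metric.uniformContinuousOn_iff.1 hu ε hε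
  refine ⟨ε', hε', Eventually.of_forall fun i y hy hyR => ⟨hX y hy, fun y' _ hy' hd => ?_⟩⟩
  exact h2 y (by simpa using hyR.le) y' (by simpa using hy'.le) hd

/-! ### The singular set of lists -/

/-- Lists on which `h` agrees with the identity or with `g`. -/
def SF (g h : E → E) : Set (List E) := {σ | σ.map h = σ ∨ σ.map h = σ.map g}

variable {g h : E → E}

lemma SF_map_h (hh : Inv h) (hc : ∀ y, g (h y) = h (g y)) (σ : List E) :
    σ.map h ∈ SF g h ↔ σ ∈ SF g h := by
  have hhh : h ∘ h = id := funext hh.invol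
  have hcc : g ∘ h = h ∘ g := funext hc
  simp only [SF, Set.mem_ofPred_eq, List.map_map, hhh, List.map_id]
  constructor
  · rintro (h1 | h1)
    · exact Or.inl h1.symm
    · right
      rw [hcc] at h1
      have := congrArg (List.map h) h1
      rwa [List.map_map, ← Function.comp_assoc, hhh, Function.id_comp] at this
  · rintro (h1 | h1)
    · exact Or.inl h1.symm
    · right
      have := congrArg (List.map h) h1
      rwa [List.map_map, List.map_map, hhh, List.map_id, ← hcc] at this

lemma SF_map_g (hg : Inv g) (hc : ∀ y, g (h y) = h (g y)) (σ : List E) :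
    σ.map g ∈ SF g h ↔ σ ∈ SF g h := by
  have hgg : g ∘ g = id := funext hg.invol
  have hcc : h ∘ g = g ∘ h := (funext hc).symm
  have hinj : Function.Injective (List.map g) := List.map_injective_iff.2
    (Function.LeftInverse.injective (g := g) hg.invol)
  simp only [SF, Set.mem_ofPred_eq, List.map_map, hcc]
  rw [← List.map_map, ← List.map_map, hinj.eq_iff, hinj.eq_iff]

lemma SF_sub {σ τ : List E} (hσ : σ ∈ SF g h) (hτ : ∀ v ∈ τ, v ∈ σ) : τ ∈ SF g h := by
  rcases hσ with h1 | h1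
  · left
    have : ∀ v ∈ σ, h v = id v := List.map_inj_left.1 (by rw [h1, List.map_id])
    rw [List.map_congr_left fun v hv => this v (hτ v hv), List.map_id]
  · right
    have : ∀ v ∈ σ, h v = g v := List.map_inj_left.1 h1
    exact List.map_congr_left fun v hv => this v (hτ v hv)

lemma SF_mem {σ : List E} : σ ∈ SF g h ↔ (∀ v ∈ σ, h v = v) ∨ ∀ v ∈ σ, h v = g v := by
  have h1 : σ.map h = σ ↔ ∀ v ∈ σ, h v = v := by
    conv_lhs => rw [← List.map_id σ, List.map_map]
    exact List.map_inj_left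
  rw [SF, Set.mem_ofPred_eq, h1, List.map_inj_left]

/-- The transfer attached to `g`, trivial when `g` is the identity. -/
def IsTr (hg : Inv g) (p : Ger E →ₗ[ZMod 2] Ger E) : Prop :=
  (p = LinearMap.id ∧ ∀ y, g y = y) ∨ p = LinearMap.id + hg.V

lemma IsTr.comm {hg : Inv g} {p : Ger E →ₗ[ZMod 2] Ger E} (hp : IsTr hg p)
    {T : Ger E →ₗ[ZMod 2] Ger E} (hT : ∀ v, T (hg.V v) = hg.V (T v)) (v : Ger E) :
    T (p v) = p (T v) := by
  rcases hp with ⟨rfl, -⟩ | rfl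
  · rfl
  · simp only [LinearMap.add_apply, LinearMap.id_apply, map_add, hT]

lemma smithBase (hg : Inv g) (hh : Inv h) (hc : ∀ y, g (h y) = h (g y))
    {p : Ger E →ₗ[ZMod 2] Ger E} (hp : IsTr hg p) : SmithBase dV hh.V (resV (SF g h)) p where
  dd := dV_dV
  hh := hh.V_V
  dh v := (mapV_dV _ _ v).symm
  ρρ v := by
    obtain ⟨c, rfl⟩ := mk_surj v
    simp only [resV_mk]
    congr 1
    funext i
    refine restr_eq_self ?_
    have := restr_mem (SF g h) Set.univ (c := c i) (by simp)
    rwa [Set.univ_inter] at this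
  ρh v := hh.V_res (SF_map_h hh hc) v
  ρd v := by
    obtain ⟨c, rfl⟩ := mk_surj v
    simp only [resV_mk, dV_mk]
    congr 1
    funext i
    refine restr_eq_self ?_
    have := restr_mem (SF g h) Set.univ (c := c i) (by simp)
    rw [Set.univ_inter] at this
    refine map_mem_of_sp bd (fun σ hσ => ?_) this
    rw [bd_bs]
    exact Finsupp.supported_mono (fun τ hτ => SF_sub hσ hτ.2) (bdL_mem σ)
  pd := hp.comm fun v => (mapV_dV _ _ v).symm
  ph := hp.comm fun v => (hg.V_comm hh hc v).symm
  pρ := hp.comm fun v => hg.V_res (SF_map_g hg hc) v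
  kill v := by
    rw [hp.comm (T := resV (SF g h)) fun v => hg.V_res (SF_map_g hg hc) v]
    obtain ⟨c, rfl⟩ := mk_surj v
    have key : ∀ i, restr (SF g h) (c i) ∈ sp (SF g h) := fun i => by
      have := restr_mem (SF g h) Set.univ (c := c i) (by simp)
      rwa [Set.univ_inter] at this
    rcases hp with ⟨rfl, hid⟩ | rfl
    · simp only [LinearMap.id_apply, resV_mk, hh.V_mk]
      congr 1
      funext i
      refine eq_of_add_eq_zero2 ((Submodule.mem_bot (ZMod 2)).1 (map_mem_of_sp
        (lmap h + LinearMap.id) (fun σ hσ => ?_) (key i)))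
      have hσ' : σ.map h = σ := by
        rcases hσ with h1 | h1
        · exact h1
        · rw [h1, List.map_congr_left (g := id) fun v _ => hid v, List.map_id]
      simp [hσ', add_self2]
    · simp only [LinearMap.add_apply, LinearMap.id_apply, resV_mk, hh.V_mk, hg.V_mk, ← map_add]
      congr 1
      funext i
      refine eq_of_add_eq_zero2 ((Submodule.mem_bot (ZMod 2)).1 (map_mem_of_sp
        (lmap h ∘ₗ (LinearMap.id + lmap g) + (LinearMap.id + lmap g)) (fun σ hσ => ?_) (key i)))
      rw [Submodule.mem_bot]
      have hcc : h ∘ g = g ∘ h := (funext hc).symm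
      have hgg : g ∘ g = id := funext hg.invol
      rcases hσ with h1 | h1
      · simp only [LinearMap.add_apply, LinearMap.comp_apply, LinearMap.id_apply, map_add, lmap_bs,
          List.map_map, hcc]
        rw [← List.map_map, h1, add_self2]
      · simp only [LinearMap.add_apply, LinearMap.comp_apply, LinearMap.id_apply, map_add, lmap_bs,
          List.map_map, hcc]
        rw [← List.map_map, h1, List.map_map, hgg, List.map_id, add_comm (bs σ), add_self2]

/-! ### Selectors -/

lemma selector_of (hg : Inv g) (hh : Inv h) (hc : ∀ y, g (h y) = h (g y))
    {p : Ger E →ₗ[ZMod 2] Ger E} (hp : IsTr hg p) {K : Set (List E)}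
    (hKg : ∀ σ, σ.map g ∈ K ↔ σ ∈ K) (hKh : ∀ σ, σ ∉ SF g h → (σ.map h ∈ K ↔ σ ∉ K))
    (hKF : ∀ σ ∈ K, σ ∉ SF g h) : Selector hh.V (resV (SF g h)) p (resV K) where
  hχ v := by
    classical
    obtain ⟨c, rfl⟩ := mk_surj v
    simp only [hh.V_mk, resV_mk, ← map_add]
    congr 1
    funext i
    have : lmap h ∘ₗ restr K + restr K ∘ₗ lmap h = lmap h + lmap h ∘ₗ restr (SF g h) := by
      refine hom_ext' fun σ => ?_
      simp only [LinearMap.add_apply, LinearMap.comp_apply, lmap_bs, restr_bs]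
      by_cases h1 : σ ∈ SF g h
      · have h2 : σ ∉ K := fun h2 => hKF σ h2 h1
        have h3 : σ.map h ∉ K := fun h2 => hKF _ h2 ((SF_map_h hh hc σ).2 h1)
        simp [h1, h2, h3, add_self2]
      · have := hKh σ h1
        by_cases h2 : σ ∈ K <;> simp [h1, h2, this]
    exact LinearMap.congr_fun this (c i)
  χρ v := by
    obtain ⟨c, rfl⟩ := mk_surj v
    simp only [resV_mk]
    rw [mk_eq_zero]
    refine ⟨1, one_pos, Eventually.of_forall fun i => ?_⟩
    have h1 := restr_mem K _ (restr_mem (SF g h) Set.univ (c := c i) (by simp))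
    refine Finsupp.supported_mono ?_ h1
    rintro σ ⟨⟨-, h2⟩, h3⟩
    exact absurd h2 (hKF σ h3)
  pχ := hp.comm fun v => hg.V_res hKg v

/-- A half of the lists outside the singular set. -/
lemma exists_half (hg : Inv g) (hh : Inv h) (hc : ∀ y, g (h y) = h (g y)) :
    ∃ T : Set (List E), (∀ σ, σ.map g ∈ T ↔ σ ∈ T) ∧
      ∀ σ, σ ∉ SF g h → (σ.map h ∈ T ↔ σ ∉ T) := by
  have hhh : h ∘ h = id := funext hh.invol
  have hgg : g ∘ g = id := funext hg.invol
  have hcc : h ∘ g = g ∘ h := (funext hc).symm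
  let q : List E → Set (List E) := fun σ => {σ, σ.map g}
  have hq : ∀ σ, q (σ.map g) = q σ := fun σ => by
    simp only [q, List.map_map, hgg, List.map_id, Set.pair_comm]
  let r : Set (List E) → Set (List E) → Prop := WellOrderingRel
  refine ⟨{σ | r (q σ) (q (σ.map h))}, fun σ => ?_, fun σ hσ => ?_⟩
  · simp only [Set.mem_ofPred_eq, List.map_map, hcc]
    rw [← List.map_map, hq, hq]
  · simp only [Set.mem_ofPred_eq, List.map_map, hhh, List.map_id]
    have hne : q σ ≠ q (σ.map h) := by
      intro he
      have h1 : σ.map h ∈ q σ := by rw [he]; exact Set.mem_insert _ _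
      rcases h1 with h1 | h1
      · exact hσ (Or.inl h1)
      · exact hσ (Or.inr h1)
    constructor
    · intro h1 h2
      exact asymm_of r h1 h2
    · intro h1
      rcases trichotomous_of r (q σ) (q (σ.map h)) with h2 | h2 | h2
      · exact absurd h2 h1
      · exact absurd h2 hne
      · exact h2

/-- The selector set of a function odd under `h`, with ties broken by `T`. -/
def selSet (g h : E → E) (T : Set (List E)) (φ : E → ℝ) : Set (List E) :=
  {σ | σ ∉ SF g h ∧ ((∀ v ∈ σ, 0 < φ v) ∨
    ((¬ ∀ v ∈ σ, 0 < φ v) ∧ (¬ ∀ v ∈ σ, φ v < 0) ∧ σ ∈ T))}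

lemma selector_selSet (hg : Inv g) (hh : Inv h) (hc : ∀ y, g (h y) = h (g y))
    {p : Ger E →ₗ[ZMod 2] Ger E} (hp : IsTr hg p) {T : Set (List E)}
    (hTg : ∀ σ, σ.map g ∈ T ↔ σ ∈ T) (hTh : ∀ σ, σ ∉ SF g h → (σ.map h ∈ T ↔ σ ∉ T))
    {φ : E → ℝ} (hφg : ∀ y, φ (g y) = φ y) (hφh : ∀ y, φ (h y) = - φ y) :
    Selector hh.V (resV (SF g h)) p (resV (selSet g h T φ)) := by
  refine selector_of hg hh hc hp (fun σ => ?_) (fun σ hσ => ?_) fun σ hσ => hσ.1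
  · simp only [selSet, Set.mem_ofPred_eq, SF_map_g hg hc, List.forall_mem_map, hφg, hTg]
  · have hne : σ ≠ [] := by
      rintro rfl
      exact hσ (Or.inl rfl)
    obtain ⟨u, hu⟩ := List.exists_mem_of_ne_nil _ hne
    simp only [selSet, Set.mem_ofPred_eq, SF_map_h hh hc, List.forall_mem_map, hφh, hTh σ hσ,
      Left.neg_pos_iff, Left.neg_neg_iff]
    have : ¬ ((∀ v ∈ σ, 0 < φ v) ∧ (∀ v ∈ σ, φ v < 0)) := fun h1 =>
      lt_asymm (h1.1 u hu) (h1.2 u hu)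
    tauto

/-- Chains near the origin on which finitely many functions are infinitesimal. -/
def IsC (X : Set E) (R : ℝ) (Φ : List (E → ℝ)) (ℓ : ℕ) (z : Ger E) : Prop :=
  ∃ c, mk c = z ∧ ∀ ε > 0, ∀ᶠ i in (UF : Filter ℕ),
    c i ∈ sp (Nr X ℓ ε R ∩ {σ | ∀ v ∈ σ, ∀ φ ∈ Φ, |φ v| < ε})

lemma IsC.mem {X : Set E} {R : ℝ} {Φ : List (E → ℝ)} {ℓ : ℕ} {z : Ger E} (hz : IsC X R Φ ℓ z) :
    z ∈ Ch X ℓ := by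
  obtain ⟨c, rfl, h1⟩ := hz
  exact mk_mem_Ch fun ε hε => (h1 ε hε).mono fun i hi =>
    Finsupp.supported_mono (fun σ hσ => hσ.1.1) hi

lemma isC_nil {X : Set E} {R : ℝ} (hR : 0 < R) {ℓ : ℕ} {z : Ger E} (hz : z ∈ Ch X ℓ) :
    IsC X R [] ℓ z := by
  obtain ⟨c, h1, h2⟩ := exists_near hz hR
  refine ⟨c, h1, fun ε hε => (h2 ε hε).mono fun i hi => ?_⟩
  refine Finsupp.supported_mono (s := Nr X ℓ ε R) ?_ hi
  intro σ hσ
  refine ⟨hσ, ?_⟩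
  simp

lemma IsC.step [ProperSpace E] {X : Set E} {R : ℝ} {Φ : List (E → ℝ)} {ℓ : ℕ} {z : Ger E}
    (hz : IsC X R Φ (ℓ + 1) z) {T : Set (List E)} {φ : E → ℝ}
    (hφc : ContinuousOn φ (Metric.closedBall 0 R)) (hφg : ∀ y, φ (g y) = φ y)
    (hφh : ∀ y, φ (h y) = - φ y) :
    IsC X R (φ :: Φ) ℓ (dV (resV (selSet g h T φ) z) + resV (selSet g h T φ) (dV z)) := by
  classical
  obtain ⟨c, rfl, h1⟩ := hz
  refine ⟨_, rfl, fun ε hε => ?_⟩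
  obtain ⟨ε', hε', hu⟩ := Metric.uniformContinuousOn_iff.1
    ((isCompact_closedBall _ _).uniformContinuousOn_of_continuous hφc) ε hε
  filter_upwards [h1 (min ε ε') (by positivity)] with i hi
  set K := selSet g h T φ
  refine map_mem_of_sp (bd ∘ₗ restr K + restr K ∘ₗ bd) (fun σ hσ => ?_) hi
  have hface : bdL σ ∈ sp ({τ | τ.length + 1 = σ.length ∧ ∀ v ∈ τ, v ∈ σ}) := bdL_mem σ
  have hsub : {τ : List E | τ.length + 1 = σ.length ∧ ∀ v ∈ τ, v ∈ σ} ⊆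
      Nr X ℓ ε R ∩ {σ | ∀ v ∈ σ, ∀ φ ∈ Φ, |φ v| < ε} := by
    rintro τ ⟨h2, h3⟩
    have h4 := hσ.1.1.1
    refine ⟨⟨⟨by omega, fun v hv => ⟨(hσ.1.1.2 v (h3 v hv)).1, fun u hu =>
      ((hσ.1.1.2 v (h3 v hv)).2 u (h3 u hu)).trans_le (min_le_left _ _)⟩⟩,
      fun v hv => hσ.1.2 v (h3 v hv)⟩, fun v hv ψ hψ =>
        (hσ.2 v (h3 v hv) ψ hψ).trans_le (min_le_left _ _)⟩
  have hgen : (∀ τ : List E, τ.length + 1 = σ.length → (∀ v ∈ τ, v ∈ σ) → ∀ v ∈ τ, |φ v| < ε) →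
      (bd ∘ₗ restr K + restr K ∘ₗ bd) (bs σ) ∈
        sp (Nr X ℓ ε R ∩ {σ | ∀ v ∈ σ, ∀ ψ ∈ φ :: Φ, |ψ v| < ε}) := by
    intro h2
    have h3 : {τ : List E | τ.length + 1 = σ.length ∧ ∀ v ∈ τ, v ∈ σ} ⊆
        Nr X ℓ ε R ∩ {σ | ∀ v ∈ σ, ∀ ψ ∈ φ :: Φ, |ψ v| < ε} := by
      intro τ hτ
      refine ⟨(hsub hτ).1, fun v hv ψ hψ => ?_⟩
      rcases List.mem_cons.1 hψ with rfl | hψ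
      · exact h2 τ hτ.1 hτ.2 v hv
      · exact (hsub hτ).2 v hv ψ hψ
    simp only [LinearMap.add_apply, LinearMap.comp_apply, restr_bs, bd_bs]
    refine add_mem ?_ ?_
    · split_ifs
      · rw [bd_bs]
        exact Finsupp.supported_mono h3 hface
      · rw [map_zero]
        exact zero_mem _
    · exact Finsupp.supported_mono (fun τ hτ => h3 hτ.1) (restr_mem K _ hface)
  rcases Nat.eq_zero_or_pos ℓ with rfl | hℓ
  · refine hgen fun τ h2 _ v hv => ?_
    have h4 := hσ.1.1.1
    have : τ = [] := List.eq_nil_of_length_eq_zero (by omega)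
    simp [this] at hv
  have hdisj : ∀ τ : List E, τ ≠ [] → (∀ v ∈ τ, 0 < φ v) → (∀ v ∈ τ, φ v < 0) → False := by
    intro τ hne h5 h6
    obtain ⟨u, hu⟩ := List.exists_mem_of_ne_nil _ hne
    exact lt_asymm (h5 u hu) (h6 u hu)
  have hposK : ∀ τ : List E, τ ≠ [] → (∀ v ∈ τ, 0 < φ v) → τ ∈ K := by
    intro τ hne h5
    refine ⟨fun h6 => ?_, Or.inl h5⟩
    obtain ⟨u, hu⟩ := List.exists_mem_of_ne_nil _ hne
    have h7 := hφh u
    rcases SF_mem.1 h6 with h8 | h8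
    · rw [h8 u hu] at h7
      linarith [h5 u hu]
    · rw [h8 u hu, hφg] at h7
      linarith [h5 u hu]
  have hnegK : ∀ τ : List E, τ ≠ [] → (∀ v ∈ τ, φ v < 0) → τ ∉ K := by
    rintro τ hne h5 ⟨-, h6 | h6⟩
    · exact hdisj τ hne h6 h5
    · exact h6.2.1 h5
  have hlen := hσ.1.1.1
  have hσne : σ ≠ [] := by rintro rfl; simp at hlen
  have hτne : ∀ τ : List E, τ.length + 1 = σ.length → τ ≠ [] := by
    rintro τ h5 rfl
    simp at h5
    omega
  by_cases hp : ∀ v ∈ σ, 0 < φ v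
  · have h5 : restr K (bdL σ) = bdL σ := by
      refine restr_eq_self (Finsupp.supported_mono ?_ hface)
      exact fun τ hτ => hposK τ (hτne τ hτ.1) fun v hv => hp v (hτ.2 v hv)
    simp only [LinearMap.add_apply, LinearMap.comp_apply, restr_bs, bd_bs, h5,
      if_pos (hposK σ hσne hp), add_self2]
    exact zero_mem _
  by_cases hn : ∀ v ∈ σ, φ v < 0
  · simp only [LinearMap.add_apply, LinearMap.comp_apply, restr_bs, bd_bs,
      if_neg (hnegK σ hσne hn), map_zero, zero_add]
    refine Finsupp.supported_mono ?_ (restr_mem K _ hface)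
    rintro τ ⟨h5, h6⟩
    exact absurd h6 (hnegK τ (hτne τ h5.1) fun v hv => hn v (h5.2 v hv))
  push Not at hp hn
  obtain ⟨v1, hv1, h5⟩ := hp
  obtain ⟨v2, hv2, h6⟩ := hn
  refine hgen fun τ _ hτ v hv => ?_
  have hv' := hτ v hv
  have hball : ∀ u ∈ σ, u ∈ Metric.closedBall (0 : E) R := fun u hu => by
    simpa using (hσ.1.2 u hu).le
  have h7 := hu v (hball v hv') v1 (hball v1 hv1)
    (((hσ.1.1.2 v1 hv1).2 v hv').trans_le (min_le_right _ _))
  have h8 := hu v (hball v hv') v2 (hball v2 hv2)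
    (((hσ.1.1.2 v2 hv2).2 v hv').trans_le (min_le_right _ _))
  rw [Real.dist_eq, abs_lt] at h7 h8
  rw [abs_lt]
  constructor <;> linarith [h7.1, h7.2, h8.1, h8.2]

end

end InfChain

/-! ## Pushing chains into the singular set -/

namespace InfChain

open Filter Topology

noncomputable section

/-- Equivariant choice for two commuting involutions. -/
lemma exists_equivariant {E : Type*} [Nonempty E] {g h : E → E} (hg : ∀ y, g (g y) = y)
    (hh : ∀ y, h (h y) = y) (hc : ∀ y, g (h y) = h (g y)) {R : E → E → Prop}
    (hR : ∀ y, ∃ z, R y z) (Rg : ∀ y z, R y z → R (g y) (g z)) (Rh : ∀ y z, R y z → R (h y) (h z))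
    (hs : ∀ y z, R y z → (g y = y → g z = z) ∧ (h y = y → h z = z) ∧ (h y = g y → h z = g z)) :
    ∃ q : E → E, (∀ y, R y (q y)) ∧ (∀ y, q (g y) = g (q y)) ∧ ∀ y, q (h y) = h (q y) := by
  classical
  choose f hf using hR
  let O : E → Set E := fun y => {y, g y, h y, g (h y)}
  let rep : Set E → E := fun S => if hS : S.Nonempty then hS.some else Classical.arbitrary E
  have hrep : ∀ y, rep (O y) ∈ O y := fun y => by
    have hS : (O y).Nonempty := ⟨y, by simp [O]⟩
    simp only [rep, dif_pos hS]
    exact hS.some_mem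
  have hOg : ∀ y, O (g y) = O y := fun y => by
    ext z
    simp only [O, Set.mem_insert_iff, Set.mem_singleton_iff, ← hc, hg]
    tauto
  have hOh : ∀ y, O (h y) = O y := fun y => by
    ext z
    simp only [O, Set.mem_insert_iff, Set.mem_singleton_iff, hh]
    tauto
  let P : E → E → E → Prop := fun a y z => (y = a ∧ z = f a) ∨ (y = g a ∧ z = g (f a)) ∨
    (y = h a ∧ z = h (f a)) ∨ (y = g (h a) ∧ z = g (h (f a)))
  have hP : ∀ y, ∃ z, P (rep (O y)) y z := fun y => by
    generalize rep (O y) = a, hrep y = ha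
    simp only [O, Set.mem_insert_iff, Set.mem_singleton_iff] at ha
    rcases ha with rfl | rfl | rfl | rfl
    · exact ⟨_, Or.inl ⟨rfl, rfl⟩⟩
    · exact ⟨_, Or.inr (Or.inl ⟨(hg _).symm, rfl⟩)⟩
    · exact ⟨_, Or.inr (Or.inr (Or.inl ⟨(hh _).symm, rfl⟩))⟩
    · exact ⟨_, Or.inr (Or.inr (Or.inr ⟨by rw [← hc, hh, hg], rfl⟩))⟩
  have hPR : ∀ a y z, P a y z → R y z := by
    rintro a y z (⟨rfl, rfl⟩ | ⟨rfl, rfl⟩ | ⟨rfl, rfl⟩ | ⟨rfl, rfl⟩)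
    · exact hf _
    · exact Rg _ _ (hf _)
    · exact Rh _ _ (hf _)
    · exact Rg _ _ (Rh _ _ (hf _))
  have hPg : ∀ a y z, P a y z → P a (g y) (g z) := by
    rintro a y z (⟨rfl, rfl⟩ | ⟨rfl, rfl⟩ | ⟨rfl, rfl⟩ | ⟨rfl, rfl⟩) <;> simp [P, hg]
  have hPh : ∀ a y z, P a y z → P a (h y) (h z) := by
    rintro a y z (⟨rfl, rfl⟩ | ⟨rfl, rfl⟩ | ⟨rfl, rfl⟩ | ⟨rfl, rfl⟩) <;> simp [P, hh, ← hc]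
  have hPu : ∀ a y z z', P a y z → P a y z' → z = z' := by
    intro a y z z' h1 h2
    obtain ⟨s1, s2, s3⟩ := hs a (f a) (hf a)
    have gi : ∀ {u v}, g u = g v ↔ u = v := fun {u v} =>
      (Function.LeftInverse.injective (g := g) hg).eq_iff
    have hi : ∀ {u v}, h u = h v ↔ u = v := fun {u v} =>
      (Function.LeftInverse.injective (g := h) hh).eq_iff
    have g1 : ∀ {u v}, u = g v ↔ g u = v := fun {u v} =>
      ⟨fun h => by rw [h, hg], fun h => by rw [← h, hg]⟩
    rcases h1 with ⟨e1, rfl⟩ | ⟨e1, rfl⟩ | ⟨e1, rfl⟩ | ⟨e1, rfl⟩ <;>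
    rcases h2 with ⟨e2, rfl⟩ | ⟨e2, rfl⟩ | ⟨e2, rfl⟩ | ⟨e2, rfl⟩ <;>
    first
    | rfl
    | (rw [e1] at e2
       grind)
  choose q hq using hP
  refine ⟨q, fun y => hPR _ _ _ (hq y), fun y => ?_, fun y => ?_⟩
  · have h1 := hq (g y)
    rw [hOg] at h1
    exact hPu _ _ _ _ h1 (hPg _ _ _ (hq y))
  · have h1 := hq (h y)
    rw [hOh] at h1
    exact hPu _ _ _ _ h1 (hPh _ _ _ (hq y))

/-- Two points whose orbits are pointwise close. -/
def OrbClose {E : Type*} [NormedAddCommGroup E] (g h : E → E) (θ : ℝ) (y z : E) : Prop :=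
  dist y z ≤ θ ∧ dist (g y) (g z) ≤ θ ∧ dist (h y) (h z) ≤ θ ∧ dist (g (h y)) (g (h z)) ≤ θ

variable {E : Type*} [NormedAddCommGroup E] {g h : E → E}

lemma OrbClose.map_g {θ : ℝ} {y z : E} (hg : Inv g) (hc : ∀ y, g (h y) = h (g y))
    (H : OrbClose g h θ y z) : OrbClose g h θ (g y) (g z) := by
  obtain ⟨h1, h2, h3, h4⟩ := H
  refine ⟨h2, by rwa [hg.invol, hg.invol], by rwa [← hc, ← hc], ?_⟩
  rwa [← hc, ← hc, hg.invol, hg.invol]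

lemma OrbClose.map_h {θ : ℝ} {y z : E} (hh : Inv h)
    (H : OrbClose g h θ y z) : OrbClose g h θ (h y) (h z) := by
  obtain ⟨h1, h2, h3, h4⟩ := H
  exact ⟨h3, h4, by rwa [hh.invol, hh.invol], by rwa [hh.invol, hh.invol]⟩

lemma OrbClose.refl {θ : ℝ} (hθ : 0 ≤ θ) (y : E) : OrbClose g h θ y y := by
  simp [OrbClose, hθ]

lemma eventually_orbClose {x : E} (hgx : ContinuousAt g x) (hhx : ContinuousAt h x)
    (hghx : ContinuousAt (g ∘ h) x) {s : ℕ → E} (hs : Tendsto s (UF : Filter ℕ) (𝓝 x)) {θ : ℝ}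
    (hθ : 0 < θ) : ∀ᶠ i in (UF : Filter ℕ), OrbClose g h θ (s i) x := by
  have key : ∀ T : E → E, ContinuousAt T x → ∀ᶠ i in (UF : Filter ℕ), dist (T (s i)) (T x) < θ :=
    fun T hT => (Metric.tendsto_nhds.1 (hT.tendsto.comp hs)) θ hθ
  filter_upwards [key _ continuousAt_id, key _ hgx, key _ hhx, key _ hghx] with i h1 h2 h3 h4
  exact ⟨h1.le, h2.le, h3.le, h4.le⟩

/-- Points infinitely close to points of a convergent sequence. -/
lemma tendsto_of_dist_le {s t : ℕ → E} {x : E} (hs : Tendsto s (UF : Filter ℕ) (𝓝 x))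
    {θ : ℕ → ℝ} (hθ : ∀ ε > 0, ∀ᶠ i in (UF : Filter ℕ), θ i < ε)
    (h : ∀ᶠ i in (UF : Filter ℕ), dist (s i) (t i) ≤ θ i) : Tendsto t (UF : Filter ℕ) (𝓝 x) := by
  rw [Metric.tendsto_nhds] at hs ⊢
  intro ε hε
  filter_upwards [hs (ε / 2) (by positivity), hθ (ε / 2) (by positivity), h] with i h1 h2 h3
  have := dist_triangle_left (t i) x (s i)
  linarith

set_option maxHeartbeats 1600000 in
/-- The existence of equivariant maps pushing into the singular set. -/
lemma exists_push (hg : Inv g) (hh : Inv h) (hc : ∀ y, g (h y) = h (g y)) {X : Set E}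
    (hXg : ∀ y ∈ X, g y ∈ X) (hXh : ∀ y ∈ X, h y ∈ X) {R : ℝ}
    (hX : IsCompact (X ∩ Metric.closedBall 0 R))
    (hgR : ∀ y ∈ Metric.closedBall 0 R, ContinuousAt g y)
    (hhR : ∀ y ∈ Metric.closedBall 0 R, ContinuousAt h y)
    (hghR : ∀ y ∈ Metric.closedBall 0 R, ContinuousAt (g ∘ h) y) {Φ : List (E → ℝ)}
    (hΦ : ∀ φ ∈ Φ, ContinuousOn φ (Metric.closedBall 0 R))
    (hZ : ∀ y ∈ X ∩ Metric.closedBall 0 R, (∀ φ ∈ Φ, φ y = 0) → h y = y ∨ h y = g y)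
    {η : ℕ → ℝ} (hη : ∀ ε > 0, ∀ᶠ i in (UF : Filter ℕ), η i < ε) :
    ∃ (r : ℕ → E → E) (δ : ℕ → ℝ), (∀ ε > 0, ∀ᶠ i in (UF : Filter ℕ), δ i < ε) ∧
      (∀ i y, dist (r i y) y ≤ δ i) ∧ (∀ i, ∀ y ∈ X, r i y ∈ X) ∧ (∀ i y, r i (g y) = g (r i y)) ∧
      (∀ i y, r i (h y) = h (r i y)) ∧
      ∀ᶠ i in (UF : Filter ℕ), ∀ σ : List E, (∀ v ∈ σ, v ∈ X ∩ Metric.closedBall 0 R ∧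
        (∀ u ∈ σ, dist u v < η i) ∧ ∀ φ ∈ Φ, |φ v| < η i) → σ.map (r i) ∈ SF g h := by
  classical
  set B := X ∩ Metric.closedBall 0 R with hBdef
  have hBc : ∀ y ∈ B, ContinuousAt g y ∧ ContinuousAt h y ∧ ContinuousAt (g ∘ h) y := fun y hy =>
    ⟨hgR y hy.2, hhR y hy.2, hghR y hy.2⟩
  obtain ⟨θ, hθ0, hθ, h1⟩ := exists_threshold (P := fun θ i => ∀ y ∈ B, (∀ φ ∈ Φ, |φ y| < η i) →
      ∃ z ∈ X, (h z = z ∨ h z = g z) ∧ OrbClose g h θ y z) (by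
    intro θ hθ
    refine uf_forall hX fun s hs x hx hl => ?_
    by_cases hcond : ∀ᶠ i in (UF : Filter ℕ), ∀ φ ∈ Φ, |φ (s i)| < η i
    · have hzero : ∀ φ ∈ Φ, φ x = 0 := by
        intro φ hφ
        have h2 : Tendsto (fun i => φ (s i)) (UF : Filter ℕ) (𝓝 (φ x)) :=
          ((hΦ φ hφ) x hx.2).tendsto.comp (tendsto_nhdsWithin_iff.2 ⟨hl, hs.mono fun i hi => hi.2⟩)
        have h3 : Tendsto (fun i => φ (s i)) (UF : Filter ℕ) (𝓝 0) := by
          rw [Metric.tendsto_nhds]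
          intro ε hε
          filter_upwards [hcond, hη ε hε] with i h4 h5
          rw [Real.dist_eq, sub_zero]
          exact (h4 φ hφ).trans h5
        exact tendsto_nhds_unique h2 h3
      obtain ⟨c1, c2, c3⟩ := hBc x hx
      filter_upwards [eventually_orbClose c1 c2 c3 hl hθ] with i hi _
      exact ⟨x, hx.1, hZ x hx hzero, hi⟩
    · rw [← Ultrafilter.eventually_not] at hcond
      exact hcond.mono fun i hi h2 => absurd h2 hi)
  obtain ⟨θ', hθ'0, hθ', h2⟩ := exists_threshold (P := fun θ' i => ∀ y ∈ B,
      ((∃ y1 ∈ B, ∃ y2 ∈ B, dist y y1 ≤ η i ∧ dist y y2 ≤ η i ∧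
        (∃ z, h z = z ∧ OrbClose g h (θ i) y1 z) ∧ ∃ z, h z = g z ∧ OrbClose g h (θ i) y2 z) ∨
        (g y = y ∧ ∃ z, (h z = z ∨ h z = g z) ∧ OrbClose g h (θ i) y z)) →
      ∃ x ∈ X, h x = x ∧ g x = x ∧ OrbClose g h θ' y x) (by
    intro θ' hθ'
    refine uf_forall hX fun s hs x hx hl => ?_
    obtain ⟨c1, c2, c3⟩ := hBc x hx
    have hfin : h x = x → g x = x → ∀ᶠ i in (UF : Filter ℕ),
        ∃ x ∈ X, h x = x ∧ g x = x ∧ OrbClose g h θ' (s i) x := fun e1 e2 => by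
      filter_upwards [eventually_orbClose c1 c2 c3 hl hθ'] with i hi
      exact ⟨x, hx.1, e1, e2, hi⟩
    have lim1 : ∀ t z : ℕ → E, Tendsto t (UF : Filter ℕ) (𝓝 x) →
        (∀ᶠ i in (UF : Filter ℕ), h (z i) = z i ∧ OrbClose g h (θ i) (t i) (z i)) → h x = x := by
      intro t z ht hz
      have l1 : Tendsto z (UF : Filter ℕ) (𝓝 x) :=
        tendsto_of_dist_le ht hθ (hz.mono fun i hi => hi.2.1)
      have l2 : Tendsto (fun i => h (z i)) (UF : Filter ℕ) (𝓝 (h x)) :=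
        tendsto_of_dist_le (c2.tendsto.comp ht) hθ (hz.mono fun i hi => hi.2.2.2.1)
      exact tendsto_nhds_unique (l2.congr' (hz.mono fun i hi => hi.1)) l1
    have lim2 : ∀ t z : ℕ → E, Tendsto t (UF : Filter ℕ) (𝓝 x) →
        (∀ᶠ i in (UF : Filter ℕ), h (z i) = g (z i) ∧ OrbClose g h (θ i) (t i) (z i)) →
        h x = g x := by
      intro t z ht hz
      have l1 : Tendsto (fun i => g (z i)) (UF : Filter ℕ) (𝓝 (g x)) :=
        tendsto_of_dist_le (c1.tendsto.comp ht) hθ (hz.mono fun i hi => hi.2.2.1)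
      have l2 : Tendsto (fun i => h (z i)) (UF : Filter ℕ) (𝓝 (h x)) :=
        tendsto_of_dist_le (c2.tendsto.comp ht) hθ (hz.mono fun i hi => hi.2.2.2.1)
      exact tendsto_nhds_unique (l2.congr' (hz.mono fun i hi => hi.1)) l1
    by_cases hA : ∀ᶠ i in (UF : Filter ℕ), ∃ y1 ∈ B, ∃ y2 ∈ B, dist (s i) y1 ≤ η i ∧
        dist (s i) y2 ≤ η i ∧ (∃ z, h z = z ∧ OrbClose g h (θ i) y1 z) ∧
          ∃ z, h z = g z ∧ OrbClose g h (θ i) y2 z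
    · have hA' : ∀ i, ∃ y1 y2 z1 z2 : E, (∃ y1 ∈ B, ∃ y2 ∈ B, dist (s i) y1 ≤ η i ∧
        dist (s i) y2 ≤ η i ∧ (∃ z, h z = z ∧ OrbClose g h (θ i) y1 z) ∧
          ∃ z, h z = g z ∧ OrbClose g h (θ i) y2 z) → dist (s i) y1 ≤ η i ∧
        dist (s i) y2 ≤ η i ∧ (h z1 = z1 ∧ OrbClose g h (θ i) y1 z1) ∧
          (h z2 = g z2 ∧ OrbClose g h (θ i) y2 z2) := by
        intro i
        by_cases hi : ∃ y1 ∈ B, ∃ y2 ∈ B, dist (s i) y1 ≤ η i ∧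
          dist (s i) y2 ≤ η i ∧ (∃ z, h z = z ∧ OrbClose g h (θ i) y1 z) ∧
          ∃ z, h z = g z ∧ OrbClose g h (θ i) y2 z
        · obtain ⟨y1, -, y2, -, e1, e2, ⟨z1, e3⟩, z2, e4⟩ := hi
          exact ⟨y1, y2, z1, z2, fun _ => ⟨e1, e2, e3, e4⟩⟩
        · exact ⟨0, 0, 0, 0, fun h3 => absurd h3 hi⟩
      choose y1 y2 z1 z2 hyz using hA'
      have hev := hA.mono fun i hi => hyz i hi
      have t1 : Tendsto y1 (UF : Filter ℕ) (𝓝 x) :=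
        tendsto_of_dist_le hl hη (hev.mono fun i hi => hi.1)
      have t2 : Tendsto y2 (UF : Filter ℕ) (𝓝 x) :=
        tendsto_of_dist_le hl hη (hev.mono fun i hi => hi.2.1)
      have e1 := lim1 y1 z1 t1 (hev.mono fun i hi => hi.2.2.1)
      have e2 := lim2 y2 z2 t2 (hev.mono fun i hi => hi.2.2.2)
      exact (hfin e1 (by rw [← e2, e1])).mono fun i hi _ => hi
    by_cases hA2 : ∀ᶠ i in (UF : Filter ℕ), g (s i) = s i ∧
        ∃ z, (h z = z ∨ h z = g z) ∧ OrbClose g h (θ i) (s i) z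
    · have hgx : g x = x := tendsto_nhds_unique
        ((c1.tendsto.comp hl).congr' (hA2.mono fun i hi => hi.1)) hl
      have hA' : ∀ i, ∃ z : E, (∃ z, (h z = z ∨ h z = g z) ∧ OrbClose g h (θ i) (s i) z) →
          (h z = z ∨ h z = g z) ∧ OrbClose g h (θ i) (s i) z := by
        intro i
        by_cases hi : ∃ z, (h z = z ∨ h z = g z) ∧ OrbClose g h (θ i) (s i) z
        · obtain ⟨z, hz⟩ := hi
          exact ⟨z, fun _ => hz⟩
        · exact ⟨0, fun h3 => absurd h3 hi⟩
      choose z hz using hA'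
      have hev : ∀ᶠ i in (UF : Filter ℕ), (h (z i) = z i ∧ OrbClose g h (θ i) (s i) (z i)) ∨
          (h (z i) = g (z i) ∧ OrbClose g h (θ i) (s i) (z i)) := hA2.mono fun i hi => by
        have := hz i hi.2
        tauto
      have hhx : h x = x := by
        rcases Ultrafilter.eventually_or.1 hev with h3 | h3
        · exact lim1 s z hl h3
        · rw [lim2 s z hl h3, hgx]
      exact (hfin hhx hgx).mono fun i hi _ => hi
    rw [← Ultrafilter.eventually_not] at hA hA2
    filter_upwards [hA, hA2] with i h3 h4 h5
    exact h5.elim (fun a => absurd a h3) (fun a => absurd a h4))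
  let P1 : ℕ → E → Prop := fun i y => ∃ x ∈ X, h x = x ∧ g x = x ∧ OrbClose g h (θ' i) y x
  let P2 : E → Prop := fun y => h y = y ∨ h y = g y
  let P3 : ℕ → E → Prop := fun i y => g y ≠ y ∧
    ∃ x ∈ X, (h x = x ∨ h x = g x) ∧ OrbClose g h (θ i) y x
  let Rl : ℕ → E → E → Prop := fun i y z =>
    (P1 i y ∧ z ∈ X ∧ h z = z ∧ g z = z ∧ OrbClose g h (θ' i) y z) ∨
    (¬ P1 i y ∧ (P2 y ∨ ¬ P3 i y) ∧ z = y) ∨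
    (¬ P1 i y ∧ ¬ P2 y ∧ P3 i y ∧ z ∈ X ∧ (h z = z ∨ h z = g z) ∧ OrbClose g h (θ i) y z)
  have hRl : ∀ i y, ∃ z, Rl i y z := by
    intro i y
    by_cases p1 : P1 i y
    · obtain ⟨x, hx⟩ := p1
      exact ⟨x, Or.inl ⟨⟨x, hx⟩, hx⟩⟩
    by_cases p2 : P2 y
    · exact ⟨y, Or.inr (Or.inl ⟨p1, Or.inl p2, rfl⟩)⟩
    by_cases p3 : P3 i y
    · obtain ⟨hgy, x, hx⟩ := p3
      exact ⟨x, Or.inr (Or.inr ⟨p1, p2, ⟨hgy, x, hx⟩, hx⟩)⟩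
    · exact ⟨y, Or.inr (Or.inl ⟨p1, Or.inr p3, rfl⟩)⟩
  have equi : ∀ T : E → E, (∀ y, T (T y) = y) → (∀ y, T (g y) = g (T y)) →
      (∀ y, T (h y) = h (T y)) → (∀ y ∈ X, T y ∈ X) →
      (∀ θ y z, OrbClose g h θ y z → OrbClose g h θ (T y) (T z)) →
      ∀ i y z, Rl i y z → Rl i (T y) (T z) := by
    intro T hT hTg hTh hTX hTO i y z hyz
    have Ti : ∀ {u v}, T u = T v ↔ u = v := fun {u v} =>
      (Function.LeftInverse.injective (g := T) hT).eq_iff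
    have q1 : ∀ y, P1 i y → P1 i (T y) := by
      rintro y ⟨x, hx, e1, e2, e3⟩
      exact ⟨T x, hTX x hx, by rw [← hTh, e1], by rw [← hTg, e2], hTO _ _ _ e3⟩
    have q2 : ∀ y, P2 (T y) ↔ P2 y := fun y => by
      simp only [P2, ← hTh, ← hTg, Ti]
    have q3 : ∀ y, P3 i y → P3 i (T y) := by
      rintro y ⟨e0, x, hx, e1, e3⟩
      refine ⟨by rwa [← hTg, Ne, Ti], T x, hTX x hx, ?_, hTO _ _ _ e3⟩
      simpa only [← hTh, ← hTg, Ti] using e1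
    have q1' : P1 i (T y) ↔ P1 i y := ⟨fun H => by simpa [hT] using q1 _ H, q1 y⟩
    have q3' : P3 i (T y) ↔ P3 i y := ⟨fun H => by simpa [hT] using q3 _ H, q3 y⟩
    rcases hyz with ⟨a, b, c, d, e⟩ | ⟨a, b, c⟩ | ⟨a, b, c, d, e, f⟩
    · exact Or.inl ⟨q1 y a, hTX _ b, by rw [← hTh, c], by rw [← hTg, d], hTO _ _ _ e⟩
    · refine Or.inr (Or.inl ⟨by rwa [q1'], by rwa [q2, q3'], by rw [c]⟩)
    · refine Or.inr (Or.inr ⟨by rwa [q1'], by rwa [q2], by rwa [q3'], hTX _ d, ?_, hTO _ _ _ f⟩)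
      simpa only [← hTh, ← hTg, Ti] using e
  have hstab : ∀ i y z, Rl i y z →
      (g y = y → g z = z) ∧ (h y = y → h z = z) ∧ (h y = g y → h z = g z) := by
    rintro i y z (⟨a, b, c, d, e⟩ | ⟨a, b, rfl⟩ | ⟨a, b, c, d, e, f⟩)
    · exact ⟨fun _ => d, fun _ => c, fun _ => by rw [c, d]⟩
    · exact ⟨id, id, id⟩
    · exact ⟨fun H => absurd H c.1, fun H => absurd (Or.inl H) b, fun H => absurd (Or.inr H) b⟩
  choose r hr hrg hrh using fun i => exists_equivariant hg.invol hh.invol hc (hRl i)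
    (equi g hg.invol (fun _ => rfl) hc hXg (fun _ _ _ H => H.map_g hg hc) i)
    (equi h hh.invol (fun y => (hc y).symm) (fun _ => rfl) hXh (fun _ _ _ H => H.map_h hh) i)
    (hstab i)
  refine ⟨r, fun i => max (θ i) (θ' i), fun ε hε => ?_, fun i y => ?_, fun i y hy => ?_, hrg, hrh, ?_⟩
  · filter_upwards [hθ ε hε, hθ' ε hε] with i e1 e2
    exact max_lt e1 e2
  · rw [dist_comm]
    rcases hr i y with ⟨a, b, c, d, e⟩ | ⟨a, b, e⟩ | ⟨a, b, c, d, e, f⟩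
    · exact e.1.trans (le_max_right _ _)
    · rw [e, dist_self]
      exact le_max_of_le_left (hθ0 i).le
    · exact f.1.trans (le_max_left _ _)
  · rcases hr i y with ⟨a, b, c, d, e⟩ | ⟨a, b, e⟩ | ⟨a, b, c, d, e, f⟩
    · exact b
    · rwa [e]
    · exact d
  · filter_upwards [h1, h2] with i e1 e2 σ hσ
    -- every vertex is pushed into the singular set
    have hv : ∀ v ∈ σ, ((h (r i v) = r i v ∧ g (r i v) = r i v) ∨
        (¬ P1 i v ∧ OrbClose g h (θ i) v (r i v))) ∧
        (h (r i v) = r i v ∨ h (r i v) = g (r i v)) := by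
      intro v hv
      obtain ⟨z, hz, hz1, hz2⟩ := e1 v (hσ v hv).1 (hσ v hv).2.2
      rcases hr i v with ⟨a, b, c, d, e⟩ | ⟨a, b, e⟩ | ⟨a, b, c, d, e, f⟩
      · exact ⟨Or.inl ⟨c, d⟩, Or.inl c⟩
      · rw [e]
        refine ⟨Or.inr ⟨a, OrbClose.refl (hθ0 i).le _⟩, ?_⟩
        rcases b with b | b
        · exact b
        · exfalso
          by_cases hgv : g v = v
          · exact a (e2 v (hσ v hv).1 (Or.inr ⟨hgv, z, hz1, hz2⟩))
          · exact b ⟨hgv, z, hz, hz1, hz2⟩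
      · exact ⟨Or.inr ⟨a, f⟩, e⟩
    rw [SF_mem]
    simp only [List.forall_mem_map]
    by_contra! hcon
    obtain ⟨⟨v, hvσ, k1⟩, w, hwσ, k2⟩ := hcon
    obtain ⟨a1, a2⟩ := hv v hvσ
    obtain ⟨b1, b2⟩ := hv w hwσ
    have a3 : h (r i v) = g (r i v) := a2.resolve_left k1
    have b3 : h (r i w) = r i w := b2.resolve_right k2
    have a4 := a1.resolve_left fun H => k1 H.1
    have b4 := b1.resolve_left fun H => k2 (by rw [H.1, H.2])
    refine a4.1 (e2 v (hσ v hvσ).1 (Or.inl ⟨w, (hσ w hwσ).1, v, (hσ v hvσ).1, ?_, ?_, ?_, ?_⟩))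
    · exact ((hσ w hwσ).2.1 v hvσ).le
    · exact ((hσ v hvσ).2.1 v hvσ).le
    · exact ⟨_, b3, b4.2⟩
    · exact ⟨_, a3, a4.2⟩

lemma push (hg : Inv g) (hh : Inv h) (hc : ∀ y, g (h y) = h (g y))
    {p : Ger E →ₗ[ZMod 2] Ger E} (hp : IsTr hg p) {X : Set E}
    (hXg : ∀ y ∈ X, g y ∈ X) (hXh : ∀ y ∈ X, h y ∈ X) {R : ℝ}
    (hX : IsCompact (X ∩ Metric.closedBall 0 R))
    (hgR : ∀ y ∈ Metric.closedBall 0 R, ContinuousAt g y)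
    (hhR : ∀ y ∈ Metric.closedBall 0 R, ContinuousAt h y)
    (hghR : ∀ y ∈ Metric.closedBall 0 R, ContinuousAt (g ∘ h) y) {Φ : List (E → ℝ)}
    (hΦ : ∀ φ ∈ Φ, ContinuousOn φ (Metric.closedBall 0 R))
    (hZ : ∀ y ∈ X ∩ Metric.closedBall 0 R, (∀ φ ∈ Φ, φ y = 0) → h y = y ∨ h y = g y)
    {ℓ : ℕ} {u : Ger E} (hu : IsC X R Φ ℓ u) (hd : dV (p u + hh.V (p u)) = 0) :
    ∃ t ∈ Ch X (ℓ + 1), p u + hh.V (p u) = dV (p t + hh.V (p t)) := by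
  classical
  have hB := smithBase hg hh hc hp
  have huC := hu.mem
  obtain ⟨c, rfl, hc'⟩ := hu
  obtain ⟨η, hη0, hη, hcη⟩ := exists_threshold hc'
  obtain ⟨r, δ, hδ, hrδ, hrX, hrg, hrh, hrS⟩ :=
    exists_push hg hh hc hXg hXh hX hgR hhR hghR hΦ hZ hη
  let F : ℕ → ℕ → E → E := fun i k => if k = 0 then id else r i
  have hF0 : ∀ i, F i 0 = id := fun i => if_pos rfl
  have hF1 : ∀ i, F i 1 = r i := fun i => if_neg one_ne_zero
  have hFd : ∀ i k y, dist (F i k y) y ≤ max (δ i) 0 := fun i k y => by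
    by_cases hk : k = 0
    · simp [F, hk]
    · simpa only [F, if_neg hk] using le_max_of_le_left (hrδ i y)
  have hFX : ∀ i k, ∀ y ∈ X, F i k y ∈ X := fun i k y hy => by
    by_cases hk : k = 0
    · simpa [F, hk] using hy
    · simpa only [F, if_neg hk] using hrX i y hy
  have hFar : FarHom F fun _ => 1 := fun ε hε => by
    refine ⟨ε / 2, by positivity, (hδ (ε / 2) (by positivity)).mono fun i hi k _ y hy => ?_⟩
    have h1 := (hFd i k y).trans_lt (max_lt hi (by positivity))
    rw [dist_eq_norm] at h1
    have h2 := norm_sub_norm_le y (F i k y)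
    rw [norm_sub_rev] at h2
    linarith
  have hT := homV_mem hFar (X := X) (X' := X) one_pos (fun ε hε => by
    refine ⟨ε / 3, by positivity, (hδ (ε / 3) (by positivity)).mono ?_⟩
    refine fun i hi k _ y hy _ => ⟨hFX i k y hy, fun k' _ _ _ y' _ _ hd => ?_⟩
    have h1 := (hFd i k y).trans_lt (max_lt hi (by positivity))
    have h2 := (hFd i k' y').trans_lt (max_lt hi (by positivity))
    have h3 := dist_triangle4_right (F i k y) (F i k' y') y y'
    linarith) huC
  have comm : ∀ {T : E → E} (hT : Inv T), (∀ i y, r i (T y) = T (r i y)) → ∀ v,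
      homV F (fun _ => 1) hFar (hT.V v) = hT.V (homV F (fun _ => 1) hFar v) := by
    intro T hT hrT v
    obtain ⟨e, rfl⟩ := mk_surj v
    simp only [hT.V_mk, homV_mk]
    congr 1
    funext i
    refine (lmap_homot _ (fun k y => ?_) _).symm
    by_cases hk : k = 0
    · simp [F, hk]
    · simp only [F, if_neg hk, hrT]
  set t := homV F (fun _ => 1) hFar (mk c) with ht
  refine ⟨t, hT, ?_⟩
  have heq := dV_homV F (fun _ => 1) hFar (mk c)
  have hid : mapV (fun i => F i 0) hFar.zero (mk c) = mk c := by
    rw [mapV_mk]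
    congr 1
    funext i
    rw [hF0, lmap_id]
  rw [hid] at heq
  have hr0 : resV (SF g h) (mapV (fun i => F i 1) hFar.last (mk c)) =
      mapV (fun i => F i 1) hFar.last (mk c) := by
    rw [mapV_mk, resV_mk]
    refine mk_congr ?_
    filter_upwards [hcη, hrS] with i h1 h2
    refine restr_eq_self (map_mem_of_sp _ (fun σ hσ => ?_) h1)
    rw [hF1, lmap_bs]
    refine bs_mem (h2 σ fun v hv => ⟨⟨(hσ.1.1.2 v hv).1, by simpa using (hσ.1.2 v hv).le⟩,
      (hσ.1.1.2 v hv).2, hσ.2 v hv⟩)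
  have hkill : p (mapV (fun i => F i 1) hFar.last (mk c)) +
      hh.V (p (mapV (fun i => F i 1) hFar.last (mk c))) = 0 := by
    rw [← hr0, ← hB.pρ, hB.kill, add_self2]
  have hcomm2 : ∀ v, p (homV F (fun _ => 1) hFar v) + hh.V (p (homV F (fun _ => 1) hFar v)) =
      homV F (fun _ => 1) hFar (p v + hh.V (p v)) := fun v => by
    rw [map_add, comm hh hrh, hp.comm (comm hg hrg)]
  have hzero : p (homV F (fun _ => 1) hFar (dV (mk c))) +
      hh.V (p (homV F (fun _ => 1) hFar (dV (mk c)))) = 0 := by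
    rw [hcomm2, ← hB.pd, ← hB.dh, ← map_add, hd, map_zero]
  have h1 := congrArg (fun v => p v + hh.V (p v)) heq
  simp only [map_add] at h1
  rw [map_add, hB.pd, hB.dh, hB.pd]
  have h2 : p (dV t) + p (homV F (fun _ => 1) hFar (dV (mk c))) +
      (hh.V (p (dV t)) + hh.V (p (homV F (fun _ => 1) hFar (dV (mk c))))) =
      (p (dV t) + hh.V (p (dV t))) := by
    rw [add_add_add_comm, hzero, add_zero]
  have h3 : p (mk c) + p (mapV (fun i => F i 1) hFar.last (mk c)) +
      (hh.V (p (mk c)) + hh.V (p (mapV (fun i => F i 1) hFar.last (mk c)))) =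
      p (mk c) + hh.V (p (mk c)) := by
    rw [add_add_add_comm, hkill, add_zero]
  rw [h2, h3] at h1
  exact h1.symm

end

end InfChain

/-! ## Smith theory for germs of involutions -/

namespace InfChain

open Filter Topology

noncomputable section

/-- Separation of the orbits of an involution by symmetric polynomials. -/
lemma eq_or_eq_of_sym {ι : Type*} {y y' u u' : ι → ℝ} (h1 : ∀ i, y i + y' i = u i + u' i)
    (h2 : ∀ i j, y i * y j + y' i * y' j = u i * u j + u' i * u' j) : u = y ∨ u = y' := by
  have h3 : ∀ i j, (y i - y' i) * (y j - y' j) = (u i - u' i) * (u j - u' j) := by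
    intro i j
    have e1 := h1 i
    have e2 := h1 j
    have e3 := h2 i j
    have e4 : (y i + y' i) * (y j + y' j) = (u i + u' i) * (u j + u' j) := by rw [e1, e2]
    nlinarith
  by_cases h4 : ∀ i, y i - y' i = 0
  · left
    funext i
    have e1 := h3 i i
    rw [h4 i, zero_mul] at e1
    have e2 := mul_self_eq_zero.1 e1.symm
    have := h4 i
    have := h1 i
    linarith
  · push Not at h4
    obtain ⟨k, hk⟩ := h4
    rcases mul_self_eq_mul_self_iff.1 (h3 k k) with e | e
    · left
      funext i
      have e1 := h3 i k
      rw [← e] at e1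
      have := mul_right_cancel₀ hk e1
      have := h1 i
      linarith
    · right
      funext i
      have e1 := h3 i k
      have e2 : u k - u' k = - (y k - y' k) := by linarith
      rw [e2, mul_neg, ← neg_mul] at e1
      have := mul_right_cancel₀ hk e1
      have := h1 i
      linarith

variable {n : ℕ} {g h : EuclideanSpace ℝ (Fin n) → EuclideanSpace ℝ (Fin n)}

/-- Finitely many odd functions whose common zeros are the singular points. -/
lemma exists_sep (hg : Inv g) (hh : Inv h) (hc : ∀ y, g (h y) = h (g y)) {R : ℝ}
    (hgR : ∀ y ∈ Metric.closedBall 0 R, ContinuousAt g y)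
    (hhR : ∀ y ∈ Metric.closedBall 0 R, ContinuousAt h y)
    (hghR : ∀ y ∈ Metric.closedBall 0 R, ContinuousAt (g ∘ h) y) :
    ∃ Φ : List (EuclideanSpace ℝ (Fin n) → ℝ),
      (∀ φ ∈ Φ, ContinuousOn φ (Metric.closedBall 0 R) ∧ (∀ y, φ (g y) = φ y) ∧
        ∀ y, φ (h y) = - φ y) ∧ ∀ y, (∀ φ ∈ Φ, φ y = 0) → h y = y ∨ h y = g y := by
  let s : Fin n → EuclideanSpace ℝ (Fin n) → ℝ := fun i y =>
    (y i + g y i) - (h y i + g (h y) i)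
  let q : Fin n × Fin n → EuclideanSpace ℝ (Fin n) → ℝ := fun i y =>
    (y i.1 * y i.2 + g y i.1 * g y i.2) - (h y i.1 * h y i.2 + g (h y) i.1 * g (h y) i.2)
  have c1 : ∀ (T : EuclideanSpace ℝ (Fin n) → EuclideanSpace ℝ (Fin n)) (i : Fin n) y,
      ContinuousAt T y → ContinuousAt (fun y => T y i) y := fun T i y hT =>
    ContinuousAt.comp (g := fun z : EuclideanSpace ℝ (Fin n) => z i)
      (by fun_prop) hT
  refine ⟨(Finset.univ.toList).map s ++ (Finset.univ.toList).map q, fun φ hφ => ?_, fun y hy => ?_⟩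
  · simp only [List.mem_append, List.mem_map, Finset.mem_toList, Finset.mem_univ, true_and] at hφ
    rcases hφ with ⟨i, rfl⟩ | ⟨i, rfl⟩
    · refine ⟨fun y hy => ContinuousAt.continuousWithinAt ?_, fun y => ?_, fun y => ?_⟩
      · have a1 := c1 _ i y (hgR y hy)
        have a2 := c1 _ i y (hhR y hy)
        have a3 := c1 _ i y (hghR y hy)
        have a4 := c1 _ i y continuousAt_id
        exact (a4.add a1).sub (a2.add a3)
      · simp only [s, hg.invol, ← hc]
        ring
      · simp only [s, hh.invol]
        ring
    · refine ⟨fun y hy => ContinuousAt.continuousWithinAt ?_, fun y => ?_, fun y => ?_⟩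
      · have a1 := fun i => c1 _ i y (hgR y hy)
        have a2 := fun i => c1 _ i y (hhR y hy)
        have a3 := fun i => c1 _ i y (hghR y hy)
        have a4 := fun i => c1 _ i y continuousAt_id
        exact (((a4 _).mul (a4 _)).add ((a1 _).mul (a1 _))).sub
          (((a2 _).mul (a2 _)).add ((a3 _).mul (a3 _)))
      · simp only [q, hg.invol, ← hc]
        ring
      · simp only [q, hh.invol]
        ring
  · simp only [List.mem_append, List.mem_map, Finset.mem_toList, Finset.mem_univ, true_and] at hy
    have e1 : ∀ i, y i + g y i = h y i + g (h y) i := fun i =>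
      sub_eq_zero.1 (hy (s i) (Or.inl ⟨i, rfl⟩))
    have e2 : ∀ i j, y i * y j + g y i * g y j = h y i * h y j + g (h y) i * g (h y) j :=
      fun i j => sub_eq_zero.1 (hy (q (i, j)) (Or.inr ⟨(i, j), rfl⟩))
    rcases eq_or_eq_of_sym (y := fun i => y i) (y' := fun i => g y i) (u := fun i => h y i)
      (u' := fun i => g (h y) i) e1 e2 with e | e
    · exact Or.inl (by ext i; exact congrFun e i)
    · exact Or.inr (by ext i; exact congrFun e i)

/-- `X` is locally compact at the origin. -/
def LC0 {E : Type*} [NormedAddCommGroup E] (X : Set E) : Prop :=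
  ∃ R > 0, IsCompact (X ∩ Metric.closedBall 0 R)

lemma LC0.of_le {E : Type*} [NormedAddCommGroup E] {X : Set E} (hX : LC0 X) :
    ∃ R > 0, ∀ R' ≤ R, IsCompact (X ∩ Metric.closedBall 0 R') := by
  obtain ⟨R, hR, h1⟩ := hX
  refine ⟨R, hR, fun R' hR' => ?_⟩
  have : X ∩ Metric.closedBall 0 R' = (X ∩ Metric.closedBall 0 R) ∩ Metric.closedBall 0 R' := by
    rw [Set.inter_assoc, Set.inter_eq_self_of_subset_right
      (Metric.closedBall_subset_closedBall hR')]
  rw [this]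
  exact h1.inter_right Metric.isClosed_closedBall

lemma resV_mem_Ch {E : Type*} [NormedAddCommGroup E] {D : Set (List E)} {X : Set E} {ℓ : ℕ}
    {z : Ger E} (hz : z ∈ Ch X ℓ) : resV D z ∈ Ch X ℓ :=
  resV_mem (fun _ _ h => h) hz

/-- Smith theory for a transfer. -/
theorem smith_tr (hg : Inv g) (hh : Inv h) (hc : ∀ y, g (h y) = h (g y))
    {p : Ger (EuclideanSpace ℝ (Fin n)) →ₗ[ZMod 2] Ger (EuclideanSpace ℝ (Fin n))}
    (hp : IsTr hg p) {X : Set (EuclideanSpace ℝ (Fin n))}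
    (hXg : ∀ y ∈ X, g y ∈ X) (hXh : ∀ y ∈ X, h y ∈ X) (hX : LC0 X) :
    Smith dV (LinearMap.id + hh.V) (im p (Ch X))
      (fun ℓ => ((Ch X ℓ).map p).map (resV (SF g h))) := by
  obtain ⟨R1, hR1, hX⟩ := hX.of_le
  obtain ⟨R2, hR2, h2⟩ := exists_closedBall (hg.cont.and (hh.cont.and (hg.comp hh hc).cont))
  set R := min R1 R2 with hRdef
  have hR : 0 < R := lt_min hR1 hR2
  have hXR := hX R (min_le_left _ _)
  have h3 := h2 R (min_le_right _ _)
  obtain ⟨T, hTg, hTh⟩ := exists_half hg hh hc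
  obtain ⟨Φ, hΦ, hZ⟩ := exists_sep hg hh hc (fun y hy => (h3 y hy).1) (fun y hy => (h3 y hy).2.1)
    (fun y hy => (h3 y hy).2.2)
  refine (smithBase hg hh hc hp).smith (Ch X) (Ch_zero X) (fun ℓ c hc => dV_mem hc)
    (fun ℓ c hc => hh.mem_Ch hXh hc) (fun ℓ c hc => resV_mem_Ch hc)
    (fun φ : EuclideanSpace ℝ (Fin n) → ℝ => ContinuousOn φ (Metric.closedBall 0 R) ∧
      (∀ y, φ (g y) = φ y) ∧ ∀ y, φ (h y) = - φ y) (fun φ => resV (selSet g h T φ))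
    (fun φ hφ => selector_selSet hg hh hc hp hTg hTh hφ.2.1 hφ.2.2)
    (fun φ _ ℓ c hc => resV_mem_Ch hc) (IsC X R) (fun _ _ _ hz => hz.mem)
    (fun ℓ v hv => isC_nil hR hv) (fun Φ φ hφ ℓ v hv => hv.step hφ.1 hφ.2.1 hφ.2.2) Φ hΦ
    ⟨fun _ => 0, continuousOn_const, fun _ => rfl, fun _ => by simp⟩ ?_
  exact fun ℓ u hu hd => push hg hh hc hp hXg hXh hXR (fun y hy => (h3 y hy).1)
    (fun y hy => (h3 y hy).2.1) (fun y hy => (h3 y hy).2.2) (fun φ hφ => (hΦ φ hφ).1)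
    (fun y _ hy => hZ y hy) hu hd

/-- The fixed part of the transfer complex. -/
lemma map_resV_eq {p : Ger (EuclideanSpace ℝ (Fin n)) →ₗ[ZMod 2] Ger (EuclideanSpace ℝ (Fin n))}
    (hg : Inv g) (hh : Inv h) (hc : ∀ y, g (h y) = h (g y)) (hp : IsTr hg p)
    (X : Set (EuclideanSpace ℝ (Fin n))) (ℓ : ℕ) :
    ((Ch X ℓ).map p).map (resV (SF g h)) =
      (Ch (X ∩ {y | h y = y}) ℓ).map p ⊔ (Ch (X ∩ {y | h y = g y}) ℓ).map p := by
  have hcomm := (smithBase hg hh hc hp).pρ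
  apply le_antisymm
  · rintro _ ⟨_, ⟨c, hcX, rfl⟩, rfl⟩
    have hsplit : resV (SF g h) c = resV {σ | ∀ v ∈ σ, h v = v} c +
        resV ({σ | ∀ v ∈ σ, h v = g v} \ {σ | ∀ v ∈ σ, h v = v}) c := by
      obtain ⟨c, rfl⟩ := mk_surj c
      simp only [resV_mk, ← map_add]
      congr 1
      funext i
      have : restr (SF g h) = restr {σ | ∀ v ∈ σ, h v = v} +
          restr ({σ | ∀ v ∈ σ, h v = g v} \ {σ | ∀ v ∈ σ, h v = v}) := by
        refine hom_ext' fun σ => ?_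
        simp only [LinearMap.add_apply, restr_bs, SF_mem, Set.mem_sdiff, Set.mem_ofPred_eq]
        by_cases h1 : ∀ v ∈ σ, h v = v
        · rw [if_pos (Or.inl h1), if_pos h1, if_neg fun h2 => h2.2 h1, add_zero]
        · simp only [h1, false_or, if_false, zero_add, not_false_iff, and_true]
      exact LinearMap.congr_fun this (c i)
    rw [hcomm, hsplit, map_add]
    refine Submodule.add_mem_sup ⟨_, ?_, rfl⟩ ⟨_, ?_, rfl⟩
    · exact resV_mem (D := {σ | ∀ v ∈ σ, h v = v}) (X := X) (Y := X ∩ {y | h y = y})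
        (fun σ h1 h2 v hv => ⟨h2 v hv, h1 v hv⟩) hcX
    · exact resV_mem (X := X) (Y := X ∩ {y | h y = g y})
        (fun σ h1 h2 v hv => ⟨h2 v hv, h1.1 v hv⟩) hcX
  · refine sup_le ?_ ?_
    · rintro _ ⟨c, hcX, rfl⟩
      have h1 : resV (SF g h) c = c :=
        resV_eq_self (fun σ hσ => SF_mem.2 (Or.inl fun v hv => (hσ v hv).2)) hcX
      exact ⟨p c, ⟨c, Ch_mono Set.inter_subset_left _ hcX, rfl⟩, by rw [hcomm, h1]⟩
    · rintro _ ⟨c, hcX, rfl⟩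
      have h1 : resV (SF g h) c = c :=
        resV_eq_self (fun σ hσ => SF_mem.2 (Or.inr fun v hv => (hσ v hv).2)) hcX
      exact ⟨p c, ⟨c, Ch_mono Set.inter_subset_left _ hcX, rfl⟩, by rw [hcomm, h1]⟩

/-- Smith theory for an involution. -/
theorem smith_inv (hh : Inv h) {X : Set (EuclideanSpace ℝ (Fin n))}
    (hXh : ∀ y ∈ X, h y ∈ X) (hX : LC0 X) :
    Smith dV (LinearMap.id + hh.V) (Ch X) (Ch (X ∩ {y | h y = y})) := by
  have h1 := smith_tr Inv.id hh (fun _ => rfl) (p := LinearMap.id) (Or.inl ⟨rfl, fun _ => rfl⟩)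
    (X := X) (fun y hy => hy) hXh hX
  have h2 : im LinearMap.id (Ch X) = Ch X := by
    funext ℓ
    exact Submodule.map_id _
  rw [h2] at h1
  convert h1 using 1
  funext ℓ
  rw [map_resV_eq Inv.id hh (fun _ => rfl) (Or.inl ⟨rfl, fun _ => rfl⟩)]
  simp only [Submodule.map_id, id_eq, sup_idem]

lemma van_map_of_pure (hg : Inv g) {Y : Set (EuclideanSpace ℝ (Fin n))}
    (hYg : ∀ y ∈ Y, g y ∈ Y) (hY : LC0 Y) {r : ℕ} (h1 : Pure dV (Ch Y) r)
    (h2 : Pure dV (Ch (Y ∩ {y | g y = y})) r) (ℓ : ℕ) :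
    Van dV (im (LinearMap.id + hg.V) (Ch Y)) ℓ := by
  obtain ⟨r', -, -, h3, h4, -⟩ := (smith_inv hg hYg hY).main h1
  obtain rfl := h2.unique h3
  exact h4 ℓ (le_or_gt _ _)

lemma LC0.fix {X : Set (EuclideanSpace ℝ (Fin n))} (hX : LC0 X) (hg : Inv g) :
    LC0 (X ∩ {y | g y = y}) := by
  obtain ⟨R1, hR1, hX⟩ := hX.of_le
  obtain ⟨R2, hR2, h2⟩ := exists_closedBall hg.cont
  refine ⟨min R1 R2, lt_min hR1 hR2, ?_⟩
  have h3 : ContinuousOn g (Metric.closedBall 0 (min R1 R2)) := fun y hy =>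
    (h2 _ (min_le_right _ _) y hy).continuousWithinAt
  have h4 : X ∩ {y | g y = y} ∩ Metric.closedBall 0 (min R1 R2) =
      (X ∩ Metric.closedBall 0 (min R1 R2)) ∩
        (Metric.closedBall 0 (min R1 R2) ∩ {y | g y = y}) := by
    ext y
    simp only [Set.mem_inter_iff]
    tauto
  rw [h4]
  refine (hX _ (min_le_left _ _)).inter_right ?_
  have : Metric.closedBall 0 (min R1 R2) ∩ {y | g y = y} =
      Metric.closedBall 0 (min R1 R2) ∩ (fun y => g y - y) ⁻¹' {0} := by
    ext y
    simp [sub_eq_zero]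
  rw [this]
  exact (h3.sub continuousOn_id).preimage_isClosed_of_isClosed Metric.isClosed_closedBall
    isClosed_singleton

/-- The singular part of a transfer complex is acyclic. -/
lemma van_sing (hg : Inv g) (hh : Inv h) (hc : ∀ y, g (h y) = h (g y))
    {X : Set (EuclideanSpace ℝ (Fin n))}
    (hXg : ∀ y ∈ X, g y ∈ X) (hX : LC0 X) {r : ℕ}
    (h1 : Pure dV (Ch (X ∩ {y | h y = y})) r) (h2 : Pure dV (Ch (X ∩ {y | h y = g y})) r)
    (h3 : Pure dV (Ch (X ∩ {y | g y = y ∧ h y = y})) r) (ℓ : ℕ) :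
    Van dV (fun ℓ => ((Ch X ℓ).map (LinearMap.id + hg.V)).map (resV (SF g h))) ℓ := by
  set p : Ger (EuclideanSpace ℝ (Fin n)) →ₗ[ZMod 2] Ger (EuclideanSpace ℝ (Fin n)) :=
    LinearMap.id + hg.V with hpdef
  have hp : IsTr hg p := Or.inr rfl
  have hS := smith_inv hg hXg hX
  have hgh := hg.comp hh hc
  have v1 := van_map_of_pure hg (Y := X ∩ {y | h y = y})
    (fun y hy => ⟨hXg y hy.1, by rw [Set.mem_ofPred_eq, ← hc, hy.2]⟩) (hX.fix hh) h1 (by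
      convert h3 using 2
      ext y
      simp only [Set.mem_inter_iff, Set.mem_ofPred_eq]
      tauto)
  have e2 : {y | h y = g y} = {y | (g ∘ h) y = y} := by
    ext y
    simp only [Set.mem_ofPred_eq, Function.comp]
    constructor
    · intro e
      rw [e, hg.invol]
    · intro e
      have := congrArg g e
      rwa [hg.invol] at this
  have v2 := van_map_of_pure hg (Y := X ∩ {y | h y = g y})
    (fun y hy => ⟨hXg y hy.1, by rw [Set.mem_ofPred_eq, ← hc, hy.2]⟩)
    (by rw [e2]; exact hX.fix hgh) h2 (by
      convert h3 using 2
      ext y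
      simp only [Set.mem_inter_iff, Set.mem_ofPred_eq]
      constructor
      · rintro ⟨⟨a, b⟩, c⟩
        exact ⟨a, c, by rw [b, c]⟩
      · rintro ⟨a, b, c⟩
        exact ⟨⟨a, by rw [b, c]⟩, b⟩)
  have hpd := (smithBase hg hh hc hp).pd
  intro z hz dz
  simp only [map_resV_eq hg hh hc hp] at hz ⊢
  obtain ⟨_, ⟨c1, hc1, rfl⟩, _, ⟨c2, hc2, rfl⟩, rfl⟩ := Submodule.mem_sup.1 hz
  have key : dV (p c1) = 0 := by
    rcases ℓ with _ | ℓ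
    · rw [SetLike.mem_coe, Ch_zero, Submodule.mem_bot] at hc1
      rw [hc1, map_zero, map_zero]
    · have e3 : p (dV c1) = p (dV c2) := by
        rw [map_add] at dz
        rw [← hpd, ← hpd]
        exact eq_of_add_eq_zero2 dz
      have e4 : p (dV c1) ∈ Ch (X ∩ {y | h y = y}) ℓ :=
        add_mem (dV_mem hc1) (hg.mem_Ch (X := X ∩ {y | h y = y})
          (X' := X ∩ {y | h y = y}) (fun y hy => ⟨hXg y hy.1, by
          rw [Set.mem_ofPred_eq, ← hc, hy.2]⟩) (dV_mem hc1))
      have e5 : p (dV c2) ∈ Ch (X ∩ {y | h y = g y}) ℓ :=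
        add_mem (dV_mem hc2) (hg.mem_Ch (X := X ∩ {y | h y = g y})
          (X' := X ∩ {y | h y = g y}) (fun y hy => ⟨hXg y hy.1, by
          rw [Set.mem_ofPred_eq, ← hc, hy.2]⟩) (dV_mem hc2))
      rw [← e3] at e5
      rw [hpd]
      refine hS.inter ℓ (dV c1) (Ch_mono Set.inter_subset_left _ (dV_mem hc1)) ?_
      refine Ch_mono ?_ _ (Ch_inter e4 e5)
      rintro y ⟨⟨a, b⟩, -, c⟩
      refine ⟨a, ?_⟩
      rw [Set.mem_ofPred_eq] at b c ⊢
      rw [← c, b]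
  have key2 : dV (p c2) = 0 := by
    rwa [map_add, key, zero_add] at dz
  obtain ⟨w1, hw1, e1⟩ := v1 ℓ (p c1) ⟨c1, hc1, rfl⟩ key
  obtain ⟨w2, hw2, e2⟩ := v2 ℓ (p c2) ⟨c2, hc2, rfl⟩ key2
  exact ⟨w1 + w2, Submodule.add_mem_sup hw1 hw2, by rw [map_add, e1, e2]⟩

/-- The Borel-type rank restriction for two commuting involutions. -/
theorem pure_eq_of_rank_two (hg : Inv g) (hh : Inv h) (hc : ∀ y, g (h y) = h (g y))
    {X : Set (EuclideanSpace ℝ (Fin n))}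
    (hXg : ∀ y ∈ X, g y ∈ X) (hXh : ∀ y ∈ X, h y ∈ X) (hX : LC0 X) {m r : ℕ}
    (hm : Pure dV (Ch X) m) (h0 : Pure dV (Ch (X ∩ {y | g y = y})) r)
    (h1 : Pure dV (Ch (X ∩ {y | h y = y})) r) (h2 : Pure dV (Ch (X ∩ {y | h y = g y})) r)
    (h3 : Pure dV (Ch (X ∩ {y | g y = y ∧ h y = y})) r) : m = r := by
  refine Smith.rank_two (a := LinearMap.id + hg.V) (b := LinearMap.id + hh.V) ?_
    (smith_inv hg hXg hX)
    (smith_tr hg hh hc (p := LinearMap.id + hg.V) (Or.inr rfl) hXg hXh hX)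
    (smith_tr hh hg (fun y => (hc y).symm) (p := LinearMap.id + hh.V) (Or.inr rfl) hXh hXg hX)
    (van_sing hg hh hc hXg hX h1 h2 h3)
    (van_sing hh hg (fun y => (hc y).symm) hXh hX h0 ?_ ?_) ?_ hm h0
  · intro v
    simp only [LinearMap.add_apply, LinearMap.id_apply, map_add, hg.V_comm hh hc]
    abel
  · convert h2 using 5
    exact eq_comm
  · convert h3 using 5
    exact and_comm
  · exact fun ℓ s hs => add_mem hs (hh.mem_Ch hXh hs)

end

end InfChain

/-! ## Suspension along a flow -/

namespace InfChain

open Filter Topology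

noncomputable section

section Algebra

variable {V : Type*} [AddCommGroup V] [Module (ZMod 2) V]

/-- The Mayer-Vietoris form of the suspension isomorphism. -/
structure Suspends (d : V →ₗ[ZMod 2] V) (C Cp Cm C0 : ℕ → Submodule (ZMod 2) V) : Prop where
  dd : ∀ v, d (d v) = 0
  dC : ∀ ℓ, ∀ s ∈ C (ℓ + 1), d s ∈ C ℓ
  dp : ∀ ℓ, ∀ s ∈ Cp (ℓ + 1), d s ∈ Cp ℓ
  dm : ∀ ℓ, ∀ s ∈ Cm (ℓ + 1), d s ∈ Cm ℓ
  pC : ∀ ℓ, Cp ℓ ≤ C ℓ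
  mC : ∀ ℓ, Cm ℓ ≤ C ℓ
  op : ∀ ℓ, C0 ℓ ≤ Cp ℓ
  om : ∀ ℓ, C0 ℓ ≤ Cm ℓ
  inter : ∀ ℓ, ∀ v ∈ Cp ℓ, v ∈ Cm ℓ → v ∈ C0 ℓ
  vp : ∀ ℓ, Van d Cp ℓ
  vm : ∀ ℓ, Van d Cm ℓ
  snap : ∀ ℓ, ∀ z ∈ C ℓ, ∃ R : V →ₗ[ZMod 2] V, (∀ v, R (d v) = d (R v)) ∧
    (∀ m, ∀ s ∈ Cp m, R s ∈ Cp m) ∧ (∀ m, ∀ s ∈ Cm m, R s ∈ Cm m) ∧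
    (∀ m, ∀ s ∈ C0 m, R s = s) ∧ (∃ a ∈ Cp ℓ, ∃ b ∈ Cm ℓ, R z = a + b) ∧
    ∀ m, ∀ s ∈ C m, d s = 0 → ∃ w ∈ C (m + 1), d w = s + R s

variable {d : V →ₗ[ZMod 2] V} {C Cp Cm C0 : ℕ → Submodule (ZMod 2) V}

lemma Suspends.split (h : Suspends d C Cp Cm C0) {ℓ : ℕ} {z : V} (hz : z ∈ C (ℓ + 1))
    (dz : d z = 0) : ∃ a ∈ Cp (ℓ + 1), ∃ b ∈ Cm (ℓ + 1), ∃ w ∈ C (ℓ + 2), d w = z + (a + b) ∧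
      d a = d b ∧ d a ∈ C0 ℓ := by
  obtain ⟨R, hRd, -, -, -, ⟨a, ha, b, hb, e⟩, hw⟩ := h.snap _ z hz
  obtain ⟨w, hwC, e2⟩ := hw _ z hz dz
  have e3 : d a = d b := by
    have h1 : d (a + b) = 0 := by rw [← e, ← hRd, dz, map_zero]
    rw [map_add] at h1
    exact eq_of_add_eq_zero2 h1
  refine ⟨a, ha, b, hb, w, hwC, by rw [e2, e], e3, ?_⟩
  exact h.inter _ _ (h.dp _ _ ha) (e3 ▸ h.dm _ _ hb)

lemma Suspends.van (h : Suspends d C Cp Cm C0) {ℓ : ℕ} (hv : Van d C0 ℓ) : Van d C (ℓ + 1) := by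
  intro z hz dz
  obtain ⟨a, ha, b, hb, w, hw, e1, e2, e3⟩ := h.split hz dz
  obtain ⟨u, hu, e4⟩ := hv _ e3 (h.dd _)
  obtain ⟨w1, hw1, e5⟩ := h.vp _ (a + u) (add_mem ha (h.op _ hu)) (by rw [map_add, e4, add_self2])
  obtain ⟨w2, hw2, e6⟩ := h.vm _ (b + u) (add_mem hb (h.om _ hu))
    (by rw [map_add, e4, e2, add_self2])
  refine ⟨w + w1 + w2, add_mem (add_mem hw (h.pC _ hw1)) (h.mC _ hw2), ?_⟩
  rw [map_add, map_add, e1, e5, e6, ← add_eq_zero2]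
  abel_nf
  simp only [two_zsmul_eq_zero, add_zero]

lemma Suspends.one (h : Suspends d C Cp Cm C0) {ℓ : ℕ} (ho : One d C0 ℓ) : One d C (ℓ + 1) := by
  obtain ⟨e0, he0, de0, hn, huniq⟩ := ho
  obtain ⟨a0, ha0, ea0⟩ := h.vp _ e0 (h.op _ he0) de0
  obtain ⟨b0, hb0, eb0⟩ := h.vm _ e0 (h.om _ he0) de0
  refine ⟨a0 + b0, add_mem (h.pC _ ha0) (h.mC _ hb0), by rw [map_add, ea0, eb0, add_self2], ?_, ?_⟩
  · rintro ⟨w, hw, ew⟩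
    obtain ⟨R, hRd, hRp, hRm, hR0, ⟨a, ha, b, hb, e⟩, -⟩ := h.snap _ w hw
    have h1 : R a0 + d a = R b0 + d b := by
      have h2 : R (a0 + b0) = d (a + b) := by rw [← e, ← hRd, ew]
      rw [map_add, map_add] at h2
      rw [← add_eq_zero2] at h2 ⊢
      rw [← h2]
      abel
    refine hn ⟨R a0 + d a, h.inter _ _ (add_mem (hRp _ _ ha0) (h.dp _ _ ha)) ?_, ?_⟩
    · rw [h1]
      exact add_mem (hRm _ _ hb0) (h.dm _ _ hb)
    · rw [map_add, h.dd, add_zero, ← hRd, ea0, hR0 _ _ he0]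
  · intro z hz dz
    obtain ⟨a, ha, b, hb, w, hw, e1, e2, e3⟩ := h.split hz dz
    rcases huniq _ e3 (h.dd _) with ⟨u, hu, e4⟩ | ⟨u, hu, e4⟩
    · left
      obtain ⟨w1, hw1, e5⟩ := h.vp _ (a + u) (add_mem ha (h.op _ hu))
        (by rw [map_add, e4, add_self2])
      obtain ⟨w2, hw2, e6⟩ := h.vm _ (b + u) (add_mem hb (h.om _ hu))
        (by rw [map_add, e4, e2, add_self2])
      refine ⟨w + w1 + w2, add_mem (add_mem hw (h.pC _ hw1)) (h.mC _ hw2), ?_⟩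
      rw [map_add, map_add, e1, e5, e6, ← add_eq_zero2]
      abel_nf
      simp only [two_zsmul_eq_zero, add_zero]
    · right
      obtain ⟨w1, hw1, e5⟩ := h.vp _ (a + u + a0) (add_mem (add_mem ha (h.op _ hu)) ha0)
        (by rw [map_add, map_add, e4, ea0, ← add_assoc, add_self2, zero_add, add_self2])
      obtain ⟨w2, hw2, e6⟩ := h.vm _ (b + u + b0) (add_mem (add_mem hb (h.om _ hu)) hb0)
        (by rw [map_add, map_add, e4, eb0, e2, ← add_assoc, add_self2, zero_add, add_self2])
      refine ⟨w + w1 + w2, add_mem (add_mem hw (h.pC _ hw1)) (h.mC _ hw2), ?_⟩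
      rw [map_add, map_add, e1, e5, e6, ← add_eq_zero2]
      abel_nf
      simp only [two_zsmul_eq_zero, add_zero]

end Algebra

section Germ

variable {E : Type*} [NormedAddCommGroup E]

/-- A sequence of maps converging uniformly to the identity is chain homotopic to it. -/
lemma exists_homot_near_id {r : ℕ → E → E} {δ : ℕ → ℝ}
    (hδ : ∀ ε > 0, ∀ᶠ i in (UF : Filter ℕ), δ i < ε)
    (hr : ∀ᶠ i in (UF : Filter ℕ), ∀ y, dist (r i y) y ≤ δ i) :
    ∃ hf : FarMap r, (∀ (X X' : Set E), (∀ i, ∀ y ∈ X, r i y ∈ X') → ∀ ℓ, ∀ z ∈ Ch X ℓ,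
        mapV r hf z ∈ Ch X' ℓ) ∧
      ∃ P : Ger E →ₗ[ZMod 2] Ger E, (∀ v, dV (P v) + P (dV v) = v + mapV r hf v) ∧
        ∀ X : Set E, (∀ i, ∀ y ∈ X, r i y ∈ X) → ∀ ℓ, ∀ z ∈ Ch X ℓ, P z ∈ Ch X (ℓ + 1) := by
  let F : ℕ → ℕ → E → E := fun i k => if k = 0 then id else r i
  have hF0 : ∀ i, F i 0 = id := fun i => if_pos rfl
  have hF1 : ∀ i, F i 1 = r i := fun i => if_neg one_ne_zero
  have hFd : ∀ ε > 0, ∀ᶠ i in (UF : Filter ℕ), ∀ k y, dist (F i k y) y < ε := fun ε hε => by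
    filter_upwards [hδ ε hε, hr] with i h1 h2 k y
    by_cases hk : k = 0
    · simpa [F, hk] using hε
    · simpa only [F, if_neg hk] using (h2 y).trans_lt h1
  have hFar : FarHom F fun _ => 1 := fun ε hε => by
    refine ⟨ε / 2, by positivity, (hFd (ε / 2) (by positivity)).mono fun i hi k _ y hy => ?_⟩
    have h1 := hi k y
    rw [dist_eq_norm] at h1
    have h2 := norm_sub_norm_le y (F i k y)
    rw [norm_sub_rev] at h2
    linarith
  have hF1' : (fun i => F i 1) = r := funext hF1
  have hlast : FarMap r := hF1' ▸ hFar.last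
  refine ⟨hlast, fun X X' hX ℓ z hz => ?_, homV F (fun _ => 1) hFar, fun v => ?_,
    fun X hX ℓ z hz => ?_⟩
  · refine mapV_mem hlast one_pos (fun ε hε => ?_) hz
    refine ⟨ε / 3, by positivity, (hFd (ε / 3) (by positivity)).mono fun i hi y hy _ => ?_⟩
    refine ⟨hX i y hy, fun y' _ _ hd => ?_⟩
    have h1 := hi 1 y
    have h2 := hi 1 y'
    rw [hF1] at h1 h2
    have h3 := dist_triangle4_right (r i y) (r i y') y y'
    linarith
  · rw [dV_homV]
    obtain ⟨c, rfl⟩ := mk_surj v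
    simp only [mapV_mk, hF0, hF1, lmap_id]
  · refine homV_mem hFar one_pos (fun ε hε => ?_) hz
    refine ⟨ε / 3, by positivity, (hFd (ε / 3) (by positivity)).mono fun i hi k _ y hy _ => ?_⟩
    refine ⟨?_, fun k' _ _ _ y' _ _ hd => ?_⟩
    · by_cases hk : k = 0
      · simpa [F, hk] using hy
      · simpa only [F, if_neg hk] using hX i y hy
    · have h1 := hi k y
      have h2 := hi k' y'
      have h3 := dist_triangle4_right (F i k y) (F i k' y') y y'
      linarith

/-- A local flow on `X` along which `f` grows at unit speed. -/
structure Flow (X : Set E) (f : E → ℝ) (θ : ℝ → E → E) (ρ t₀ : ℝ) : Prop where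
  ρ_pos : 0 < ρ
  t_pos : 0 < t₀
  cont : ContinuousOn (fun p : ℝ × E => θ p.1 p.2) (Set.Icc (-t₀) t₀ ×ˢ Metric.closedBall 0 ρ)
  fcont : ContinuousOn f (Metric.closedBall 0 ρ)
  zero : ∀ y ∈ Metric.closedBall (0 : E) ρ, θ 0 y = y
  f0 : f 0 = 0
  mem : ∀ y ∈ X, ‖y‖ ≤ ρ → ∀ t, |t| ≤ t₀ → θ t y ∈ X
  add : ∀ y ∈ X, ‖y‖ ≤ ρ → ∀ t, |t| ≤ t₀ → f (θ t y) = f y + t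

variable {X : Set E} {f : E → ℝ} {θ : ℝ → E → E} {ρ t₀ : ℝ}

/-- Reversing a flow. -/
lemma Flow.neg (h : Flow X f θ ρ t₀) : Flow X (fun y => - f y) (fun t => θ (-t)) ρ t₀ where
  ρ_pos := h.ρ_pos
  t_pos := h.t_pos
  cont := by
    refine h.cont.comp (f := fun p : ℝ × E => (-p.1, p.2)) (by fun_prop) ?_
    rintro ⟨t, y⟩ ⟨ht, hy⟩
    exact ⟨⟨by linarith [ht.2], by linarith [ht.1]⟩, hy⟩
  fcont := h.fcont.neg
  zero y hy := by simpa using h.zero y hy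
  f0 := by simp [h.f0]
  mem y hy hyρ t ht := h.mem y hy hyρ _ (by rwa [abs_neg])
  add y hy hyρ t ht := by rw [h.add y hy hyρ _ (by rwa [abs_neg])]; ring

variable [ProperSpace E]

lemma Flow.unif (h : Flow X f θ ρ t₀) {ε : ℝ} (hε : 0 < ε) : ∃ ε' > 0, ∀ t t' y y', |t| ≤ t₀ →
    |t'| ≤ t₀ → ‖y‖ ≤ ρ → ‖y'‖ ≤ ρ → |t - t'| < ε' → dist y y' < ε' →
      dist (θ t y) (θ t' y') < ε := by
  have hc : IsCompact (Set.Icc (-t₀) t₀ ×ˢ Metric.closedBall (0 : E) ρ) :=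
    isCompact_Icc.prod (isCompact_closedBall _ _)
  obtain ⟨ε', hε', h1⟩ := Metric.uniformContinuousOn_iff.1
    (hc.uniformContinuousOn_of_continuous h.cont) ε hε
  refine ⟨ε', hε', fun t t' y y' ht ht' hy hy' h2 h3 => ?_⟩
  refine h1 (t, y) ⟨abs_le.1 ht, by simpa using hy⟩ (t', y') ⟨abs_le.1 ht', by simpa using hy'⟩ ?_
  rw [Prod.dist_eq, max_lt_iff, Real.dist_eq]
  exact ⟨h2, h3⟩

/-- The upper half is acyclic. -/
lemma Flow.van_half (h : Flow X f θ ρ t₀) (ℓ : ℕ) : Van dV (Ch (X ∩ {y | 0 ≤ f y})) ℓ := by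
  classical
  set Y := X ∩ {y | 0 ≤ f y} with hY
  have hρ := h.ρ_pos
  have ht0 := h.t_pos
  have hfr : ∀ τ > 0, ∃ δ > 0, δ ≤ ρ ∧ ∀ y, ‖y‖ < δ → |f y| < τ := by
    intro τ hτ
    have h1 := h.fcont 0 (by simpa using hρ.le)
    rw [Metric.continuousWithinAt_iff] at h1
    obtain ⟨δ, hδ, h2⟩ := h1 τ hτ
    refine ⟨min δ ρ, lt_min hδ hρ, min_le_right _ _, fun y hy => ?_⟩
    have h3 := @h2 y (by simpa using (hy.trans_le (min_le_right _ _)).le)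
      (by simpa using hy.trans_le (min_le_left _ _))
    rwa [h.f0, Real.dist_eq, sub_zero] at h3
  -- points of the upper half stay away from the origin
  have haway : ∀ δ > 0, ∃ δ' > 0, ∀ y ∈ Y, ‖y‖ ≤ ρ → δ ≤ ‖y‖ → ∀ t, 0 ≤ t → t ≤ t₀ →
      δ' ≤ ‖θ t y‖ := by
    intro δ hδ
    obtain ⟨τ, hτ, h1⟩ := h.unif (half_pos hδ)
    obtain ⟨δ1, hδ1, -, h2⟩ := hfr τ hτ
    refine ⟨min δ1 (δ / 2), by positivity, fun y hy hyρ hyδ t ht ht' => ?_⟩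
    by_contra! hlt
    have hta : |t| ≤ t₀ := by rwa [abs_of_nonneg ht]
    have h3 := h2 _ (hlt.trans_le (min_le_left _ _))
    rw [h.add y hy.1 hyρ t hta] at h3
    have h4 : t < τ := by
      have := (abs_lt.1 h3).2
      have := hy.2
      rw [Set.mem_ofPred_eq] at this
      linarith
    have h5 := h1 t 0 y y hta (by simpa using ht0.le) hyρ hyρ
      (by rwa [sub_zero, abs_of_nonneg ht]) (by simpa using hτ)
    rw [h.zero y (by simpa using hyρ), dist_eq_norm] at h5
    have h6 := norm_sub_norm_le y (θ t y)
    rw [norm_sub_rev] at h6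
    have h7 := hlt.trans_le (min_le_right _ _)
    linarith
  let tk : ℕ → ℕ → ℝ := fun i k => t₀ * ((k : ℝ) / ((i : ℝ) + 1))
  have htk : ∀ i k, k ≤ i + 1 → 0 ≤ tk i k ∧ tk i k ≤ t₀ := fun i k hk => by
    have hi : (0 : ℝ) < (i : ℝ) + 1 := by positivity
    have h1 : (k : ℝ) / ((i : ℝ) + 1) ≤ 1 := by
      rw [div_le_one hi]
      exact_mod_cast hk
    exact ⟨by positivity, mul_le_of_le_one_right ht0.le h1⟩
  let F : ℕ → ℕ → E → E := fun i k y => if y ∈ Y ∧ ‖y‖ ≤ ρ then θ (tk i k) y else y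
  have hFpos : ∀ i k y, y ∈ Y → ‖y‖ ≤ ρ → F i k y = θ (tk i k) y := fun i k y h1 h2 =>
    if_pos ⟨h1, h2⟩
  have hFar : FarHom F fun i => i + 1 := fun δ hδ => by
    obtain ⟨δ', hδ', h1⟩ := haway δ hδ
    refine ⟨min δ δ', by positivity, Eventually.of_forall fun i k hk y hy => ?_⟩
    by_cases hyY : y ∈ Y ∧ ‖y‖ ≤ ρ
    · rw [hFpos i k y hyY.1 hyY.2]
      exact (min_le_right _ _).trans (h1 y hyY.1 hyY.2 hy _ (htk i k hk).1 (htk i k hk).2)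
    · simp only [F, if_neg hyY]
      exact (min_le_left _ _).trans hy
  intro z hz dz
  have heq := dV_homV F (fun i => i + 1) hFar z
  rw [dz, map_zero, add_zero] at heq
  have h0 : mapV (fun i => F i 0) hFar.zero z = z := by
    refine mapV_eq_self _ hρ (Eventually.of_forall fun i y hy hyρ => ?_) hz
    rw [hFpos i 0 y hy hyρ.le]
    simpa [tk] using h.zero y (by simpa using hyρ.le)
  have h1 : mapV (fun i => F i (i + 1)) hFar.last z = 0 := by
    obtain ⟨δ, hδ, -, h2⟩ := hfr t₀ ht0
    refine mapV_eq_zero _ hρ hδ (Eventually.of_forall fun i y hy hyρ => ?_) hz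
    have h3 : tk i (i + 1) = t₀ := by
      have hi : (i : ℝ) + 1 ≠ 0 := by positivity
      simp [tk, div_self hi]
    rw [hFpos i _ y hy hyρ.le, h3]
    by_contra! hlt
    have h4 := h2 _ hlt
    rw [h.add y hy.1 hyρ.le t₀ (by rw [abs_of_pos ht0])] at h4
    have := (abs_lt.1 h4).2
    have := hy.2
    rw [Set.mem_ofPred_eq] at this
    linarith
  rw [h0, h1, add_zero] at heq
  refine ⟨_, ?_, heq⟩
  refine homV_mem hFar hρ (fun ε hε => ?_) hz
  obtain ⟨ε', hε', h2⟩ := h.unif hε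
  have hlim : ∀ᶠ i : ℕ in (UF : Filter ℕ), t₀ / ((i : ℝ) + 1) < ε' := by
    obtain ⟨j, hj⟩ := exists_nat_one_div_lt (div_pos hε' ht0)
    filter_upwards [UF_le (eventually_ge_atTop j)] with i hi
    have h3 := (Nat.one_div_le_one_div (α := ℝ) hi).trans_lt hj
    rw [lt_div_iff₀ ht0] at h3
    rwa [div_eq_mul_one_div, mul_comm]
  refine ⟨ε', hε', hlim.mono fun i hi k hk y hy hyρ => ⟨?_, fun k' hk' h3 h4 y' hy' hyρ' hd => ?_⟩⟩
  · rw [hFpos i k y hy hyρ.le]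
    have hta : |tk i k| ≤ t₀ := by
      rw [abs_of_nonneg (htk i k hk).1]
      exact (htk i k hk).2
    refine ⟨h.mem y hy.1 hyρ.le _ hta, ?_⟩
    rw [Set.mem_ofPred_eq, h.add y hy.1 hyρ.le _ hta]
    exact add_nonneg hy.2 (htk i k hk).1
  · rw [hFpos i k y hy hyρ.le, hFpos i k' y' hy' hyρ'.le]
    refine h2 _ _ _ _ ?_ ?_ hyρ.le hyρ'.le ?_ hd
    · rw [abs_of_nonneg (htk i k hk).1]
      exact (htk i k hk).2
    · rw [abs_of_nonneg (htk i k' hk').1]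
      exact (htk i k' hk').2
    · have h5 : tk i k' - tk i k = (t₀ / ((i : ℝ) + 1)) * ((k' : ℝ) - k) := by
        simp only [tk]
        ring
      have h6 : (0 : ℝ) ≤ (k' : ℝ) - k := by
        have : (k : ℝ) ≤ k' := by exact_mod_cast h3
        linarith
      have h7 : (k' : ℝ) - k ≤ 1 := by
        have : (k' : ℝ) ≤ k + 1 := by exact_mod_cast h4
        linarith
      rw [abs_sub_comm, h5, abs_of_nonneg (by positivity)]
      exact (mul_le_of_le_one_right (by positivity) h7).trans_lt hi

end Germ

end

end InfChain

/-! ## The suspension theorem -/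

namespace InfChain

open Filter Topology

noncomputable section

lemma restr_add_restr {E : Type*} {D D' : Set (List E)} {c : LC E} (hc : c ∈ sp (D ∪ D'))
    (hd : ∀ σ ∈ D, σ ∉ D') : c = restr D c + restr D' c := by
  classical
  ext1 σ
  rw [Finsupp.add_apply, restr_apply, restr_apply]
  by_cases h1 : σ ∈ D
  · rw [if_pos h1, if_neg (hd σ h1), add_zero]
  · by_cases h2 : σ ∈ D'
    · rw [if_neg h1, if_pos h2, zero_add]
    · rw [if_neg h1, if_neg h2, add_zero]
      exact Finsupp.mem_supported' _ _ |>.1 hc σ fun h => h.elim h1 h2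

section Germ

variable {E : Type*} [NormedAddCommGroup E]

lemma van_zero (X : Set E) : Van dV (Ch X) 0 := by
  intro z hz _
  rw [Ch_zero, Submodule.mem_bot] at hz
  exact ⟨0, zero_mem _, by rw [hz, map_zero]⟩

variable [ProperSpace E]
variable {X : Set E} {f : E → ℝ} {θ : ℝ → E → E} {ρ t₀ : ℝ}

lemma Flow.exists_fine (h : Flow X f θ ρ t₀) {ℓ : ℕ} {c : ℕ → LC E}
    (hc : ∀ ε > 0, ∀ᶠ i in (UF : Filter ℕ), c i ∈ sp (Nr X ℓ ε ρ)) :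
    ∃ η : ℕ → ℝ, (∀ i, 0 < η i) ∧ (∀ ε > 0, ∀ᶠ i in (UF : Filter ℕ), η i < ε) ∧
      ∀ᶠ i in (UF : Filter ℕ), c i ∈ sp {σ | ∀ v ∈ σ, v ∈ X ∧ ‖v‖ ≤ ρ ∧
        ∀ u ∈ σ, |f u - f v| < η i} := by
  refine exists_threshold (P := fun ε i => c i ∈ sp {σ | ∀ v ∈ σ, v ∈ X ∧ ‖v‖ ≤ ρ ∧
    ∀ u ∈ σ, |f u - f v| < ε}) fun ε hε => ?_
  obtain ⟨ε', hε', h1⟩ := Metric.uniformContinuousOn_iff.1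
    ((isCompact_closedBall _ _).uniformContinuousOn_of_continuous h.fcont) ε hε
  filter_upwards [hc ε' hε'] with i hi
  refine Finsupp.supported_mono ?_ hi
  intro σ hσ v hv
  refine ⟨(hσ.1.2 v hv).1, (hσ.2 v hv).le, fun u hu => ?_⟩
  have h2 := h1 u (by simpa using (hσ.2 u hu).le) v (by simpa using (hσ.2 v hv).le)
    ((hσ.1.2 v hv).2 u hu)
  rwa [Real.dist_eq] at h2

/-- A set with a flow is, locally at the origin, the suspension of the zero set. -/
theorem Flow.suspends (h : Flow X f θ ρ t₀) :
    Suspends dV (Ch X) (Ch (X ∩ {y | 0 ≤ f y})) (Ch (X ∩ {y | f y ≤ 0}))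
      (Ch (X ∩ {y | f y = 0})) where
  dd := dV_dV
  dC _ _ hs := dV_mem hs
  dp _ _ hs := dV_mem hs
  dm _ _ hs := dV_mem hs
  pC _ := Ch_mono Set.inter_subset_left _
  mC _ := Ch_mono Set.inter_subset_left _
  op _ := Ch_mono (Set.inter_subset_inter_right _ fun _ hy => le_of_eq (Eq.symm hy)) _
  om _ := Ch_mono (Set.inter_subset_inter_right _ fun _ hy => le_of_eq hy) _
  inter _ _ h1 h2 := by
    refine Ch_mono ?_ _ (Ch_inter h1 h2)
    rintro y ⟨⟨h3, h4⟩, -, h5⟩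
    exact ⟨h3, le_antisymm h5 h4⟩
  vp := h.van_half
  vm ℓ := by
    have h1 := h.neg.van_half ℓ
    simpa only [Left.nonneg_neg_iff] using h1
  snap ℓ z hz := by
    classical
    obtain ⟨c, rfl, hc⟩ := exists_near hz h.ρ_pos
    obtain ⟨η, ηpos, ηlim, hη⟩ := h.exists_fine hc
    let r : ℕ → E → E := fun i y =>
      if y ∈ X ∧ ‖y‖ ≤ ρ ∧ |f y| ≤ η i ∧ |f y| ≤ t₀ then θ (- f y) y else y
    have r1 : ∀ i y, (r i y = y ∧ ¬ (y ∈ X ∧ ‖y‖ ≤ ρ ∧ |f y| ≤ η i ∧ |f y| ≤ t₀)) ∨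
        (y ∈ X ∧ ‖y‖ ≤ ρ ∧ |f y| ≤ η i ∧ |f y| ≤ t₀ ∧ r i y = θ (- f y) y ∧ r i y ∈ X ∧
          f (r i y) = 0) := fun i y => by
      by_cases hy : y ∈ X ∧ ‖y‖ ≤ ρ ∧ |f y| ≤ η i ∧ |f y| ≤ t₀
      · right
        have e : r i y = θ (- f y) y := if_pos hy
        obtain ⟨h1, h2, h3, h4⟩ := hy
        refine ⟨h1, h2, h3, h4, e, ?_, ?_⟩
        · rw [e]
          exact h.mem y h1 h2 _ (by rwa [abs_neg])
        · rw [e, h.add y h1 h2 _ (by rwa [abs_neg])]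
          ring
      · exact Or.inl ⟨if_neg hy, hy⟩
    obtain ⟨δ, δpos, δlim, hδ⟩ : ∃ δ : ℕ → ℝ, (∀ i, 0 < δ i) ∧
        (∀ ε > 0, ∀ᶠ i in (UF : Filter ℕ), δ i < ε) ∧
        ∀ᶠ i in (UF : Filter ℕ), ∀ y, dist (r i y) y ≤ δ i := by
      refine exists_threshold (P := fun ε i => ∀ y, dist (r i y) y ≤ ε) fun ε hε => ?_
      obtain ⟨ε', hε', h1⟩ := h.unif hε
      filter_upwards [ηlim ε' hε'] with i hi y
      rcases r1 i y with ⟨e, -⟩ | ⟨-, h2, h3, h4, e, -, -⟩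
      · rw [e, dist_self]
        exact hε.le
      · have h5 := h1 (- f y) 0 y y (by rwa [abs_neg]) (by simpa using h.t_pos.le) h2 h2
          (by rw [sub_zero, abs_neg]; exact h3.trans_lt hi) (by simpa using hε')
        rw [h.zero y (by simpa using h2)] at h5
        rw [e]
        exact h5.le
    obtain ⟨hf, hmem, P, hP, hPmem⟩ := exists_homot_near_id δlim hδ
    have hrX : ∀ i, ∀ y ∈ X, r i y ∈ X := fun i y hy => by
      rcases r1 i y with ⟨e, -⟩ | ⟨-, -, -, -, -, h2, -⟩
      · rwa [e]
      · exact h2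
    refine ⟨mapV r hf, mapV_dV r hf, fun m s hs => ?_, fun m s hs => ?_, fun m s hs => ?_, ?_,
      fun m s hs ds => ?_⟩
    · refine hmem _ _ ?_ m s hs
      intro i y hy
      refine ⟨hrX i y hy.1, ?_⟩
      rcases r1 i y with ⟨e, -⟩ | ⟨-, -, -, -, -, -, h2⟩
      · rw [e]
        exact hy.2
      · exact h2.ge
    · refine hmem _ _ ?_ m s hs
      intro i y hy
      refine ⟨hrX i y hy.1, ?_⟩
      rcases r1 i y with ⟨e, -⟩ | ⟨-, -, -, -, -, -, h2⟩
      · rw [e]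
        exact hy.2
      · exact h2.le
    · refine mapV_eq_self hf h.ρ_pos (Eventually.of_forall fun i y hy hyρ => ?_) hs
      rcases r1 i y with ⟨e, -⟩ | ⟨-, -, -, -, e, -⟩
      · exact e
      · have h2 : f y = 0 := hy.2
        rw [e, h2, neg_zero]
        exact h.zero y (by simpa using hyρ.le)
    · let D : Set (List E) := {σ | ∀ v ∈ σ, 0 ≤ f v}
      let D' : Set (List E) := {σ | (∀ v ∈ σ, f v ≤ 0) ∧ σ ∉ D}
      have hRz := hmem X X hrX _ _ hz
      refine ⟨resV D (mapV r hf (InfChain.mk c)), ?_, resV D' (mapV r hf (InfChain.mk c)), ?_, ?_⟩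
      · refine resV_mem (X := X) ?_ hRz
        intro σ hσ hX v hv
        exact ⟨hX v hv, hσ v hv⟩
      · refine resV_mem (X := X) ?_ hRz
        intro σ hσ hX v hv
        exact ⟨hX v hv, hσ.1 v hv⟩
      · rw [mapV_mk, resV_mk, resV_mk, ← map_add]
        refine mk_congr ?_
        filter_upwards [hη, ηlim t₀ h.t_pos] with i h1 h2
        refine restr_add_restr ?_ fun σ hσ hσ' => hσ'.2 hσ
        refine map_mem_of_sp _ (fun σ hσ => ?_) h1
        rw [lmap_bs]
        refine bs_mem ?_
        have key : ∀ v ∈ σ, f (r i v) = 0 ∨ (f (r i v) = f v ∧ η i < |f v|) := fun v hv => by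
          rcases r1 i v with ⟨e, h3⟩ | ⟨-, -, -, -, -, -, h3⟩
          · refine Or.inr ⟨by rw [e], ?_⟩
            by_contra! h4
            exact h3 ⟨(hσ v hv).1, (hσ v hv).2.1, h4, h4.trans h2.le⟩
          · exact Or.inl h3
        by_cases hD : σ.map (r i) ∈ D
        · exact Or.inl hD
        · refine Or.inr ⟨?_, hD⟩
          have hD' : ∃ v ∈ σ, f (r i v) < 0 := by
            by_contra! h3
            refine hD fun u hu => ?_
            obtain ⟨v, hv, rfl⟩ := List.mem_map.1 hu
            exact h3 v hv
          obtain ⟨v, hv, hneg⟩ := hD'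
          intro u' hu'
          obtain ⟨u, hu, rfl⟩ := List.mem_map.1 hu'
          rcases key v hv with e | ⟨e, h3⟩
          · exact absurd e hneg.ne
          rw [e] at hneg
          rw [abs_of_neg hneg] at h3
          have h4 := (abs_lt.1 ((hσ v hv).2.2 u hu)).2
          rcases key u hu with e | ⟨e, -⟩
          · exact e.le
          · rw [e]
            linarith
    · refine ⟨P s, hPmem X hrX m s hs, ?_⟩
      rw [← hP, ds, map_zero, add_zero]

/-- Suspension raises the local dimension by one. -/
theorem Flow.pure_succ (h : Flow X f θ ρ t₀) {m : ℕ} (hp : Pure dV (Ch (X ∩ {y | f y = 0})) m) :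
    Pure dV (Ch X) (m + 1) := by
  refine ⟨h.suspends.one hp.1, fun ℓ hℓ => ?_⟩
  rcases ℓ with _ | ℓ
  · exact van_zero X
  · exact h.suspends.van (hp.2 ℓ (by omega))

/-- Suspension raises the connectivity by one. -/
theorem Flow.van_succ (h : Flow X f θ ρ t₀) {m : ℕ}
    (hp : ∀ ℓ ≤ m, Van dV (Ch (X ∩ {y | f y = 0})) ℓ) : ∀ ℓ ≤ m + 1, Van dV (Ch X) ℓ := by
  intro ℓ hℓ
  rcases ℓ with _ | ℓ
  · exact van_zero X
  · exact h.suspends.van (hp ℓ (by omega))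

end Germ

end

end InfChain

/-! ## Local homology of Euclidean space -/

namespace InfChain

open Filter Topology

noncomputable section

lemma bd_replicate {E : Type*} (v : E) (j : ℕ) :
    bd (bs (List.replicate (2 * j + 1) v)) = bs (List.replicate (2 * j) v) ∧
      bd (bs (List.replicate (2 * j + 2) v)) = 0 := by
  have hc : ∀ ℓ, bs (List.replicate (ℓ + 1) v) = cone v (bs (List.replicate ℓ v)) := fun ℓ => by
    rw [List.replicate_succ, cone_bs]
  induction j with
  | zero =>
    have h1 : bd (bs (List.replicate 1 v)) = bs (List.replicate 0 v) := by
      rw [hc, bd_cone, bd_bs]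
      simp [bdL]
    refine ⟨h1, ?_⟩
    rw [hc, bd_cone, h1, ← hc, add_self2]
  | succ j ih =>
    have h1 : bd (bs (List.replicate (2 * (j + 1) + 1) v)) =
        bs (List.replicate (2 * (j + 1)) v) := by
      rw [hc, bd_cone, show 2 * (j + 1) = 2 * j + 2 by ring, ih.2, map_zero, add_zero]
    refine ⟨h1, ?_⟩
    rw [hc, bd_cone, h1, ← hc, add_self2]

section Point

variable {E : Type*} [NormedAddCommGroup E]

/-- The degenerate simplex at the origin. -/
def pt (E : Type*) [NormedAddCommGroup E] (ℓ : ℕ) : Ger E := mk fun _ => bs (List.replicate ℓ 0)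

lemma pt_mem (ℓ : ℕ) : pt E ℓ ∈ Ch ({0} : Set E) ℓ := by
  refine mk_mem_Ch fun ε hε => Eventually.of_forall fun _ => bs_mem ?_
  refine ⟨by simp, fun v hv => ?_⟩
  rw [List.eq_of_mem_replicate hv]
  refine ⟨rfl, fun u hu => ?_⟩
  rw [List.eq_of_mem_replicate hu, dist_self]
  exact hε

lemma pt_ne_zero (ℓ : ℕ) : pt E (ℓ + 1) ≠ 0 := by
  intro h
  obtain ⟨δ, hδ, h1⟩ := mk_eq_zero.1 h
  obtain ⟨i, hi⟩ := h1.exists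
  have h2 : List.replicate (ℓ + 1) (0 : E) ∈ Far E δ := by
    by_contra h3
    have h4 := (Finsupp.mem_supported' _ _).1 hi _ h3
    simp [bs] at h4
  have h3 := h2 0 (by simp)
  rw [norm_zero] at h3
  linarith

lemma mem_Ch_singleton {ℓ : ℕ} {z : Ger E} (hz : z ∈ Ch ({0} : Set E) ℓ) : z = 0 ∨ z = pt E ℓ := by
  obtain ⟨c, hc, rfl⟩ := hz
  have h1 : ∀ᶠ i in (UF : Filter ℕ), c i = 0 ∨ c i = bs (List.replicate ℓ 0) := by
    filter_upwards [hc 1 one_pos] with i hi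
    have h2 : ∀ σ, σ ≠ List.replicate ℓ (0 : E) → c i σ = 0 := fun σ hσ => by
      refine (Finsupp.mem_supported' _ _).1 hi _ fun h3 => hσ ?_
      exact List.eq_replicate_iff.2 ⟨h3.1, fun v hv => (h3.2 v hv).1⟩
    have h3 : c i = Finsupp.single (List.replicate ℓ (0 : E)) (c i (List.replicate ℓ 0)) := by
      ext1 σ
      by_cases h4 : σ = List.replicate ℓ 0
      · rw [h4, Finsupp.single_eq_same]
      · rw [h2 σ h4, Finsupp.single_eq_of_ne h4]
    have h5 : ∀ a : ZMod 2, a = 0 ∨ a = 1 := by decide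
    rcases h5 (c i (List.replicate ℓ 0)) with h6 | h6
    · left
      rw [h3, h6, Finsupp.single_zero]
    · right
      rw [h3, h6]
  rcases Ultrafilter.eventually_or.1 h1 with h2 | h2
  · left
    rw [mk_congr (c' := fun _ => 0) h2]
    exact map_zero mk
  · exact Or.inr (mk_congr h2)

lemma dV_pt (j : ℕ) : dV (pt E (2 * j + 1)) = pt E (2 * j) ∧ dV (pt E (2 * j + 2)) = 0 := by
  refine ⟨?_, ?_⟩
  · rw [pt, dV_mk]
    simp only [(bd_replicate (0 : E) j).1]
    rfl
  · rw [pt, dV_mk]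
    simp only [(bd_replicate (0 : E) j).2]
    exact map_zero mk

lemma pure_singleton : Pure dV (Ch ({0} : Set E)) 1 := by
  have h0 : pt E 0 = 0 := by
    have := pt_mem (E := E) 0
    rwa [Ch_zero, Submodule.mem_bot] at this
  have h2 : ∀ w ∈ Ch ({0} : Set E) 2, dV w = 0 := fun w hw => by
    rcases mem_Ch_singleton hw with rfl | rfl
    · exact map_zero _
    · exact (dV_pt 0).2
  refine ⟨⟨pt E 1, pt_mem 1, (dV_pt 0).1.trans h0, ?_, ?_⟩, fun ℓ hℓ z hz dz => ?_⟩
  · rintro ⟨w, hw, e⟩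
    rw [h2 w hw] at e
    exact pt_ne_zero 0 e.symm
  · intro z hz _
    rcases mem_Ch_singleton hz with rfl | rfl
    · exact Or.inl ⟨0, zero_mem _, map_zero _⟩
    · exact Or.inr ⟨0, zero_mem _, by rw [add_self2, map_zero]⟩
  · rcases mem_Ch_singleton hz with rfl | rfl
    · exact ⟨0, zero_mem _, map_zero _⟩
    · obtain ⟨j, rfl | rfl⟩ := Nat.even_or_odd' ℓ
      · exact ⟨_, pt_mem _, (dV_pt j).1⟩
      · rw [(dV_pt j).1] at dz
        obtain ⟨m, rfl⟩ : ∃ m, j = m + 1 := ⟨j - 1, by omega⟩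
        exact absurd dz (pt_ne_zero (2 * m + 1))

end Point

section Euclid

variable {n : ℕ}

/-- The coordinate subspaces. -/
def flag (n j : ℕ) : Set (EuclideanSpace ℝ (Fin n)) := {y | ∀ i : Fin n, j ≤ i → y i = 0}

lemma flag_flow (j : Fin n) : Flow (flag n (j + 1)) (fun y => y j)
    (fun t y => y + EuclideanSpace.single j t) 1 1 where
  ρ_pos := one_pos
  t_pos := one_pos
  cont := by
    have h : Continuous fun t : ℝ => EuclideanSpace.single j t := by
      refine (PiLp.continuous_toLp 2 _).comp (continuous_pi fun i => ?_)
      simp only [Pi.single_apply]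
      split_ifs
      · exact continuous_id
      · exact continuous_const
    fun_prop
  fcont := by fun_prop
  zero y _ := by simp
  f0 := rfl
  mem y hy _ t _ i hi := by
    have hne : i ≠ j := by
      rintro rfl
      omega
    simp [hy i hi, hne]
  add y _ _ t _ := by simp

lemma pure_flag : ∀ j ≤ n, Pure dV (Ch (flag n j)) (j + 1) := by
  intro j
  induction j with
  | zero =>
    intro _
    have : flag n 0 = {0} := by
      ext y
      refine ⟨fun h => ?_, fun h i _ => by rw [Set.mem_singleton_iff.1 h]; rfl⟩
      ext i
      exact h i (Nat.zero_le _)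
    rw [this]
    exact pure_singleton
  | succ j ih =>
    intro hj
    refine (flag_flow ⟨j, hj⟩).pure_succ ?_
    convert ih (by omega) using 2
    ext y
    constructor
    · rintro ⟨h1, h2⟩ i hi
      rcases hi.eq_or_lt with h3 | h3
      · have : i = ⟨j, hj⟩ := Fin.ext h3.symm
        rw [this]
        exact h2
      · exact h1 i h3
    · exact fun h => ⟨fun i hi => h i (by change j + 1 ≤ (i : ℕ) at hi; omega), h _ le_rfl⟩

lemma pure_univ : Pure dV (Ch (Set.univ : Set (EuclideanSpace ℝ (Fin n)))) (n + 1) := by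
  have h := pure_flag (n := n) n le_rfl
  have : flag n n = Set.univ := Set.eq_univ_of_forall fun y i hi => absurd i.2 (by omega)
  rwa [this] at h

end Euclid

end

end InfChain

/-! ## Newman's theorem for involutions -/

namespace InfChain

open Filter Topology

noncomputable section

section Avoid

variable {E : Type*} [NormedAddCommGroup E] [NormedSpace ℝ E]

/-- A cycle at the origin that avoids a ball around a nearby point is a boundary. -/
lemma exists_bd_of_avoid {ℓ : ℕ} {c : ℕ → LC E} {δ β : ℝ} {q : E}
    (hc : ∀ ε > 0, ∀ᶠ i in (UF : Filter ℕ), c i ∈ sp (Sm Set.univ ℓ ε))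
    (hδ : 0 < δ) (hd : ∀ᶠ i in (UF : Filter ℕ), bd (c i) ∈ sp (Far E δ)) (hq : ‖q‖ < δ / 2)
    (hβ : 0 < β) (ha : ∀ᶠ i in (UF : Filter ℕ), c i ∈ sp {σ | ∀ v ∈ σ, β ≤ ‖v - q‖}) :
    ∃ w ∈ Ch (Set.univ : Set E) (ℓ + 1), dV w = mk c := by
  let F : ℕ → ℕ → E → E := fun i k y => y - ((k : ℝ) / ((i : ℝ) + 1)) • q
  have hpos : ∀ i : ℕ, (0 : ℝ) < (i : ℝ) + 1 := fun i => by positivity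
  have hF0 : ∀ i, F i 0 = id := fun i => by
    funext y
    simp [F]
  have hF1 : ∀ i, F i (i + 1) = fun y => y - q := fun i => by
    funext y
    simp only [F]
    rw [Nat.cast_succ, div_self (hpos i).ne', one_smul]
  refine ⟨mk fun i => homot (F i) (i + 1) (c i), mk_mem_Ch fun ε hε => ?_, ?_⟩
  · have hlim : ∀ᶠ i : ℕ in (UF : Filter ℕ), ‖q‖ / ((i : ℝ) + 1) < ε / 2 := by
      obtain ⟨j, hj⟩ := exists_nat_one_div_lt (show 0 < ε / 2 / (‖q‖ + 1) by positivity)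
      filter_upwards [UF_le (eventually_ge_atTop j)] with i hi
      have h1 := (Nat.one_div_le_one_div (α := ℝ) hi).trans_lt hj
      rw [lt_div_iff₀ (by positivity)] at h1
      have h2 : ‖q‖ / ((i : ℝ) + 1) ≤ 1 / ((i : ℝ) + 1) * (‖q‖ + 1) := by
        rw [div_mul_eq_mul_div, one_mul]
        gcongr
        linarith
      linarith
    filter_upwards [hc (ε / 2) (by positivity), hlim] with i h1 h2
    refine map_mem_of_sp _ (fun σ hσ => ?_) h1
    refine Finsupp.supported_mono ?_ (homot_mem _ _ _)
    rintro τ ⟨h3, k, -, h4⟩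
    have key : ∀ u ∈ τ, ∃ v ∈ σ, ∃ e : ℝ, 0 ≤ e ∧ e ≤ 1 ∧
        u = v - (((k : ℝ) + e) / ((i : ℝ) + 1)) • q := fun u hu => by
      obtain ⟨v, hv, h5 | h5⟩ := h4 u hu
      · exact ⟨v, hv, 0, le_rfl, zero_le_one, by rw [h5, add_zero]⟩
      · exact ⟨v, hv, 1, zero_le_one, le_rfl, by rw [h5]; simp [F]⟩
    refine ⟨by rw [h3, hσ.1], fun v hv => ⟨trivial, fun u hu => ?_⟩⟩
    obtain ⟨v', hv', e, he0, he1, rfl⟩ := key v hv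
    obtain ⟨u', hu', e', he0', he1', rfl⟩ := key u hu
    have h5 := (hσ.2 v' hv').2 u' hu'
    have h6 : u' - (((k : ℝ) + e') / ((i : ℝ) + 1)) • q - (v' - (((k : ℝ) + e) / ((i : ℝ) + 1)) • q)
        = (u' - v') + ((e - e') / ((i : ℝ) + 1)) • q := by
      have : (e - e') / ((i : ℝ) + 1) = ((k : ℝ) + e) / ((i : ℝ) + 1) -
        ((k : ℝ) + e') / ((i : ℝ) + 1) := by ring
      rw [this, sub_smul]
      abel
    rw [dist_eq_norm] at h5 ⊢
    rw [h6]
    have h7 : ‖((e - e') / ((i : ℝ) + 1)) • q‖ ≤ ‖q‖ / ((i : ℝ) + 1) := by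
      rw [norm_smul, Real.norm_eq_abs, abs_div, abs_of_pos (hpos i), div_mul_eq_mul_div]
      gcongr
      refine mul_le_of_le_one_left (norm_nonneg _) (abs_le.2 ⟨by linarith, by linarith⟩)
    linarith [norm_add_le (u' - v') (((e - e') / ((i : ℝ) + 1)) • q)]
  · rw [dV_mk, mk_eq]
    refine ⟨min (δ / 2) β, by positivity, ?_⟩
    filter_upwards [hd, ha] with i h1 h2
    have h3 := bd_homot (F i) (i + 1) (c i)
    rw [hF0, lmap_id] at h3
    have h4 : bd (homot (F i) (i + 1) (c i)) + c i =
        homot (F i) (i + 1) (bd (c i)) + lmap (F i (i + 1)) (c i) := by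
      rw [← add_eq_zero2] at h3 ⊢
      rw [← h3]
      abel
    rw [h4]
    refine add_mem (map_mem_of_sp _ (fun σ hσ => ?_) h1) (map_mem_of_sp _ (fun σ hσ => ?_) h2)
    · refine Finsupp.supported_mono ?_ (homot_mem _ _ _)
      rintro τ ⟨-, k, hk, h5⟩ u hu
      have key : ∀ v ∈ σ, ∀ j ≤ i + 1, δ / 2 ≤ ‖F i j v‖ := fun v hv j hj => by
        have h6 := hσ v hv
        have h7 : ‖((j : ℝ) / ((i : ℝ) + 1)) • q‖ ≤ ‖q‖ := by
          rw [norm_smul]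
          refine mul_le_of_le_one_left (norm_nonneg _) ?_
          rw [Real.norm_eq_abs, abs_of_nonneg (by positivity), div_le_one (hpos i)]
          exact_mod_cast hj
        have h8 := norm_sub_norm_le v (((j : ℝ) / ((i : ℝ) + 1)) • q)
        change δ / 2 ≤ ‖v - ((j : ℝ) / ((i : ℝ) + 1)) • q‖
        linarith
      obtain ⟨v, hv, rfl | rfl⟩ := h5 u hu
      · exact (min_le_left _ _).trans (key v hv _ hk.le)
      · exact (min_le_left _ _).trans (key v hv _ hk)
    · rw [lmap_bs, hF1]
      refine bs_mem fun u hu => ?_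
      obtain ⟨v, hv, rfl⟩ := List.mem_map.1 hu
      exact (min_le_right _ _).trans (hσ v hv)

end Avoid

variable {n : ℕ} {g : EuclideanSpace ℝ (Fin n) → EuclideanSpace ℝ (Fin n)}

lemma LC0.univ : LC0 (Set.univ : Set (EuclideanSpace ℝ (Fin n))) :=
  ⟨1, one_pos, by rw [Set.univ_inter]; exact isCompact_closedBall _ _⟩

lemma smith_univ (hg : Inv g) : Smith dV (LinearMap.id + hg.V) (Ch Set.univ) (Ch {y | g y = y}) := by
  have h := smith_inv hg (X := Set.univ) (fun _ _ => trivial) LC0.univ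
  rwa [Set.univ_inter] at h

/-- The fixed set of an involution that is nontrivial near the origin has smaller dimension. -/
theorem exists_pure_fix (hg : Inv g) (hn : ∃ᶠ y in 𝓝 0, g y ≠ y) :
    ∃ r ≤ n, Pure dV (Ch {y | g y = y}) r := by
  have hS := smith_univ hg
  obtain ⟨r, -, h2, h3, -⟩ := hS.main pure_univ
  refine ⟨r, ?_, h3⟩
  by_contra hr
  obtain rfl : r = n + 1 := by omega
  obtain ⟨z, hz, dz, hnb, -⟩ := h3.1
  obtain ⟨c, hc, rfl⟩ := hz
  rw [dV_mk, mk_eq_zero] at dz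
  obtain ⟨δ, hδ, hd⟩ := dz
  have hev : ∀ᶠ y in 𝓝 (0 : EuclideanSpace ℝ (Fin n)), ContinuousAt g y ∧ ‖y‖ < δ / 2 := by
    refine hg.cont.and ?_
    have := Metric.ball_mem_nhds (0 : EuclideanSpace ℝ (Fin n)) (half_pos hδ)
    filter_upwards [this] with y hy
    simpa using hy
  obtain ⟨q, hq, hqc, hqδ⟩ := (hn.and_eventually hev).exists
  obtain ⟨β, hβ, hball⟩ := Metric.eventually_nhds_iff.1
    ((hqc.sub continuousAt_id).eventually_ne (sub_ne_zero.2 hq))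
  obtain ⟨w, hw, e⟩ := exists_bd_of_avoid (c := c) (q := q) (β := β) (fun ε hε => by
    filter_upwards [hc ε hε] with i hi
    exact Finsupp.supported_mono (Sm_mono (Set.subset_univ _) le_rfl) hi) hδ hd hqδ hβ (by
    filter_upwards [hc 1 one_pos] with i hi
    refine Finsupp.supported_mono ?_ hi
    intro σ hσ v hv
    by_contra! h4
    refine hball (y := v) (by rwa [dist_eq_norm]) ?_
    have h5 : g v = v := (hσ.2 v hv).1
    simp [h5])
  exact hnb (hS.inj (t := 0) (hS.van_im (m := n + 1) (fun ℓ hl => pure_univ.2 ℓ (by omega))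
    (Nat.lt_succ_self _)) (zero_mem _) ⟨c, hc, rfl⟩ hw (by rw [map_zero, zero_add, e])).2

/-- The fixed set of an involution that is nontrivial near the origin has no interior points near
the origin. -/
theorem eventually_notMem_interior (hg : Inv g) (hn : ∃ᶠ y in 𝓝 0, g y ≠ y) :
    ∀ᶠ q in 𝓝 0, q ∉ interior {y | g y = y} := by
  have hS := smith_univ hg
  obtain ⟨r, -, -, h3, -, -, hgen⟩ := hS.main pure_univ
  obtain ⟨r', hr', h3'⟩ := exists_pure_fix hg hn
  obtain rfl := h3.unique h3'
  obtain ⟨z, hz, dz, hnb, -⟩ := (pure_univ (n := n)).1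
  obtain ⟨t, ht, w, hw, e⟩ := hgen (by omega) z hz dz
  obtain ⟨R, hR, hRc⟩ := exists_closedBall hg.cont
  have hu : UniformContinuousOn g (Metric.closedBall 0 R) :=
    (isCompact_closedBall _ _).uniformContinuousOn_of_continuous
      fun y hy => (hRc R le_rfl y hy).continuousWithinAt
  obtain ⟨c, rfl, hc⟩ := exists_near ht hR
  have e1 : (LinearMap.id + hg.V : Ger _ →ₗ[ZMod 2] Ger _) (mk c) = mk (fun i => c i + lmap g (c i)) := rfl
  have hd : dV (mk (fun i => c i + lmap g (c i))) = 0 := by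
    rw [← e1]
    have h4 := dV_dV w
    rw [e, map_add, dz, zero_add] at h4
    exact h4
  rw [dV_mk, mk_eq_zero] at hd
  obtain ⟨δ, hδ, hd⟩ := hd
  by_contra hfr
  rw [Filter.not_eventually] at hfr
  have hev : ∀ᶠ y in 𝓝 (0 : EuclideanSpace ℝ (Fin n)), ‖y‖ < δ / 2 := by
    filter_upwards [Metric.ball_mem_nhds (0 : EuclideanSpace ℝ (Fin n)) (half_pos hδ)] with y hy
    simpa using hy
  obtain ⟨q, hq, hqδ⟩ := (hfr.and_eventually hev).exists
  rw [not_not, mem_interior_iff_mem_nhds, Metric.mem_nhds_iff] at hq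
  obtain ⟨β, hβ, hball⟩ := hq
  obtain ⟨u, hu', eu⟩ := exists_bd_of_avoid (ℓ := n + 1) (c := fun i => c i + lmap g (c i)) (q := q)
    (β := β / 2) (fun ε hε => by
      obtain ⟨ε', hε', h5⟩ := Metric.uniformContinuousOn_iff.1 hu ε hε
      filter_upwards [hc (min ε ε') (by positivity)] with i hi
      refine map_mem_of_sp (LinearMap.id + lmap g : LC _ →ₗ[ZMod 2] LC _) (fun σ hσ => ?_) hi
      refine add_mem (bs_mem (Sm_mono subset_rfl (min_le_left _ _) hσ.1)) ?_
      rw [lmap_bs]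
      refine bs_mem ⟨by rw [List.length_map, hσ.1.1], fun v hv => ⟨trivial, fun v' hv' => ?_⟩⟩
      obtain ⟨u, hu, rfl⟩ := List.mem_map.1 hv
      obtain ⟨u', hu', rfl⟩ := List.mem_map.1 hv'
      exact h5 _ (by simpa using (hσ.2 u' hu').le) _ (by simpa using (hσ.2 u hu).le)
        (((hσ.1.2 u hu).2 u' hu').trans_le (min_le_right _ _))) hδ hd hqδ (half_pos hβ) (by
      filter_upwards [hc (β / 2) (by positivity)] with i hi
      refine map_mem_of_sp (LinearMap.id + lmap g : LC _ →ₗ[ZMod 2] LC _) (fun σ hσ => ?_) hi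
      by_cases hfar : ∀ v ∈ σ, β / 2 ≤ ‖v - q‖ ∧ β / 2 ≤ ‖g v - q‖
      · refine add_mem (bs_mem fun v hv => (hfar v hv).1) ?_
        rw [lmap_bs]
        refine bs_mem fun v hv => ?_
        obtain ⟨u, hu, rfl⟩ := List.mem_map.1 hv
        exact (hfar u hu).2
      · have hnear : ∃ v ∈ σ, ‖v - q‖ < β / 2 := by
          by_contra! h6
          refine hfar fun v hv => ⟨h6 v hv, ?_⟩
          by_contra! h7
          have h8 : g (g v) = g v := hball (by
            rw [Metric.mem_ball, dist_eq_norm]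
            linarith)
          rw [hg.invol] at h8
          rw [← h8] at h7
          exact absurd (h6 v hv) (not_le.2 h7)
        obtain ⟨v, hv, hvq⟩ := hnear
        have h6 : σ.map g = σ := by
          rw [List.map_congr_left (g := id) fun u hu => ?_, List.map_id]
          refine hball ?_
          have h7 := (hσ.1.2 v hv).2 u hu
          have h8 := dist_triangle u v q
          rw [dist_eq_norm v q] at h8
          rw [Metric.mem_ball]
          linarith
        have h7 : (LinearMap.id + lmap g : LC _ →ₗ[ZMod 2] LC _) (bs σ) = 0 := by
          rw [LinearMap.add_apply, lmap_bs, h6, LinearMap.id_apply, add_self2]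
        rw [h7]
        exact zero_mem _)
  refine hnb ⟨w + u, add_mem hw hu', ?_⟩
  rw [map_add, e, e1, eu, add_assoc, add_self2, add_zero]

end

end InfChain

/-! ## Newman's theorem on connected open sets -/

namespace InfChain

open Filter Topology

variable {n : ℕ} {g : EuclideanSpace ℝ (Fin n) → EuclideanSpace ℝ (Fin n)}

/-- An involution of a connected open set that is trivial somewhere is trivial everywhere. -/
theorem eq_self_of_interior {U : Set (EuclideanSpace ℝ (Fin n))} (hU : IsOpen U)
    (hUc : IsPreconnected U) (hg : ContinuousOn g U) (hm : ∀ y ∈ U, g y ∈ U)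
    (hi : ∀ y ∈ U, g (g y) = y) (hne : (U ∩ interior {y | g y = y}).Nonempty) :
    ∀ y ∈ U, g y = y := by
  classical
  have hcl : closure (interior {y | g y = y}) ∩ U ⊆ interior {y | g y = y} := by
    rintro y ⟨hyc, hyU⟩
    have hUy : U ∈ 𝓝 y := hU.mem_nhds hyU
    have hcy : ∀ y ∈ U, ContinuousAt g y := fun y hy => hg.continuousAt (hU.mem_nhds hy)
    have hfr : ∃ᶠ y' in 𝓝 y, y' ∈ interior {y | g y = y} := mem_closure_iff_frequently.1 hyc
    have hgy : g y = y := by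
      by_contra h
      have h1 := ((hcy y hyU).sub continuousAt_id).eventually_ne (sub_ne_zero.2 h)
      obtain ⟨y', h2, h3⟩ := (hfr.and_eventually h1).exists
      have h4 : y' ∈ {y | g y = y} := interior_subset h2
      exact h3 (sub_eq_zero.2 h4)
    let h : EuclideanSpace ℝ (Fin n) → EuclideanSpace ℝ (Fin n) := fun z =>
      if z + y ∈ U then g (z + y) - y else z
    have hpos : ∀ z, z + y ∈ U → h z = g (z + y) - y := fun z hz => if_pos hz
    have htend : Tendsto (fun z => z + y) (𝓝 0) (𝓝 y) := by
      have := (continuous_add_const y).tendsto (0 : EuclideanSpace ℝ (Fin n))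
      rwa [zero_add] at this
    have htend' : Tendsto (fun y' => y' - y) (𝓝 y) (𝓝 0) := by
      have := (continuous_sub_right y).tendsto y
      rwa [sub_self] at this
    have hinv : Inv h := by
      refine ⟨fun z => ?_, ?_, ?_⟩
      · by_cases hz : z + y ∈ U
        · have h1 : g (z + y) - y + y ∈ U := by
            rw [sub_add_cancel]
            exact hm _ hz
          rw [hpos z hz, hpos _ h1, sub_add_cancel, hi _ hz, add_sub_cancel_right]
        · have : h z = z := if_neg hz
          rw [this, this]
      · rw [hpos 0 (by rwa [zero_add]), zero_add, hgy, sub_self]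
      · filter_upwards [(htend hUy : ∀ᶠ z in 𝓝 0, z + y ∈ U)] with z hz
        have h1 : ContinuousAt (fun z => g (z + y) - y) z :=
          (ContinuousAt.comp (f := fun z => z + y) (hcy _ hz)
            (continuous_add_const y).continuousAt).sub continuousAt_const
        refine h1.congr ?_
        have h2 := (continuous_add_const y).continuousAt (hU.mem_nhds hz)
        filter_upwards [h2] with z' hz'
        exact (hpos z' hz').symm
    by_contra hyi
    have hn : ∃ᶠ z in 𝓝 0, h z ≠ z := by
      by_contra h1
      rw [Filter.not_frequently] at h1
      refine hyi (mem_interior_iff_mem_nhds.2 ?_)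
      filter_upwards [htend'.eventually h1, hUy] with y' h2 h3
      rw [not_not, hpos _ (by rwa [sub_add_cancel]), sub_add_cancel] at h2
      exact sub_left_injective h2
    have h1 := eventually_notMem_interior hinv hn
    obtain ⟨y', h2, h3, h4⟩ := (hfr.and_eventually ((htend'.eventually h1).and hUy)).exists
    refine h3 (mem_interior_iff_mem_nhds.2 ?_)
    have htend2 : Tendsto (fun z => z + y) (𝓝 (y' - y)) (𝓝 y') := by
      have := (continuous_add_const y).tendsto (y' - y)
      rwa [sub_add_cancel] at this
    filter_upwards [htend2 (mem_interior_iff_mem_nhds.1 h2), htend2 (hU.mem_nhds h4)] with z h5 h6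
    have h7 : g (z + y) = z + y := h5
    change h z = z
    rw [hpos z h6, h7, add_sub_cancel_right]
  intro y hy
  have h1 : y ∈ {y | g y = y} := interior_subset
    (hUc.subset_of_closure_inter_subset isOpen_interior hne hcl hy)
  exact h1

end InfChain

/-! ## Actions of elementary abelian 2-groups that are homotopically trivial -/

namespace InfChain

open Filter Topology

noncomputable section

variable {n : ℕ} {A : Type*}

/-- The common fixed set. -/
def fixS (g : A → EuclideanSpace ℝ (Fin n) → EuclideanSpace ℝ (Fin n)) (S : Set A) :
    Set (EuclideanSpace ℝ (Fin n)) := {y | ∀ a ∈ S, g a y = y}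

lemma fixS_insert {g : A → EuclideanSpace ℝ (Fin n) → EuclideanSpace ℝ (Fin n)} (a : A) (S : Set A) :
    fixS g (insert a S) = fixS g S ∩ {y | g a y = y} := by
  ext y
  change (∀ b ∈ insert a S, g b y = y) ↔ (∀ b ∈ S, g b y = y) ∧ g a y = y
  rw [Set.forall_mem_insert, and_comm]

variable [AddCommGroup A]

/-- An effective local action of an elementary abelian 2-group by maps which are equivariantly
homotopic to the identity. -/
structure Act (g : A → EuclideanSpace ℝ (Fin n) → EuclideanSpace ℝ (Fin n))
    (H : A → ℝ → EuclideanSpace ℝ (Fin n) → EuclideanSpace ℝ (Fin n)) : Prop where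
  inv : ∀ a, Inv (g a)
  add : ∀ a b y, g (a + b) y = g a (g b y)
  ne : ∀ a ≠ 0, ∃ᶠ y in 𝓝 0, g a y ≠ y
  zero : ∀ a y, H a 0 y = y
  one : ∀ a y, H a 1 y = g a y
  comm : ∀ a b s y, H a s (g b y) = g b (H a s y)
  cont : ∀ a, ∃ R > 0, ContinuousOn (fun p : ℝ × EuclideanSpace ℝ (Fin n) => H a p.1 p.2)
    (Set.Icc 0 1 ×ˢ Metric.closedBall 0 R)
  far : ∀ a, ∀ δ > 0, ∃ δ' > 0, ∀ s ∈ Set.Icc (0 : ℝ) 1, ∀ y, δ ≤ ‖y‖ → δ' ≤ ‖H a s y‖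

variable {g : A → EuclideanSpace ℝ (Fin n) → EuclideanSpace ℝ (Fin n)}
  {H : A → ℝ → EuclideanSpace ℝ (Fin n) → EuclideanSpace ℝ (Fin n)}

namespace Act

lemma g_zero (h : Act g H) (y : EuclideanSpace ℝ (Fin n)) : g 0 y = y := by
  have := h.add 0 0 y
  rw [add_zero, (h.inv 0).invol] at this
  exact this

lemma g_comm (h : Act g H) (a b : A) (y : EuclideanSpace ℝ (Fin n)) :
    g a (g b y) = g b (g a y) := by rw [← h.add, add_comm, h.add]

lemma fixS_inv (h : Act g H) (S : Set A) (a : A) :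
    ∀ y ∈ fixS g S, g a y ∈ fixS g S := fun y hy b hb => by
  rw [h.g_comm, hy b hb]

lemma fixS_hom (h : Act g H) (S : Set A) (a : A) (s : ℝ) :
    ∀ y ∈ fixS g S, H a s y ∈ fixS g S := fun y hy b hb => by
  rw [← h.comm, hy b hb]

lemma lc0_fixS (h : Act g H) {S : Set A} (hS : S.Finite) : LC0 (fixS g S) := by
  induction S, hS using Set.Finite.induction_on with
  | empty =>
    have : fixS g (∅ : Set A) = Set.univ := Set.eq_univ_of_forall fun y a ha => ha.elim
    rw [this]
    exact LC0.univ
  | insert _ _ ih =>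
    rw [fixS_insert]
    exact ih.fix (h.inv _)

/-- Enlarging the group does not increase the dimension of the fixed set. -/
lemma exists_pure (h : Act g H) {S T : Set A} (hS : S.Finite) (hT : T.Finite) {m : ℕ}
    (hm : Pure dV (Ch (fixS g S)) m) : ∃ r ≤ m, Pure dV (Ch (fixS g (S ∪ T))) r := by
  induction T, hT using Set.Finite.induction_on with
  | empty => exact ⟨m, le_rfl, by rwa [Set.union_empty]⟩
  | @insert a T _ hT ih =>
    obtain ⟨r, hr, h1⟩ := ih
    obtain ⟨r', -, h2, h3, -⟩ := (smith_inv (h.inv a) (h.fixS_inv (S ∪ T) a)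
      (h.lc0_fixS (hS.union hT))).main h1
    refine ⟨r', h2.trans hr, ?_⟩
    rwa [Set.union_insert, fixS_insert]

/-- The homotopy from the identity to one of the involutions on germs of chains. -/
lemma exists_homotopy (h : Act g H) (a : A) :
    ∃ P : Ger (EuclideanSpace ℝ (Fin n)) →ₗ[ZMod 2] Ger (EuclideanSpace ℝ (Fin n)),
      (∀ v, dV (P v) + P (dV v) = (LinearMap.id + (h.inv a).V : Ger _ →ₗ[ZMod 2] Ger _) v) ∧
      ∀ S ℓ, ∀ s ∈ Ch (fixS g S) ℓ, P s ∈ Ch (fixS g S) (ℓ + 1) := by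
  have hI : ∀ {i k : ℕ}, k ≤ i + 1 → (k : ℝ) / (i + 1) ∈ Set.Icc (0 : ℝ) 1 := fun {i k} hk => by
    have h0 : (0 : ℝ) < i + 1 := by positivity
    refine ⟨by positivity, (div_le_one h0).2 ?_⟩
    exact_mod_cast hk
  have hF : FarHom (fun i k => H a ((k : ℝ) / (i + 1))) (fun i => i + 1) := fun δ hδ => by
    obtain ⟨δ', hδ', h1⟩ := h.far a δ hδ
    exact ⟨δ', hδ', Eventually.of_forall fun i k hk y hy => h1 _ (hI hk) y hy⟩
  refine ⟨homV _ _ hF, fun v => ?_, fun S ℓ s hs => ?_⟩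
  · rw [dV_homV, LinearMap.add_apply, LinearMap.id_apply]
    congr 1
    · obtain ⟨c, rfl⟩ := mk_surj v
      rw [mapV_mk]
      refine mk_congr (Eventually.of_forall fun i => ?_)
      have : H a (((0 : ℕ) : ℝ) / (i + 1)) = id := by
        funext y
        rw [Nat.cast_zero, zero_div, h.zero, id]
      rw [this, lmap_id]
    · obtain ⟨c, rfl⟩ := mk_surj v
      rw [mapV_mk, Inv.V_mk]
      refine mk_congr (Eventually.of_forall fun i => ?_)
      have : H a (((i + 1 : ℕ) : ℝ) / (i + 1)) = g a := by
        funext y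
        rw [Nat.cast_add, Nat.cast_one, div_self (by positivity), h.one]
      rw [this]
  · obtain ⟨R, hR, hc⟩ := h.cont a
    have huc := ((isCompact_Icc (a := (0 : ℝ)) (b := 1)).prod
      (isCompact_closedBall (0 : EuclideanSpace ℝ (Fin n)) R)).uniformContinuousOn_of_continuous hc
    rw [Metric.uniformContinuousOn_iff] at huc
    refine homV_mem hF hR (fun ε hε => ?_) hs
    obtain ⟨η, hη, h1⟩ := huc ε hε
    obtain ⟨i₀, hi₀⟩ := exists_nat_one_div_lt hη
    refine ⟨η, hη, ?_⟩
    filter_upwards [UF_le (eventually_ge_atTop i₀)] with i hi k hk y hy hyR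
    refine ⟨h.fixS_hom S a _ y hy, fun k' hk' hkk hkk' y' hy' hyR' hd => ?_⟩
    refine h1 ((k : ℝ) / (i + 1), y) ⟨hI hk, by simpa using hyR.le⟩ ((k' : ℝ) / (i + 1), y')
      ⟨hI hk', by simpa using hyR'.le⟩ ?_
    rw [Prod.dist_eq]
    refine max_lt ?_ hd
    have h0 : (0 : ℝ) < i + 1 := by positivity
    have h3 : (k : ℝ) ≤ k' := by exact_mod_cast hkk
    have h4 : (k' : ℝ) ≤ k + 1 := by exact_mod_cast hkk'
    have h5 : (1 : ℝ) / (i + 1) ≤ 1 / (i₀ + 1) := by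
      apply one_div_le_one_div_of_le (by positivity)
      have : (i₀ : ℝ) ≤ i := by exact_mod_cast hi
      linarith
    refine lt_of_le_of_lt ?_ (h5.trans_lt hi₀)
    rw [Real.dist_eq, ← sub_div, abs_div, abs_of_pos h0]
    refine div_le_div_of_nonneg_right ?_ h0.le
    rw [abs_le]
    constructor <;> linarith

variable [Module (ZMod 2) A]

lemma fixS_bot (h : Act g H) : fixS g ((⊥ : Submodule (ZMod 2) A) : Set A) = Set.univ :=
  Set.eq_univ_of_forall fun y a ha => by
    rw [(Submodule.mem_bot _).1 ha, h.g_zero]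

lemma fixS_sup (h : Act g H) (K : Submodule (ZMod 2) A) (a : A) :
    fixS g ((K ⊔ Submodule.span (ZMod 2) {a} : Submodule (ZMod 2) A) : Set A) =
      fixS g K ∩ {y | g a y = y} := by
  ext y
  constructor
  · intro hy
    exact ⟨fun b hb => hy b (Submodule.mem_sup_left hb),
      hy a (Submodule.mem_sup_right (Submodule.mem_span_singleton_self a))⟩
  · rintro ⟨h1, h2⟩ b hb
    have h2 : g a y = y := h2
    obtain ⟨u, hu, v, hv, rfl⟩ := Submodule.mem_sup.1 hb
    obtain ⟨c, rfl⟩ := Submodule.mem_span_singleton.1 hv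
    rw [h.add]
    have h3 : g (c • a) y = y := by
      fin_cases c
      · change g ((0 : ZMod 2) • a) y = y
        rw [zero_smul, h.g_zero]
      · change g ((1 : ZMod 2) • a) y = y
        rw [one_smul, h2]
    rw [h3, h1 u hu]

/-- Each factor of the group drops the dimension of the fixed set by at least two. -/
theorem pure_add_le [Finite A] (h : Act g H) (K : Submodule (ZMod 2) A) :
    ∀ m, Pure dV (Ch (fixS g K)) m → m + 2 * Module.finrank (ZMod 2) K ≤ n + 1 := by
  induction hd : Module.finrank (ZMod 2) K using Nat.strong_induction_on generalizing K with
  | _ d ih =>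
  subst hd
  intro m hm
  rcases eq_or_ne K ⊥ with rfl | hK
  · rw [h.fixS_bot] at hm
    rw [hm.unique pure_univ, finrank_bot]
  have hfin : ∀ S : Set A, S.Finite := fun S => S.toFinite
  have hmono : ∀ {K₁ K₂ : Submodule (ZMod 2) A}, K₁ ≤ K₂ → ∀ {m₁}, Pure dV (Ch (fixS g K₁)) m₁ →
      ∃ r ≤ m₁, Pure dV (Ch (fixS g K₂)) r := fun {K₁ K₂} hle {m₁} h1 => by
    obtain ⟨r, hr, h2⟩ := h.exists_pure (hfin K₁) (hfin K₂) h1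
    rw [Set.union_eq_self_of_subset_left hle] at h2
    exact ⟨r, hr, h2⟩
  have hbot : Pure dV (Ch (fixS g (⊥ : Submodule (ZMod 2) A))) (n + 1) := by
    rw [h.fixS_bot]
    exact pure_univ
  obtain ⟨a, haK, ha⟩ := Submodule.exists_mem_ne_zero_of_ne_bot hK
  have hmn : m < n + 1 := by
    obtain ⟨r, hr, h1⟩ := exists_pure_fix (h.inv a) (h.ne a ha)
    have h2 : fixS g ((⊥ ⊔ Submodule.span (ZMod 2) {a} : Submodule (ZMod 2) A) : Set A) =
      {y | g a y = y} := by rw [h.fixS_sup, h.fixS_bot, Set.univ_inter]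
    rw [← h2] at h1
    obtain ⟨r', hr', h3⟩ := hmono (sup_le bot_le ((Submodule.span_singleton_le_iff_mem _ _).2 haK)) h1
    rw [hm.unique h3]
    omega
  obtain ⟨L, ⟨hLK, q, hq, hmq⟩, hmax⟩ := (Set.toFinite {L : Submodule (ZMod 2) A |
    L ≤ K ∧ ∃ q, Pure dV (Ch (fixS g L)) q ∧ m < q}).exists_maximal ⟨⊥, bot_le, n + 1, hbot, hmn⟩
  have hLne : L < K := by
    refine lt_of_le_of_ne hLK ?_
    rintro rfl
    exact hmq.ne (hm.unique hq)
  have hbig : ∀ b ∈ K, b ∉ L → Pure dV (Ch (fixS g L ∩ {y | g b y = y})) m := by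
    intro b hb hbL
    obtain ⟨r, hr, h1⟩ := hmono (le_sup_left (b := Submodule.span (ZMod 2) {b})) hq
    have hle : L ⊔ Submodule.span (ZMod 2) {b} ≤ K :=
      sup_le hLK ((Submodule.span_singleton_le_iff_mem _ _).2 hb)
    obtain ⟨r', hr', h2⟩ := hmono hle h1
    obtain rfl := hm.unique h2
    rw [← h.fixS_sup]
    rcases hr'.eq_or_lt with rfl | hlt
    · exact h1
    · exact absurd (hmax ⟨hle, r, h1, hlt⟩ le_sup_left (Submodule.mem_sup_right
        (Submodule.mem_span_singleton_self b))) hbL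
  obtain ⟨a, haK, haL⟩ := SetLike.exists_of_lt hLne
  have hcod : K = L ⊔ Submodule.span (ZMod 2) {a} := by
    refine le_antisymm ?_ (sup_le hLK ((Submodule.span_singleton_le_iff_mem _ _).2 haK))
    intro b hbK
    by_contra hb
    have hbL : b ∉ L := fun h1 => hb (Submodule.mem_sup_left h1)
    have haa : a ∈ L ⊔ Submodule.span (ZMod 2) {a} :=
      Submodule.mem_sup_right (Submodule.mem_span_singleton_self a)
    have habL : a + b ∉ L := fun h1 => hb (by
      have := sub_mem (Submodule.mem_sup_left h1) haa
      rwa [add_sub_cancel_left] at this)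
    have h1 := hbig a haK haL
    have h2 := hbig b hbK hbL
    have h3 := hbig (a + b) (add_mem haK hbK) habL
    have h4 : Pure dV (Ch (fixS g L ∩ {y | g a y = y ∧ g b y = y})) m := by
      have e1 : fixS g L ∩ {y | g a y = y ∧ g b y = y} =
          fixS g ((L ⊔ Submodule.span (ZMod 2) {a} ⊔ Submodule.span (ZMod 2) {b} :
            Submodule (ZMod 2) A) : Set A) := by
        rw [h.fixS_sup, h.fixS_sup, Set.inter_assoc]
        rfl
      rw [← h.fixS_sup] at h1
      obtain ⟨r, hr, h5⟩ := hmono (le_sup_left (b := Submodule.span (ZMod 2) {b})) h1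
      obtain ⟨r', hr', h6⟩ := hmono (sup_le (sup_le hLK
        ((Submodule.span_singleton_le_iff_mem _ _).2 haK))
        ((Submodule.span_singleton_le_iff_mem _ _).2 hbK)) h5
      have := hm.unique h6
      obtain rfl : m = r := by omega
      rwa [e1]
    have e2 : {y | g (a + b) y = y} = {y | g b y = g a y} := by
      ext y
      change g (a + b) y = y ↔ g b y = g a y
      rw [h.add]
      constructor
      · intro e
        rw [← (h.inv a).invol (g b y), e]
      · intro e
        rw [e, (h.inv a).invol]
    rw [e2] at h3
    exact hmq.ne' (pure_eq_of_rank_two (h.inv a) (h.inv b) (h.g_comm a b) (h.fixS_inv L a)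
      (h.fixS_inv L b) (h.lc0_fixS (hfin L)) hq h1 h2 h3 h4)
  have hq1 : q ≠ m + 1 := by
    rintro rfl
    obtain ⟨P, hP, hPS⟩ := h.exists_homotopy a
    refine (smith_inv (h.inv a) (h.fixS_inv L a) (h.lc0_fixS (hfin L))).drop_ne_one hq
      (hbig a haK haL) P hP (hPS L) ?_
    rw [← fixS_insert]
    exact hPS _
  have h1 := ih _ (Submodule.finrank_lt_finrank_of_lt hLne) L rfl q hq
  have h2 : Module.finrank (ZMod 2) K ≤ Module.finrank (ZMod 2) L + 1 := by
    rw [hcod]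
    refine (Submodule.finrank_add_le_finrank_add_finrank _ _).trans ?_
    have := finrank_span_le_card (R := ZMod 2) ({a} : Set A)
    rw [Set.toFinset_singleton, Finset.card_singleton] at this
    omega
  omega

/-- The fixed set of the whole group. -/
theorem exists_pure_top [Finite A] (h : Act g H) :
    ∃ r, Pure dV (Ch {y | ∀ a, g a y = y}) r ∧ r + 2 * Module.finrank (ZMod 2) A ≤ n + 1 := by
  have hbot : Pure dV (Ch (fixS g (∅ : Set A))) (n + 1) := by
    have : fixS g (∅ : Set A) = Set.univ := Set.eq_univ_of_forall fun y a ha => ha.elim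
    rw [this]
    exact pure_univ
  obtain ⟨r, -, hr⟩ := h.exists_pure Set.finite_empty (Set.toFinite Set.univ) hbot
  rw [Set.empty_union] at hr
  have h1 := h.pure_add_le ⊤ r (by rwa [Submodule.top_coe])
  rw [finrank_top] at h1
  refine ⟨r, ?_, h1⟩
  convert hr using 3
  ext y
  exact ⟨fun h a _ => h a, fun h a => h a trivial⟩

end Act

end

end InfChain

/-! ## Vanishing along a locally free local action -/

namespace InfChain

open Filter Topology MeasureTheory

noncomputable section

variable {E : Type*} [NormedAddCommGroup E]

lemma van_of_flows [ProperSpace E] {e : ℕ} {X : Set E} {f : Fin e → E → ℝ} {θ : Fin e → ℝ → E → E}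
    {ρ t₀ : ℝ}
    (hρ : 0 < ρ) (ht : 0 < t₀)
    (hcont : ∀ j, ContinuousOn (fun p : ℝ × E => θ j p.1 p.2)
      (Set.Icc (-t₀) t₀ ×ˢ Metric.closedBall 0 ρ))
    (hf : ∀ j, ContinuousOn (f j) (Metric.closedBall 0 ρ))
    (h0 : ∀ j, ∀ y ∈ Metric.closedBall (0 : E) ρ, θ j 0 y = y) (hf0 : ∀ j, f j 0 = 0)
    (hmem : ∀ j, ∀ y ∈ X, ‖y‖ ≤ ρ → ∀ t, |t| ≤ t₀ → θ j t y ∈ X)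
    (hadd : ∀ i j, ∀ y ∈ X, ‖y‖ ≤ ρ → ∀ t, |t| ≤ t₀ →
      f i (θ j t y) = f i y + if i = j then t else 0) :
    ∀ ℓ ≤ e, Van dV (Ch X) ℓ := by
  have key : ∀ m ≤ e, ∀ ℓ ≤ m, Van dV (Ch (X ∩ {y | ∀ i : Fin e, m ≤ i → f i y = 0})) ℓ := by
    intro m
    induction m with
    | zero =>
      intro _ ℓ hℓ
      obtain rfl : ℓ = 0 := by omega
      exact van_zero _
    | succ m ih =>
      intro hm
      let j : Fin e := ⟨m, by omega⟩
      have hflow : Flow (X ∩ {y | ∀ i : Fin e, m + 1 ≤ i → f i y = 0}) (f j) (θ j) ρ t₀ :=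
        { ρ_pos := hρ
          t_pos := ht
          cont := hcont j
          fcont := hf j
          zero := h0 j
          f0 := hf0 j
          mem := fun y hy hyρ t htt => ⟨hmem j y hy.1 hyρ t htt, fun i hi => by
            have hij : i ≠ j := by
              rintro rfl
              exact absurd hi (by simp [j])
            rw [hadd i j y hy.1 hyρ t htt, if_neg hij, add_zero]
            exact hy.2 i hi⟩
          add := fun y hy hyρ t htt => by rw [hadd j j y hy.1 hyρ t htt, if_pos rfl] }
      refine hflow.van_succ ?_
      have h1 : X ∩ {y | ∀ i : Fin e, m + 1 ≤ i → f i y = 0} ∩ {y | f j y = 0} =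
          X ∩ {y | ∀ i : Fin e, m ≤ i → f i y = 0} := by
        rw [Set.inter_assoc]
        congr 1
        ext y
        constructor
        · rintro ⟨h1, h2⟩ i hi
          rcases hi.eq_or_lt with h3 | h3
          · obtain rfl : i = j := Fin.ext h3.symm
            exact h2
          · exact h1 i h3
        · exact fun h => ⟨fun i hi => h i (by omega), h j le_rfl⟩
      rw [h1]
      exact ih (by omega)
  have h1 : X ∩ {y | ∀ i : Fin e, e ≤ i → f i y = 0} = X :=
    Set.inter_eq_left.2 fun y _ i hi => absurd i.2 (not_lt.2 hi)
  have := key e le_rfl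
  rwa [h1] at this

/-- A local action of a vector group near the origin that is free at the origin. -/
structure LocAct {e : ℕ} (X : Set E) (θ : (Fin e → ℝ) → E → E) (r ρ : ℝ) : Prop where
  r_pos : 0 < r
  ρ_pos : 0 < ρ
  cont : ContinuousOn (fun p : (Fin e → ℝ) × E => θ p.1 p.2)
    (Metric.closedBall 0 r ×ˢ Metric.closedBall 0 ρ)
  zero : ∀ y, ‖y‖ ≤ ρ → θ 0 y = y
  add : ∀ v s y, ‖v‖ ≤ r → ‖s‖ ≤ r → ‖v + s‖ ≤ r → ‖y‖ ≤ ρ → ‖θ s y‖ ≤ ρ →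
    θ v (θ s y) = θ (v + s) y
  free : ∀ v, ‖v‖ ≤ r → θ v 0 = 0 → v = 0
  mem : ∀ v, ‖v‖ ≤ r → ∀ y ∈ X, ‖y‖ ≤ ρ → θ v y ∈ X

variable {e : ℕ} {X : Set E} {θ : (Fin e → ℝ) → E → E} {r ρ : ℝ}

lemma LocAct.exists_near_id (h : LocAct X θ r ρ) {ε : ℝ} (hε : 0 < ε) :
    ∃ δ > 0, δ ≤ ρ ∧ ∃ t > 0, t ≤ r ∧ ∀ v y, ‖v‖ ≤ t → ‖y‖ ≤ δ → ‖θ v y‖ < ε := by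
  have h0 : θ 0 0 = 0 := h.zero 0 (by simpa using h.ρ_pos.le)
  have h1 := h.cont (0, 0) ⟨Metric.mem_closedBall_self h.r_pos.le,
    Metric.mem_closedBall_self h.ρ_pos.le⟩
  obtain ⟨δ, hδ, h2⟩ := Metric.continuousWithinAt_iff.1 h1 ε hε
  refine ⟨min (δ / 2) ρ, lt_min (half_pos hδ) h.ρ_pos, min_le_right _ _, min (δ / 2) r,
    lt_min (half_pos hδ) h.r_pos, min_le_right _ _, fun v y hv hy => ?_⟩
  have h3 := h2 (x := (v, y)) ⟨by simpa using hv.trans (min_le_right _ _),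
    by simpa using hy.trans (min_le_right _ _)⟩ (by
      rw [Prod.dist_eq, dist_zero_right, dist_zero_right]
      refine max_lt ?_ ?_
      · exact (hv.trans (min_le_left _ _)).trans_lt (half_lt_self hδ)
      · exact (hy.trans (min_le_left _ _)).trans_lt (half_lt_self hδ))
  simpa [h0] using h3

variable [ProperSpace E]

/-- The points of the orbit of the origin away from the origin are uniformly far away. -/
lemma LocAct.exists_sep (h : LocAct X θ r ρ) :
    ∃ η > 0, ∃ ρ' > 0, ρ' ≤ ρ ∧ ∀ v y, r / 4 ≤ ‖v‖ → ‖v‖ ≤ r → ‖y‖ ≤ ρ' → η ≤ ‖θ v y‖ := by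
  have hK : IsCompact (Metric.closedBall (0 : Fin e → ℝ) r ∩ {v | r / 4 ≤ ‖v‖}) :=
    (isCompact_closedBall _ _).inter_right (isClosed_le continuous_const continuous_norm)
  have hc0 : ContinuousOn (fun v => ‖θ v 0‖) (Metric.closedBall (0 : Fin e → ℝ) r) :=
    (h.cont.comp (f := fun v => (v, (0 : E))) (by fun_prop)
      fun v hv => ⟨hv, Metric.mem_closedBall_self h.ρ_pos.le⟩).norm
  obtain ⟨η, hη, h1⟩ : ∃ η > 0, ∀ v, r / 4 ≤ ‖v‖ → ‖v‖ ≤ r → 2 * η ≤ ‖θ v 0‖ := by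
    rcases (Metric.closedBall (0 : Fin e → ℝ) r ∩ {v | r / 4 ≤ ‖v‖}).eq_empty_or_nonempty
      with he | hne
    · refine ⟨1, one_pos, fun v h1 h2 => ?_⟩
      have : v ∈ Metric.closedBall (0 : Fin e → ℝ) r ∩ {v | r / 4 ≤ ‖v‖} := ⟨by simpa using h2, h1⟩
      rw [he] at this
      exact this.elim
    · obtain ⟨v₀, hv₀, hmin⟩ := hK.exists_isMinOn hne (hc0.mono Set.inter_subset_left)
      have hpos : 0 < ‖θ v₀ 0‖ := norm_pos_iff.2 fun e0 => by
        have := h.free v₀ (by simpa using hv₀.1) e0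
        have h2 : r / 4 ≤ ‖v₀‖ := hv₀.2
        rw [this, norm_zero] at h2
        linarith [h.r_pos]
      refine ⟨‖θ v₀ 0‖ / 2, half_pos hpos, fun v h1 h2 => ?_⟩
      have : ‖θ v₀ 0‖ ≤ ‖θ v 0‖ := hmin ⟨by simpa using h2, h1⟩
      linarith
  have huc := ((isCompact_closedBall (0 : Fin e → ℝ) r).prod
    (isCompact_closedBall (0 : E) ρ)).uniformContinuousOn_of_continuous h.cont
  rw [Metric.uniformContinuousOn_iff] at huc
  obtain ⟨δ, hδ, h2⟩ := huc η hη
  refine ⟨η, hη, min (δ / 2) ρ, lt_min (half_pos hδ) h.ρ_pos, min_le_right _ _,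
    fun v y hv1 hv2 hy => ?_⟩
  have h3 := h2 (v, y) ⟨by simpa using hv2, by simpa using hy.trans (min_le_right _ _)⟩
    (v, 0) ⟨by simpa using hv2, Metric.mem_closedBall_self h.ρ_pos.le⟩ (by
      rw [Prod.dist_eq, dist_self, dist_zero_right]
      exact max_lt hδ ((hy.trans (min_le_left _ _)).trans_lt (half_lt_self hδ)))
  have h4 := h1 v hv1 hv2
  have h5 : ‖θ v 0‖ ≤ ‖θ v y‖ + dist (θ v y) (θ v 0) := by
    rw [dist_comm, dist_eq_norm]
    have := norm_add_le (θ v y) (θ v 0 - θ v y)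
    rwa [add_sub_cancel] at this
  have h6 : dist (θ v y) (θ v 0) < η := h3
  linarith

/-- Local coordinates along the orbits, as a center of mass. -/
lemma LocAct.exists_coord (h : LocAct X θ r ρ) :
    ∃ f : E → Fin e → ℝ, ∃ ρ' > 0, ρ' ≤ ρ ∧ ∃ t₀ > 0, t₀ ≤ r ∧
      ContinuousOn f (Metric.closedBall 0 ρ') ∧ f 0 = 0 ∧
      ∀ s y, ‖s‖ ≤ t₀ → ‖y‖ ≤ ρ' → f (θ s y) = f y + s := by
  classical
  have hr := h.r_pos
  obtain ⟨η, hη, ρ₁, hρ₁, hρ₁ρ, hsep⟩ := h.exists_sep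
  let B : Set (Fin e → ℝ) := Metric.closedBall 0 (r / 2)
  have hB : IsCompact B := isCompact_closedBall _ _
  have hBm : MeasurableSet B := Metric.isClosed_closedBall.measurableSet
  have hBr : ∀ v ∈ B, ‖v‖ ≤ r := fun v hv => by
    have : ‖v‖ ≤ r / 2 := by simpa [B] using hv
    linarith
  let Ψ : E → (Fin e → ℝ) → ℝ := fun y => B.indicator fun v => max 0 (η - ‖θ v y‖)
  have hψc : ContinuousOn (fun p : (Fin e → ℝ) × E => max 0 (η - ‖θ p.1 p.2‖))
      (B ×ˢ Metric.closedBall 0 ρ) :=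
    (continuousOn_const (c := (0 : ℝ))).sup (continuousOn_const.sub
      (h.cont.mono (Set.prod_mono (fun v hv => by simpa using hBr v hv) le_rfl)).norm)
  have hψv : ∀ y, ‖y‖ ≤ ρ → ContinuousOn (fun v => max 0 (η - ‖θ v y‖)) B := fun y hy =>
    hψc.comp (f := fun v => (v, y)) (by fun_prop) fun v hv => ⟨hv, by simpa using hy⟩
  have hψy : ∀ v ∈ B, ContinuousOn (fun y => max 0 (η - ‖θ v y‖)) (Metric.closedBall 0 ρ) :=
    fun v hv => hψc.comp (f := fun y => (v, y)) (by fun_prop) fun y hy => ⟨hv, hy⟩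
  -- integrals against the bump function
  have hint : ∀ (q : (Fin e → ℝ) → ℝ), Continuous q →
      (∀ y, ‖y‖ ≤ ρ → Integrable (fun v => q v * Ψ y v)) ∧
      ContinuousOn (fun y => ∫ v, q v * Ψ y v) (Metric.closedBall 0 ρ) := by
    intro q hq
    have e1 : ∀ y, (fun v => q v * Ψ y v) = B.indicator fun v => q v * max 0 (η - ‖θ v y‖) := by
      intro y
      funext v
      by_cases hv : v ∈ B
      · simp [Ψ, hv]
      · simp [Ψ, hv]
    have hc : ∀ y, ‖y‖ ≤ ρ → ContinuousOn (fun v => q v * max 0 (η - ‖θ v y‖)) B := fun y hy =>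
      hq.continuousOn.mul (hψv y hy)
    refine ⟨fun y hy => ?_, ?_⟩
    · rw [e1, integrable_indicator_iff hBm]
      exact (hc y hy).integrableOn_compact hB
    · simp_rw [e1, integral_indicator hBm]
      obtain ⟨C, hC⟩ := hB.exists_bound_of_continuousOn hq.continuousOn
      refine continuousOn_of_dominated (bound := fun _ => C * η) (fun y hy => ?_) (fun y hy => ?_)
        ?_ ?_
      · exact (hc y (by simpa using hy)).aestronglyMeasurable hBm
      · refine (ae_restrict_iff' hBm).2 (Eventually.of_forall fun v hv => ?_)
        rw [norm_mul]
        refine mul_le_mul (hC v hv) ?_ (norm_nonneg _) ((norm_nonneg _).trans (hC v hv))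
        rw [Real.norm_of_nonneg (le_max_left _ _)]
        exact max_le hη.le (by linarith [norm_nonneg (θ v y)])
      · exact integrableOn_const hB.measure_lt_top.ne
      · exact (ae_restrict_iff' hBm).2 (Eventually.of_forall fun v hv =>
          continuousOn_const.mul (hψy v hv))
  let D : E → ℝ := fun y => ∫ v, Ψ y v
  let I : Fin e → E → ℝ := fun j y => ∫ v, v j * Ψ y v
  have hone := hint (fun _ => 1) continuous_const
  simp only [one_mul] at hone
  have hD : ContinuousOn D (Metric.closedBall 0 ρ) := hone.2
  have hI : ∀ j, ContinuousOn (I j) (Metric.closedBall 0 ρ) := fun j =>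
    (hint (fun v => v j) (continuous_apply j)).2
  have hΨ0 : ∀ y v, 0 ≤ Ψ y v := fun y v => Set.indicator_nonneg (fun _ _ => le_max_left _ _) _
  have hDpos : ∀ y, ‖y‖ ≤ ρ → ‖y‖ < η → 0 < D y := by
    intro y hy hyη
    have h1 : 0 < max 0 (η - ‖θ 0 y‖) := by
      rw [h.zero y hy]
      exact lt_max_of_lt_right (by linarith)
    have h0B : B ∈ 𝓝 (0 : Fin e → ℝ) := Metric.closedBall_mem_nhds _ (half_pos hr)
    have h2 := ((hψv y hy).continuousAt h0B).eventually (lt_mem_nhds h1)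
    refine (integral_pos_iff_support_of_nonneg (hΨ0 y) (hone.1 y hy)).2 ?_
    refine Measure.measure_pos_of_mem_nhds volume (x := 0) ?_
    filter_upwards [h2, h0B] with v hv hvB
    rw [Function.mem_support]
    simp only [Ψ, Set.indicator_of_mem hvB]
    exact hv.ne'
  obtain ⟨ρ₂, hρ₂, hρ₂ρ, t, ht, htr, hnear⟩ := h.exists_near_id hρ₁
  have hshift : ∀ s y, ‖s‖ ≤ min t (r / 4) → ‖y‖ ≤ min ρ₂ ρ₁ → ∀ v,
      Ψ (θ s y) v = Ψ y (v + s) := by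
    intro s y hs hy v
    have hs4 : ‖s‖ ≤ r / 4 := hs.trans (min_le_right _ _)
    have hyρ : ‖y‖ ≤ ρ := (hy.trans (min_le_right _ _)).trans hρ₁ρ
    have hθ : ‖θ s y‖ ≤ ρ₁ := (hnear s y (hs.trans (min_le_left _ _))
      (hy.trans (min_le_left _ _))).le
    have htri : ‖v‖ ≤ ‖v + s‖ + ‖s‖ := by
      have := norm_sub_le (v + s) s
      rwa [add_sub_cancel_right] at this
    have htri' := norm_add_le v s
    have hmB : ∀ w, w ∈ B ↔ ‖w‖ ≤ r / 2 := fun w => by simp [B]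
    have hz : ∀ w y', r / 4 ≤ ‖w‖ → ‖w‖ ≤ r → ‖y'‖ ≤ ρ₁ → max 0 (η - ‖θ w y'‖) = 0 :=
      fun w y' h1 h2 h3 => max_eq_left (by linarith [hsep w y' h1 h2 h3])
    have hadd : ‖v‖ ≤ r → ‖v + s‖ ≤ r → θ v (θ s y) = θ (v + s) y := fun h1 h2 =>
      h.add v s y h1 (by linarith) h2 hyρ (hθ.trans hρ₁ρ)
    by_cases hv : ‖v‖ ≤ r / 2
    · have e1 : Ψ (θ s y) v = max 0 (η - ‖θ (v + s) y‖) := by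
        simp only [Ψ, Set.indicator_of_mem ((hmB v).2 hv)]
        rw [hadd (by linarith) (by linarith)]
      rw [e1]
      by_cases hvs : ‖v + s‖ ≤ r / 2
      · simp only [Ψ, Set.indicator_of_mem ((hmB _).2 hvs)]
      · simp only [Ψ, Set.indicator_of_notMem (fun h1 => hvs ((hmB _).1 h1))]
        exact hz _ _ (by linarith) (by linarith) (hy.trans (min_le_right _ _))
    · have e1 : Ψ (θ s y) v = 0 := Set.indicator_of_notMem (fun h1 => hv ((hmB v).1 h1)) _
      rw [e1]
      by_cases hvs : ‖v + s‖ ≤ r / 2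
      · simp only [Ψ, Set.indicator_of_mem ((hmB _).2 hvs)]
        exact (hz _ _ (by linarith) (by linarith) (hy.trans (min_le_right _ _))).symm
      · exact (Set.indicator_of_notMem (fun h1 => hvs ((hmB _).1 h1)) _).symm
  let f₁ : E → Fin e → ℝ := fun y j => - (I j y / D y)
  let ρ' : ℝ := min (min ρ₂ ρ₁) (η / 2)
  have hρ' : 0 < ρ' := lt_min (lt_min hρ₂ hρ₁) (half_pos hη)
  have hρ'ρ : ρ' ≤ ρ := ((min_le_left _ _).trans (min_le_left _ _)).trans hρ₂ρ
  have hDne : ∀ y, ‖y‖ ≤ ρ' → D y ≠ 0 := fun y hy =>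
    (hDpos y (hy.trans hρ'ρ) ((hy.trans (min_le_right _ _)).trans_lt (half_lt_self hη))).ne'
  have hf₁ : ContinuousOn f₁ (Metric.closedBall 0 ρ') := by
    refine continuousOn_pi.2 fun j => ContinuousOn.neg ?_
    have hsub := Metric.closedBall_subset_closedBall (x := (0 : E)) hρ'ρ
    exact ((hI j).mono hsub).div (hD.mono hsub) fun y hy => hDne y (by simpa using hy)
  have hf₁add : ∀ s y, ‖s‖ ≤ min t (r / 4) → ‖y‖ ≤ ρ' → f₁ (θ s y) = f₁ y + s := by
    intro s y hs hy
    have hy' : ‖y‖ ≤ min ρ₂ ρ₁ := hy.trans (min_le_left _ _)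
    have e1 : D (θ s y) = D y := by
      simp only [D, hshift s y hs hy']
      exact integral_add_right_eq_self (fun v => Ψ y v) s
    funext j
    have e2 : I j (θ s y) = I j y - s j * D y := by
      simp only [I, D, hshift s y hs hy']
      rw [← integral_const_mul, ← integral_sub ((hint (fun v => v j) (continuous_apply j)).1 y
        (hy.trans hρ'ρ)) ((hone.1 y (hy.trans hρ'ρ)).const_mul _),
        ← integral_add_right_eq_self (fun v => v j * Ψ y v - s j * Ψ y v) s]
      refine integral_congr_ae (Eventually.of_forall fun v => ?_)
      simp only [Pi.add_apply]
      ring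
    simp only [f₁, Pi.add_apply, e1, e2]
    have := hDne y hy
    field_simp
    ring
  refine ⟨fun y => f₁ y - f₁ 0, ρ', hρ', hρ'ρ, min t (r / 4), lt_min ht (by linarith),
    (min_le_left _ _).trans htr, hf₁.sub continuousOn_const, sub_self _, fun s y hs hy => ?_⟩
  change f₁ (θ s y) - f₁ 0 = f₁ y - f₁ 0 + s
  rw [hf₁add s y hs hy]
  abel

theorem LocAct.van (h : LocAct X θ r ρ) : ∀ ℓ ≤ e, Van dV (Ch X) ℓ := by
  classical
  obtain ⟨f, ρ', hρ', hρρ, t₀, ht₀, htr, hf, hf0, hadd⟩ := h.exists_coord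
  have hs : ∀ (j : Fin e) (t : ℝ), ‖(Pi.single j t : Fin e → ℝ)‖ = |t| := fun j t => by
    rw [Pi.norm_single, Real.norm_eq_abs]
  refine van_of_flows (f := fun j y => f y j) (θ := fun j t => θ (Pi.single j t)) hρ' ht₀
    (fun j => ?_) (fun j => continuousOn_pi.1 hf j) (fun j y hy => ?_) (fun j => by simp [hf0])
    (fun j y hy hyρ t ht => h.mem _ (by rw [hs]; exact ht.trans htr) y hy (hyρ.trans hρρ))
    (fun i j y hy hyρ t ht => ?_)
  · refine h.cont.comp (f := fun p : ℝ × E => ((Pi.single j p.1 : Fin e → ℝ), p.2)) ?_ ?_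
    · have : Continuous fun t : ℝ => (Pi.single j t : Fin e → ℝ) := continuous_single (A := fun _ : Fin e => ℝ) j
      exact ((this.comp continuous_fst).prodMk continuous_snd).continuousOn
    · rintro ⟨t, y⟩ ⟨h1, h2⟩
      refine ⟨?_, Metric.closedBall_subset_closedBall hρρ h2⟩
      rw [mem_closedBall_zero_iff, hs]
      exact (abs_le.2 h1).trans htr
  · rw [Pi.single_zero]
    exact h.zero y ((by simpa using hy : ‖y‖ ≤ ρ').trans hρρ)
  · rw [hadd _ y (by rwa [hs]) hyρ, Pi.add_apply, Pi.single_apply]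

end

end InfChain

/-! ## Closed subgroups of a vector space -/

namespace InfChain

open Filter Topology Module

variable {V : Type*} [NormedAddCommGroup V] [NormedSpace ℝ V]

/-- The largest linear subspace contained in a subgroup. -/
def linPart (P : Submodule ℤ V) : Submodule ℝ V where
  carrier := {v | ∀ s : ℝ, s • v ∈ P}
  add_mem' ha hb s := by rw [smul_add]; exact P.add_mem (ha s) (hb s)
  zero_mem' s := by rw [smul_zero]; exact P.zero_mem
  smul_mem' c v hv s := by rw [smul_smul]; exact hv _

lemma mem_of_mem_linPart {P : Submodule ℤ V} {v : V} (h : v ∈ linPart P) : v ∈ P := by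
  simpa using h 1

lemma discreteTopology_of_small {Q : Submodule ℤ V} {r : ℝ} (hr : 0 < r)
    (h : ∀ q ∈ Q, ‖q‖ ≤ r → q = 0) : DiscreteTopology Q := by
  refine discreteTopology_of_isOpen_singleton_zero ?_
  suffices hq : ({0} : Set Q) = Metric.ball 0 r by
    rw [hq]
    exact Metric.isOpen_ball
  ext q
  rw [Set.mem_singleton_iff, mem_ball_zero_iff]
  constructor
  · rintro rfl
    simpa using hr
  · intro hq
    exact Subtype.ext (h q q.2 (le_of_lt hq))

variable [FiniteDimensional ℝ V]

/-- A closed subgroup has no small elements in a subspace transverse to its linear part. -/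
theorem exists_no_small {P : Submodule ℤ V} (hP : IsClosed (P : Set V)) {W : Submodule ℝ V}
    (h : Disjoint (linPart P) W) : ∃ r > 0, ∀ w ∈ W, ‖w‖ ≤ r → w ∈ P → w = 0 := by
  by_contra! hc
  choose w hwW hwr hwP hw0 using fun m : ℕ => hc (1 / ((m : ℝ) + 1)) (by positivity)
  have hn : ∀ m, 0 < ‖w m‖ := fun m => norm_pos_iff.2 (hw0 m)
  have ht : Tendsto (fun m => ‖w m‖) atTop (𝓝 0) :=
    squeeze_zero (fun m => norm_nonneg _) hwr tendsto_one_div_add_atTop_nhds_zero_nat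
  have : ProperSpace V := FiniteDimensional.proper ℝ V
  obtain ⟨u, hu, φ, hφ, hlim⟩ := (isCompact_sphere (0 : V) 1).tendsto_subseq
    (x := fun m => ‖w m‖⁻¹ • w m) fun m => by
      rw [mem_sphere_zero_iff_norm, norm_smul, norm_inv, norm_norm,
        inv_mul_cancel₀ (hn m).ne']
  have huW : u ∈ W := W.closed_of_finiteDimensional.mem_of_tendsto hlim
    (Eventually.of_forall fun m => W.smul_mem _ (hwW _))
  have huP : u ∈ linPart P := by
    intro s
    have h1 : Tendsto (fun m => (⌊s / ‖w (φ m)‖⌋ : ℝ) * ‖w (φ m)‖) atTop (𝓝 s) := by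
      have h2 : Tendsto (fun m => s - ‖w (φ m)‖) atTop (𝓝 s) := by
        simpa using (tendsto_const_nhds (x := s)).sub (ht.comp hφ.tendsto_atTop)
      refine tendsto_of_tendsto_of_tendsto_of_le_of_le h2 tendsto_const_nhds (fun m => ?_)
        fun m => ?_
      · have := Int.sub_one_lt_floor (s / ‖w (φ m)‖)
        have h3 := mul_lt_mul_of_pos_right this (hn (φ m))
        rw [sub_mul, div_mul_cancel₀ _ (hn _).ne', one_mul] at h3
        exact h3.le
      · have h3 := mul_le_mul_of_nonneg_right (Int.floor_le (s / ‖w (φ m)‖)) (hn (φ m)).le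
        rwa [div_mul_cancel₀ _ (hn _).ne'] at h3
    refine hP.mem_of_tendsto (h1.smul hlim) (Eventually.of_forall fun m => ?_)
    have h3 : ((⌊s / ‖w (φ m)‖⌋ : ℝ) * ‖w (φ m)‖) • (‖w (φ m)‖⁻¹ • w (φ m))
        = ⌊s / ‖w (φ m)‖⌋ • w (φ m) := by
      rw [smul_smul, mul_assoc, mul_inv_cancel₀ (hn _).ne', mul_one, Int.cast_smul_eq_zsmul]
    change ((⌊s / ‖w (φ m)‖⌋ : ℝ) * ‖w (φ m)‖) • (‖w (φ m)‖⁻¹ • w (φ m)) ∈ P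
    rw [h3]
    exact P.smul_mem _ (hwP _)
  have hu0 : u = 0 := by
    have := h.le_bot (show u ∈ linPart P ⊓ W from ⟨huP, huW⟩)
    simpa using this
  rw [hu0] at hu
  simp at hu

/-- A closed subgroup without linear part is discrete. -/
theorem discreteTopology_of_linPart {P : Submodule ℤ V} (hP : IsClosed (P : Set V))
    (h : linPart P = ⊥) : DiscreteTopology P := by
  obtain ⟨r, hr, hs⟩ := exists_no_small hP (W := ⊤) (by rw [h]; exact disjoint_bot_left)
  exact discreteTopology_of_small hr fun q hq hqr => hs q trivial hqr hq

lemma finrank_int_eq (Q : Submodule ℤ V) [DiscreteTopology Q] :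
    finrank ℝ (Submodule.span ℝ (Q : Set V)) = finrank ℤ Q := by
  have h := Real.finrank_eq_int_finrank_of_discrete (s := (Q : Set V))
    (by rw [Submodule.span_eq]; infer_instance)
  rw [Set.finrank, Set.finrank, Submodule.span_eq] at h
  exact h

/-- A lattice contained in a closed subgroup meets its linear part in a lattice. -/
theorem span_inter_linPart (L : Submodule ℤ V) [DiscreteTopology L] [IsZLattice ℝ L]
    {P : Submodule ℤ V} (hP : IsClosed (P : Set V)) (hLP : L ≤ P) :
    Submodule.span ℝ ((L : Set V) ∩ linPart P) = linPart P := by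
  obtain ⟨W, hW⟩ := Submodule.exists_isCompl (linPart P)
  obtain ⟨r, hr, hs⟩ := exists_no_small hP hW.disjoint
  let π : V →ₗ[ℝ] V := W.projection (linPart P) hW.symm
  have hπW : ∀ v, π v ∈ W := fun v => (W.projectionOnto (linPart P) hW.symm v).2
  have hπ : ∀ v, v - π v ∈ linPart P := by
    intro v
    exact Submodule.sub_projection_mem _ v
  let f : L →ₗ[ℤ] V := (π.restrictScalars ℤ) ∘ₗ L.subtype
  have hd : DiscreteTopology (LinearMap.range f) := by
    refine discreteTopology_of_small hr ?_
    rintro _ ⟨v, rfl⟩ hv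
    refine hs _ (hπW _) hv ?_
    have h1 := P.sub_mem (hLP v.2) (mem_of_mem_linPart (hπ v))
    rwa [sub_sub_cancel] at h1
  have hspan : Submodule.span ℝ (LinearMap.range f : Set V) = W := by
    have : (LinearMap.range f : Set V) = π '' L := by
      ext v
      simp [f]
    rw [this, Submodule.span_image, IsZLattice.span_top, Submodule.map_top]
    exact Submodule.range_projection hW.symm
  have h1 := finrank_int_eq (LinearMap.range f)
  rw [hspan] at h1
  let Q : Submodule ℤ V := L ⊓ (linPart P).restrictScalars ℤ
  have hQd : DiscreteTopology Q :=
    DiscreteTopology.of_subset (s := (L : Set V)) (t := (Q : Set V)) inferInstance inf_le_left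
  have h2 := Submodule.finrank_quotient_add_finrank (LinearMap.ker f)
  rw [f.quotKerEquivRange.finrank_eq] at h2
  have h3 : finrank ℤ (LinearMap.ker f) = finrank ℤ Q := by
    have : Q = (LinearMap.ker f).map L.subtype := by
      ext v
      have hz : π v = 0 ↔ v ∈ linPart P := Submodule.projection_apply_eq_zero_iff _
      constructor
      · rintro ⟨h1, h2⟩
        exact ⟨⟨v, h1⟩, hz.2 h2, rfl⟩
      · rintro ⟨w, h1, rfl⟩
        exact ⟨w.2, hz.1 h1⟩
    rw [this]
    exact (LinearEquiv.finrank_eq (Submodule.equivMapOfInjective _ L.injective_subtype _))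
  have h4 := finrank_int_eq Q
  have h5 := Submodule.finrank_add_eq_of_isCompl hW
  have h6 := ZLattice.rank ℝ L
  refine Submodule.eq_of_le_of_finrank_eq (Submodule.span_le.2 fun v hv => hv.2) ?_
  change finrank ℝ (Submodule.span ℝ (Q : Set V)) = _
  omega

end InfChain

/-! ## Actions of a vector group on a manifold -/

namespace InfChain

open Filter Topology Module

variable {V M : Type*} [NormedAddCommGroup V] [TopologicalSpace M]

/-- A continuous action of the additive group of `V`. -/
structure TAct (α : V → M → M) : Prop where
  cont : Continuous fun p : V × M => α p.1 p.2
  zero : ∀ y, α 0 y = y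
  add : ∀ v w y, α (v + w) y = α v (α w y)

namespace TAct

variable {α : V → M → M}

lemma cont_left (h : TAct α) (y : M) : Continuous fun v => α v y :=
  h.cont.comp (continuous_id.prodMk continuous_const)

lemma cont_right (h : TAct α) (v : V) : Continuous (α v) :=
  h.cont.comp (continuous_const.prodMk continuous_id)

lemma neg_apply (h : TAct α) (v : V) (y : M) : α (-v) (α v y) = y := by
  rw [← h.add, neg_add_cancel, h.zero]

lemma apply_neg (h : TAct α) (v : V) (y : M) : α v (α (-v) y) = y := by
  rw [← h.add, add_neg_cancel, h.zero]

/-- The subgroup of the elements acting trivially on a set. -/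
def kerOn (h : TAct α) (U : Set M) : Submodule ℤ V :=
  AddSubgroup.toIntSubmodule
    { carrier := {v | ∀ y ∈ U, α v y = y}
      add_mem' := fun {a b} ha hb y hy => by rw [h.add, hb y hy, ha y hy]
      zero_mem' := fun y _ => h.zero y
      neg_mem' := fun {a} ha y hy => by
        have h1 := h.neg_apply a y
        rwa [ha y hy] at h1 }

lemma mem_kerOn (h : TAct α) {U : Set M} {v : V} : v ∈ h.kerOn U ↔ ∀ y ∈ U, α v y = y := Iff.rfl

lemma isClosed_kerOn [T1Space M] (h : TAct α) (U : Set M) : IsClosed (h.kerOn U : Set V) := by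
  have : (h.kerOn U : Set V) = ⋂ y ∈ U, (fun v => α v y) ⁻¹' {y} := by
    ext v
    simp only [Set.mem_iInter]
    exact h.mem_kerOn
  rw [this]
  exact isClosed_biInter fun y _ => isClosed_singleton.preimage (h.cont_left y)

lemma kerOn_anti (h : TAct α) {U U' : Set M} (hU : U ⊆ U') : h.kerOn U' ≤ h.kerOn U :=
  fun _ hv y hy => hv y (hU hy)

lemma congr_of_sub_mem (h : TAct α) {v w : V} (hvw : v - w ∈ h.kerOn Set.univ) (y : M) :
    α v y = α w y := by
  have h1 := h.add (v - w) w y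
  rwa [sub_add_cancel, hvw _ trivial] at h1

variable [NormedSpace ℝ V]

/-- Invariant connected neighbourhoods of a fixed point. -/
theorem exists_tube [LocallyConnectedSpace M] (h : TAct α) {x : M} {H : Submodule ℝ V}
    (hx : ∀ v ∈ H, α v x = x) {C : Set V} (hC : IsCompact C) (hCH : C ⊆ H)
    (hHC : ∀ v ∈ H, ∃ w ∈ C, v - w ∈ h.kerOn Set.univ) {O : Set M} (hO : IsOpen O) (hxO : x ∈ O) :
    ∃ U ⊆ O, IsOpen U ∧ IsPreconnected U ∧ x ∈ U ∧ ∀ v ∈ H, ∀ y ∈ U, α v y ∈ U := by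
  obtain ⟨A, B, hA, hB, hCA, hxB, hAB⟩ := generalized_tube_lemma hC (isCompact_singleton (x := x))
    (hO.preimage h.cont) (by
      rintro ⟨v, y⟩ ⟨hv, rfl⟩
      change α v y ∈ O
      rwa [hx v (hCH hv)])
  have hxB : x ∈ B := hxB rfl
  set N := connectedComponentIn B x
  have hN : IsOpen N := hB.connectedComponentIn
  have hNB : N ⊆ B := connectedComponentIn_subset B x
  have hxN : x ∈ N := mem_connectedComponentIn hxB
  refine ⟨⋃ v : H, α v '' N, ?_, ?_, ?_, ?_, ?_⟩
  · rintro _ ⟨_, ⟨v, rfl⟩, y, hy, rfl⟩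
    obtain ⟨w, hw, hvw⟩ := hHC v v.2
    rw [h.congr_of_sub_mem hvw]
    exact hAB (show (w, y) ∈ A ×ˢ B from ⟨hCA hw, hNB hy⟩)
  · refine isOpen_iUnion fun v => ?_
    have : α v '' N = α (-v) ⁻¹' N := by
      ext y
      constructor
      · rintro ⟨z, hz, rfl⟩
        change α (-v) (α v z) ∈ N
        rwa [h.neg_apply]
      · intro hy
        exact ⟨_, hy, h.apply_neg _ _⟩
    rw [this]
    exact hN.preimage (h.cont_right _)
  · refine isPreconnected_iUnion ⟨x, Set.mem_iInter.2 fun v => ⟨x, hxN, hx v v.2⟩⟩ fun v => ?_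
    exact isPreconnected_connectedComponentIn.image _ (h.cont_right _).continuousOn
  · exact Set.mem_iUnion.2 ⟨0, x, hxN, h.zero x⟩
  · rintro v hv _ ⟨_, ⟨w, rfl⟩, y, hy, rfl⟩
    exact Set.mem_iUnion.2 ⟨⟨v, hv⟩ + w, y, hy, h.add v w y⟩

end TAct

/-- Newman's theorem in a chart. -/
theorem eq_self_of_chart {n : ℕ} (e : OpenPartialHomeomorph M (EuclideanSpace ℝ (Fin n)))
    {U W : Set M} (hUe : U ⊆ e.source) (hU : IsOpen U) (hUc : IsPreconnected U) {f : M → M}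
    (hf : Continuous f) (hm : ∀ y ∈ U, f y ∈ U) (hi : ∀ y ∈ U, f (f y) = y) (hW : IsOpen W)
    (hne : (U ∩ W).Nonempty) (hfW : ∀ y ∈ W, f y = y) : ∀ y ∈ U, f y = y := by
  have key := eq_self_of_interior (U := e '' U) (g := fun y => e (f (e.symm y)))
    (e.isOpen_image_of_subset_source hU hUe) (hUc.image _ (e.continuousOn.mono hUe)) ?_ ?_ ?_ ?_
  · intro y hy
    have h1 := key (e y) ⟨y, hy, rfl⟩
    simp only [e.left_inv (hUe hy)] at h1
    exact e.injOn (hUe (hm y hy)) (hUe hy) h1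
  · refine e.continuousOn.comp (hf.comp_continuousOn (e.continuousOn_symm.mono ?_)) ?_
    · rintro _ ⟨y, hy, rfl⟩
      exact e.map_source (hUe hy)
    · rintro _ ⟨y, hy, rfl⟩
      simp only [e.left_inv (hUe hy)]
      exact hUe (hm y hy)
  · rintro _ ⟨y, hy, rfl⟩
    simp only [e.left_inv (hUe hy)]
    exact ⟨_, hm y hy, rfl⟩
  · rintro _ ⟨y, hy, rfl⟩
    simp only [e.left_inv (hUe hy), e.left_inv (hUe (hm y hy)), hi y hy]
  · obtain ⟨y, hy, hyW⟩ := hne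
    refine ⟨e y, ⟨y, hy, rfl⟩, mem_interior.2 ⟨e '' (U ∩ W), ?_,
      e.isOpen_image_of_subset_source (hU.inter hW) fun z hz => hUe hz.1, ⟨y, ⟨hy, hyW⟩, rfl⟩⟩⟩
    rintro _ ⟨z, ⟨hz, hzW⟩, rfl⟩
    change e (f (e.symm (e z))) = e z
    rw [e.left_inv (hUe hz), hfW z hzW]

end InfChain

/-! ## Circles acting trivially on an open set -/

namespace InfChain

open Filter Topology Module

variable {V M : Type*} [NormedAddCommGroup V] [NormedSpace ℝ V] [TopologicalSpace M]

lemma smul_sub_fract_smul {v : V} (s : ℝ) :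
    s • v - Int.fract s • v = ⌊s⌋ • v := by
  rw [← sub_smul, Int.self_sub_fract, Int.cast_smul_eq_zsmul]

namespace TAct

variable {α : V → M → M}

lemma mem_linPart_of_small (h : TAct α) {v : V} {U : Set M} {ε : ℝ} (hε : 0 < ε)
    (hs : ∀ s : ℝ, |s| < ε → s • v ∈ h.kerOn U) : v ∈ linPart (h.kerOn U) := by
  intro s
  obtain ⟨N, hN⟩ := exists_nat_gt (|s| / ε)
  have hN0 : (0 : ℝ) < N := lt_of_le_of_lt (by positivity) hN
  have h1 := (h.kerOn U).smul_mem (N : ℤ) (hs (s / N) (by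
    rw [abs_div, Nat.abs_cast, div_lt_iff₀ hN0]
    rwa [div_lt_iff₀ hε, mul_comm] at hN))
  rw [natCast_zsmul, ← Nat.cast_smul_eq_nsmul ℝ, smul_smul, mul_div_cancel₀ _ hN0.ne'] at h1
  exact h1

lemma mem_linPart_of_dyadic [T1Space M] (h : TAct α) {v : V} {U : Set M}
    (hs : ∀ m : ℕ, ((1 : ℝ) / 2 ^ m) • v ∈ h.kerOn U) : v ∈ linPart (h.kerOn U) := by
  intro s
  have ht : Tendsto (fun m : ℕ => (⌊s * 2 ^ m⌋ : ℝ) / 2 ^ m) atTop (𝓝 s) := by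
    have h2 : Tendsto (fun m : ℕ => s - (1 / 2 : ℝ) ^ m) atTop (𝓝 s) := by
      simpa using (tendsto_const_nhds (x := s)).sub
        (tendsto_pow_atTop_nhds_zero_of_lt_one (by norm_num) (by norm_num : (1 / 2 : ℝ) < 1))
    refine tendsto_of_tendsto_of_tendsto_of_le_of_le h2 tendsto_const_nhds (fun m => ?_)
      fun m => ?_
    · have := Int.sub_one_lt_floor (s * 2 ^ m)
      change s - (1 / 2 : ℝ) ^ m ≤ (⌊s * 2 ^ m⌋ : ℝ) / 2 ^ m
      rw [le_div_iff₀ (by positivity), sub_mul, ← mul_pow]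
      norm_num
      linarith
    · change (⌊s * 2 ^ m⌋ : ℝ) / 2 ^ m ≤ s
      rw [div_le_iff₀ (by positivity)]
      exact Int.floor_le _
  refine (h.isClosed_kerOn U).mem_of_tendsto (ht.smul_const v) (Eventually.of_forall fun m => ?_)
  have h3 := (h.kerOn U).smul_mem ⌊s * 2 ^ m⌋ (hs m)
  rw [← Int.cast_smul_eq_zsmul ℝ, smul_smul, mul_one_div] at h3
  exact h3

/-- A circle acting trivially on a nonempty open set acts trivially. -/
theorem mem_linPart_of_open (n : ℕ) [ChartedSpace (EuclideanSpace ℝ (Fin n)) M] [PreconnectedSpace M] (h : TAct α) {v : V}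
    (hv : v ∈ h.kerOn Set.univ) {W : Set M} (hW : IsOpen W) (hne : W.Nonempty)
    (hvW : v ∈ linPart (h.kerOn W)) : v ∈ linPart (h.kerOn Set.univ) := by
  have : T1Space M := ChartedSpace.t1Space (EuclideanSpace ℝ (Fin n)) M
  have : LocallyConnectedSpace M :=
    ChartedSpace.locallyConnectedSpace (EuclideanSpace ℝ (Fin n)) M
  set T : Set M := interior {y | ∀ s : ℝ, α (s • v) y = y} with hT
  have hTs : ∀ y ∈ T, ∀ s : ℝ, α (s • v) y = y := fun y hy => interior_subset hy
  have hTo : IsOpen T := isOpen_interior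
  have hTc : IsClosed T := by
    refine isClosed_of_closure_subset fun y hy => ?_
    have hfr : ∃ᶠ z in 𝓝 y, z ∈ T := mem_closure_iff_frequently.1 hy
    let e := chartAt (EuclideanSpace ℝ (Fin n)) y
    have hye : y ∈ e.source := mem_chart_source _ y
    have hfix : ∀ s : ℝ, α (s • v) y = y := by
      have hev : ∀ᶠ s : ℝ in 𝓝 0, α (s • v) y ∈ e.source := by
        have hc : Continuous fun s : ℝ => α (s • v) y :=
          (h.cont_left y).comp (continuous_id.smul continuous_const)
        refine hc.continuousAt.eventually_mem (e.open_source.mem_nhds ?_)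
        rwa [zero_smul, h.zero]
      obtain ⟨ε, hε, hs⟩ := Metric.eventually_nhds_iff.1 hev
      have hl : v ∈ linPart (h.kerOn {y}) := by
        refine h.mem_linPart_of_small hε fun s hsε => ?_
        intro y' hy'
        rw [show y' = y from hy']
        have hse := hs (y := s) (by rwa [Real.dist_eq, sub_zero])
        have hcd : ContinuousAt (fun z => e (α (s • v) z) - e z) y :=
          ((e.continuousAt hse).comp (f := α (s • v)) (h.cont_right _).continuousAt).sub
            (e.continuousAt hye)
        have h0 : e (α (s • v) y) - e y = 0 := by
          by_contra h1
          refine hfr ((hcd.eventually_ne h1).mono fun z hz hzT => hz ?_)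
          rw [hTs z hzT s, sub_self]
        exact e.injOn hse hye (sub_eq_zero.1 h0)
      exact fun s => hl s y rfl
    have hspan : ∀ w ∈ Submodule.span ℝ {v}, ∃ s : ℝ, s • v = w := fun w hw =>
      Submodule.mem_span_singleton.1 hw
    have hmem : ∀ s : ℝ, s • v ∈ Submodule.span ℝ {v} := fun s =>
      Submodule.smul_mem _ _ (Submodule.mem_span_singleton_self v)
    obtain ⟨U, hUe, hUo, hUc, hyU, hUm⟩ := h.exists_tube (x := y) (H := Submodule.span ℝ {v})
      (C := (fun s : ℝ => s • v) '' Set.Icc 0 1) (O := e.source)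
      (fun w hw => by
        obtain ⟨s, rfl⟩ := hspan w hw
        exact hfix s)
      (isCompact_Icc.image (continuous_id.smul continuous_const))
      (by
        rintro _ ⟨s, -, rfl⟩
        exact hmem s)
      (fun w hw => by
        obtain ⟨s, rfl⟩ := hspan w hw
        refine ⟨_, ⟨Int.fract s, ⟨Int.fract_nonneg s, (Int.fract_lt_one s).le⟩, rfl⟩, ?_⟩
        change s • v - Int.fract s • v ∈ _
        rw [smul_sub_fract_smul]
        exact (h.kerOn Set.univ).smul_mem _ hv)
      e.open_source hye
    obtain ⟨z, hzU, hzT⟩ := mem_closure_iff.1 hy U hUo hyU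
    have hUm' : ∀ s : ℝ, ∀ z ∈ U, α (s • v) z ∈ U := fun s =>
      hUm _ (Submodule.smul_mem _ _ (Submodule.mem_span_singleton_self v))
    have hd : ∀ m : ℕ, ((1 : ℝ) / 2 ^ m) • v ∈ h.kerOn U := by
      intro m
      induction m with
      | zero =>
        rw [pow_zero, div_one, one_smul]
        exact h.kerOn_anti (Set.subset_univ U) hv
      | succ m ih =>
        refine eq_self_of_chart e hUe hUo hUc (h.cont_right _) (hUm' _) (fun z hz => ?_) hTo
          ⟨z, hzU, hzT⟩ fun z hz => hTs z hz _
        rw [← h.add, ← add_smul]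
        have : (1 : ℝ) / 2 ^ (m + 1) + 1 / 2 ^ (m + 1) = 1 / 2 ^ m := by
          rw [pow_succ]
          field_simp
          norm_num
        rw [this]
        exact ih z hz
    have hl := h.mem_linPart_of_dyadic hd
    exact mem_interior.2 ⟨U, fun z hz s => hl s z hz, hUo, hyU⟩
  have hTu : T = Set.univ := by
    refine IsClopen.eq_univ ⟨hTc, hTo⟩ ?_
    obtain ⟨y, hy⟩ := hne
    exact ⟨y, mem_interior.2 ⟨W, fun z hz s => hvW s z hz, hW, hy⟩⟩
  exact fun s y _ => hTs y (hTu ▸ Set.mem_univ y) s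

end TAct

end InfChain

/-! ## Lattices in linear subspaces -/

namespace InfChain

open Filter Topology Module

variable {V : Type*} [NormedAddCommGroup V] [NormedSpace ℝ V]

lemma linPart_eq_bot (L : Submodule ℤ V) [DiscreteTopology L] : linPart L = ⊥ := by
  refine (Submodule.eq_bot_iff _).2 fun v hv => ?_
  let f : ℝ → L := fun s => ⟨s • v, hv s⟩
  have hf : Continuous f := (continuous_id.smul continuous_const).subtype_mk _
  have h1 := congrArg Subtype.val (PreconnectedSpace.constant inferInstance hf (x := 1) (y := 0))
  simpa [f] using h1

/-- The part of a subgroup contained in a linear subspace. -/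
noncomputable def comapSub (L : Submodule ℤ V) (H : Submodule ℝ V) : Submodule ℤ H :=
  ZLattice.comap ℝ L H.subtype

lemma discreteTopology_comapSub (L : Submodule ℤ V) [DiscreteTopology L] (H : Submodule ℝ V) :
    DiscreteTopology (comapSub L H) :=
  ZLattice.comap_discreteTopology ℝ L continuous_subtype_val H.injective_subtype

lemma span_comapSub {L : Submodule ℤ V} {H : Submodule ℝ V}
    (h : Submodule.span ℝ ((L : Set V) ∩ H) = H) :
    Submodule.span ℝ (comapSub L H : Set H) = ⊤ := by
  rw [← (Submodule.map_injective_of_injective H.injective_subtype).eq_iff, Submodule.map_span,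
    Submodule.map_top, Submodule.range_subtype]
  rw [show (H.subtype '' (comapSub L H : Set H)) = (L : Set V) ∩ H from ?_, h]
  ext v
  constructor
  · rintro ⟨w, hw, rfl⟩
    exact ⟨hw, w.2⟩
  · rintro ⟨h1, h2⟩
    exact ⟨⟨v, h2⟩, h1, rfl⟩

variable [FiniteDimensional ℝ V]

/-- A lattice is cocompact. -/
lemma exists_compact_cover (L : Submodule ℤ V) [DiscreteTopology L] [IsZLattice ℝ L] :
    ∃ C : Set V, IsCompact C ∧ ∀ v, ∃ w ∈ C, v - w ∈ L := by
  have : ProperSpace V := FiniteDimensional.proper ℝ V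
  let b := Module.finBasis ℤ L
  let B := b.ofZLatticeBasis ℝ
  refine ⟨Metric.closedBall 0 (∑ i, ‖B i‖), isCompact_closedBall _ _, fun v =>
    ⟨ZSpan.fract B v, ?_, ?_⟩⟩
  · rw [mem_closedBall_zero_iff]
    exact ZSpan.norm_fract_le B v
  · rw [ZSpan.fract_apply, sub_sub_cancel]
    exact (b.ofZLatticeBasis_span ℝ).le (ZSpan.floor B v).2

lemma exists_compact_cover_sub (L : Submodule ℤ V) [DiscreteTopology L] {H : Submodule ℝ V}
    (h : Submodule.span ℝ ((L : Set V) ∩ H) = H) :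
    ∃ C : Set V, IsCompact C ∧ C ⊆ H ∧ ∀ v ∈ H, ∃ w ∈ C, v - w ∈ L := by
  have := discreteTopology_comapSub L H
  have : IsZLattice ℝ (comapSub L H) := ⟨span_comapSub h⟩
  obtain ⟨C, hC, hCL⟩ := exists_compact_cover (comapSub L H)
  refine ⟨Subtype.val '' C, hC.image continuous_subtype_val, ?_, fun v hv => ?_⟩
  · rintro _ ⟨w, -, rfl⟩
    exact w.2
  · obtain ⟨w, hw, hvw⟩ := hCL ⟨v, hv⟩
    exact ⟨w, ⟨w, hw, rfl⟩, hvw⟩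

/-- Representatives of the points of order two modulo a lattice. -/
lemma exists_halves (L : Submodule ℤ V) [DiscreteTopology L] [IsZLattice ℝ L] :
    ∃ u : (Fin (finrank ℝ V) → ZMod 2) → V, u 0 = 0 ∧ (∀ a b, u (a + b) - (u a + u b) ∈ L) ∧
      ∀ a, u a ∈ L → a = 0 := by
  rw [← ZLattice.rank ℝ L]
  let b := Module.finBasis ℤ L
  let B := b.ofZLatticeBasis ℝ
  let c : ZMod 2 → ℝ := fun z => (z.val : ℝ) / 2
  have hc2 : ∀ z, (z.val : ℝ) = 2 * c z := fun z => by simp only [c]; ring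
  have hc : ∀ z w : ZMod 2, ∃ m : ℤ, c (z + w) - (c z + c w) = m := by
    intro z w
    refine ⟨-(((z.val + w.val) / 2 : ℕ) : ℤ), ?_⟩
    have h1 := Nat.div_add_mod (z.val + w.val) 2
    have h2 : ((2 * ((z.val + w.val) / 2) + (z + w).val : ℕ) : ℝ) = ((z.val + w.val : ℕ) : ℝ) := by
      rw [ZMod.val_add, h1]
    rw [Nat.cast_add, Nat.cast_mul, Nat.cast_add, hc2, hc2, hc2] at h2
    rw [Int.cast_neg, Int.cast_natCast]
    push_cast at h2 ⊢
    linarith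
  refine ⟨fun a => ∑ i, c (a i) • B i, ?_, fun a a' => ?_, fun a ha => ?_⟩
  · simp [c]
  · choose m hm using fun i => hc (a i) (a' i)
    rw [← Finset.sum_add_distrib, ← Finset.sum_sub_distrib]
    refine L.sum_mem fun i _ => ?_
    rw [← add_smul, ← sub_smul, Pi.add_apply, hm, Int.cast_smul_eq_zsmul]
    refine L.smul_mem _ ?_
    rw [b.ofZLatticeBasis_apply ℝ]
    exact (b i).2
  · funext i
    have h1 := b.ofZLatticeBasis_repr_apply ℝ L ⟨_, ha⟩ i
    have h2 : B.repr (∑ i, c (a i) • B i) i = c (a i) := by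
      rw [B.repr_sum_self]
    change B.repr (∑ i, c (a i) • B i) i = _ at h1
    rw [h2] at h1
    have h3 : ((a i).val : ℝ) = ((2 * b.repr ⟨_, ha⟩ i : ℤ) : ℝ) := by
      rw [Int.cast_mul, hc2, h1]
      rfl
    have h4 : ((a i).val : ℤ) = 2 * b.repr ⟨_, ha⟩ i := by exact_mod_cast h3
    have h5 := (a i).val_lt
    exact (ZMod.val_eq_zero _).1 (by omega)

end InfChain

/-! ## Actions in a chart -/

namespace InfChain

open Filter Topology Module

noncomputable section

variable {V M E : Type*} [NormedAddCommGroup V] [NormedSpace ℝ V] [TopologicalSpace M]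
  [NormedAddCommGroup E] {e : OpenPartialHomeomorph M E} {U : Set M}

open Classical in
/-- The expression in a chart of a self-map of an open set, extended by the identity. -/
def chartMap (e : OpenPartialHomeomorph M E) (U : Set M) (f : M → M) (y : E) : E :=
  if y ∈ e '' U then e (f (e.symm y)) else y

lemma chartMap_apply (hUe : U ⊆ e.source) (f : M → M) {z : M} (hz : z ∈ U) :
    chartMap e U f (e z) = e (f z) := by
  rw [chartMap, if_pos ⟨z, hz, rfl⟩, e.left_inv (hUe hz)]

lemma chartMap_of_notMem (f : M → M) {y : E} (hy : y ∉ e '' U) : chartMap e U f y = y :=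
  if_neg hy

lemma chartMap_comp (hUe : U ⊆ e.source) (f : M → M) {f' : M → M} (hf' : ∀ z ∈ U, f' z ∈ U)
    (y : E) : chartMap e U f (chartMap e U f' y) = chartMap e U (fun z => f (f' z)) y := by
  by_cases hy : y ∈ e '' U
  · obtain ⟨z, hz, rfl⟩ := hy
    rw [chartMap_apply hUe _ hz, chartMap_apply hUe _ (hf' z hz), chartMap_apply hUe _ hz]
  · simp only [chartMap_of_notMem _ hy]

lemma chartMap_congr (hUe : U ⊆ e.source) {f f' : M → M} (hf : ∀ z ∈ U, f z = f' z) :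
    chartMap e U f = chartMap e U f' := by
  funext y
  by_cases hy : y ∈ e '' U
  · obtain ⟨z, hz, rfl⟩ := hy
    rw [chartMap_apply hUe _ hz, chartMap_apply hUe _ hz, hf z hz]
  · simp only [chartMap_of_notMem _ hy]

lemma chartMap_eq_self (hUe : U ⊆ e.source) {f : M → M} (hf : ∀ z ∈ U, f z = z) (y : E) :
    chartMap e U f y = y := by
  by_cases hy : y ∈ e '' U
  · obtain ⟨z, hz, rfl⟩ := hy
    rw [chartMap_apply hUe _ hz, hf z hz]
  · exact chartMap_of_notMem _ hy

lemma continuousOn_chartMap (hUe : U ⊆ e.source) {F : ℝ → M → M}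
    (hF : Continuous fun p : ℝ × M => F p.1 p.2) (hFU : ∀ s, ∀ z ∈ U, F s z ∈ U) :
    ContinuousOn (fun p : ℝ × E => chartMap e U (F p.1) p.2) (Set.univ ×ˢ (e '' U)) := by
  have h1 : ContinuousOn (fun p : ℝ × E => e (F p.1 (e.symm p.2))) (Set.univ ×ˢ (e '' U)) := by
    refine e.continuousOn.comp (hF.comp_continuousOn
      (f := fun p : ℝ × E => (p.1, e.symm p.2)) (continuousOn_fst.prodMk
        (e.continuousOn_symm.comp continuousOn_snd ?_))) ?_
    · rintro ⟨s, _⟩ ⟨-, z, hz, rfl⟩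
      exact e.map_source (hUe hz)
    · rintro ⟨s, _⟩ ⟨-, z, hz, rfl⟩
      change F s (e.symm (e z)) ∈ e.source
      rw [e.left_inv (hUe hz)]
      exact hUe (hFU s z hz)
  refine h1.congr ?_
  rintro ⟨s, _⟩ ⟨-, z, hz, rfl⟩
  change chartMap e U (F s) (e z) = e (F s (e.symm (e z)))
  rw [chartMap_apply hUe _ hz, e.left_inv (hUe hz)]

namespace TAct

variable {n : ℕ} {α : V → M → M} {e : OpenPartialHomeomorph M (EuclideanSpace ℝ (Fin n))}

/-- Elements of order two in a connected isotropy group. -/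
theorem act (h : TAct α) (hUe : U ⊆ e.source) (hUo : IsOpen U) (hUc : IsPreconnected U) {x : M}
    (hxU : x ∈ U) (hx : e x = 0) {H : Submodule ℝ V} (hHx : ∀ v ∈ H, α v x = x)
    (hHU : ∀ v ∈ H, ∀ y ∈ U, α v y ∈ U) {A : Type*} [AddCommGroup A] (hA : ∀ a : A, a + a = 0)
    {u : A → V} (hu : ∀ a, u a ∈ H) (hu0 : u 0 = 0)
    (hadd : ∀ a b, u (a + b) - (u a + u b) ∈ h.kerOn U) (hinj : ∀ a, u a ∈ h.kerOn U → a = 0) :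
    Act (fun a => chartMap e U (α (u a))) (fun a s => chartMap e U (α (s • u a))) := by
  have hus : ∀ a (s : ℝ), s • u a ∈ H := fun a s => H.smul_mem s (hu a)
  have hDo : IsOpen (e '' U) := e.isOpen_image_of_subset_source hUo hUe
  have hD0 : (0 : EuclideanSpace ℝ (Fin n)) ∈ e '' U := ⟨x, hxU, hx⟩
  have hcomp : ∀ v, ∀ w ∈ H, ∀ y,
      chartMap e U (α v) (chartMap e U (α w) y) = chartMap e U (α (v + w)) y := by
    intro v w hw y
    rw [chartMap_comp hUe _ (hHU w hw)]
    exact congrFun (chartMap_congr hUe fun z _ => (h.add v w z).symm) y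
  have hzero : ∀ y, chartMap e U (α 0) y = y := chartMap_eq_self hUe fun z _ => h.zero z
  have hker : ∀ a b, chartMap e U (α (u (a + b))) = chartMap e U (α (u a + u b)) := by
    intro a b
    refine chartMap_congr hUe fun z hz => ?_
    have h1 := h.add (u a + u b) (u (a + b) - (u a + u b)) z
    rwa [add_sub_cancel, hadd a b z hz] at h1
  have hadd' : ∀ a b y, chartMap e U (α (u (a + b))) y
      = chartMap e U (α (u a)) (chartMap e U (α (u b)) y) := by
    intro a b y
    rw [hcomp _ _ (hu b), hker]
  have hfix : ∀ v ∈ H, chartMap e U (α v) 0 = 0 := fun v hv => by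
    rw [← hx, chartMap_apply hUe _ hxU, hHx v hv]
  have hcont : ∀ v ∈ H, ContinuousOn (fun p : ℝ × EuclideanSpace ℝ (Fin n) =>
      chartMap e U (α (p.1 • v)) p.2) (Set.univ ×ˢ (e '' U)) := by
    intro v hv
    refine continuousOn_chartMap hUe (F := fun s z => α (s • v) z) ?_ fun s z hz =>
      hHU _ (H.smul_mem s hv) z hz
    exact h.cont.comp ((continuous_fst.smul continuous_const).prodMk continuous_snd)
  refine ⟨fun a => ⟨fun y => ?_, hfix _ (hu a), ?_⟩, hadd', fun a ha hc => ?_, fun a y => ?_,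
    fun a y => ?_, fun a b s y => ?_, fun a => ?_, fun a δ hδ => ?_⟩
  · rw [← hadd', hA, hu0, hzero]
  · refine Filter.mem_of_superset (hDo.mem_nhds hD0) fun y hy => ?_
    have h1 := ((hcont _ (hu a)).comp (f := fun y => ((1 : ℝ), y)) (s := e '' U)
      (continuousOn_const.prodMk continuousOn_id) fun z hz => ⟨trivial, hz⟩).continuousAt
      (hDo.mem_nhds hy)
    simp only [Function.comp_def, one_smul] at h1
    exact h1
  · simp only [not_not] at hc
    obtain ⟨B, hB, hBo, hB0⟩ := eventually_nhds_iff.1 hc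
    refine ha (hinj a ?_)
    refine eq_self_of_chart e hUe hUo hUc (h.cont_right _) (hHU _ (hu a)) (fun z hz => ?_)
      (e.isOpen_inter_preimage hBo |>.inter hUo) ⟨x, hxU, ⟨hUe hxU, ?_⟩, hxU⟩ ?_
    · rw [← h.add]
      have h1 := hadd a a z hz
      rw [hA, hu0, zero_sub] at h1
      have h2 := h.apply_neg (u a + u a) z
      rwa [h1] at h2
    · change e x ∈ B
      rwa [hx]
    · rintro z ⟨⟨hze, hzB⟩, hzU⟩
      have h1 := hB _ hzB
      rw [chartMap_apply hUe _ hzU] at h1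
      exact e.injOn (hUe (hHU _ (hu a) z hzU)) hze h1
  · rw [zero_smul, hzero]
  · rw [one_smul]
  · rw [hcomp _ _ (hu b), hcomp _ _ (hus a s), add_comm]
  · obtain ⟨R, hR, hRD⟩ := Metric.nhds_basis_closedBall.mem_iff.1 (hDo.mem_nhds hD0)
    exact ⟨R, hR, (hcont _ (hu a)).mono (Set.prod_mono (Set.subset_univ _) hRD)⟩
  · have hop := (hcont _ (H.neg_mem (hu a))).isOpen_inter_preimage (isOpen_univ.prod hDo)
      (Metric.isOpen_ball (x := (0 : EuclideanSpace ℝ (Fin n))) (ε := δ))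
    obtain ⟨A', B, hA', hB, hIA, h0B, hAB⟩ := generalized_tube_lemma
      (isCompact_Icc (a := (0 : ℝ)) (b := 1)) (isCompact_singleton (x := 0)) hop (by
        rintro ⟨s, y⟩ ⟨-, hy⟩
        rw [show y = 0 from hy]
        refine ⟨⟨trivial, hD0⟩, ?_⟩
        change chartMap e U (α (s • -u a)) 0 ∈ Metric.ball _ δ
        rw [hfix _ (H.smul_mem s (H.neg_mem (hu a)))]
        exact Metric.mem_ball_self hδ)
    obtain ⟨δ', hδ', hδB⟩ := Metric.isOpen_iff.1 hB 0 (h0B rfl)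
    refine ⟨δ', hδ', fun s hs y hy => ?_⟩
    by_contra! hlt
    have h1 := hAB (show (s, chartMap e U (α (s • u a)) y) ∈ A' ×ˢ B from
      ⟨hIA hs, hδB (mem_ball_zero_iff.2 hlt)⟩)
    have h2 : chartMap e U (α (s • -u a)) (chartMap e U (α (s • u a)) y) ∈ Metric.ball _ δ := h1.2
    rw [hcomp _ _ (hus a s), smul_neg, neg_add_cancel, hzero, mem_ball_zero_iff] at h2
    exact absurd h2 (not_lt.2 hy)

end TAct

end

end InfChain

/-! ## The rank of an effective torus action -/

namespace InfChain

open Filter Topology Module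

noncomputable section

variable {V M E : Type*} [NormedAddCommGroup V] [NormedSpace ℝ V] [TopologicalSpace M]
  [NormedAddCommGroup E] {e : OpenPartialHomeomorph M E} {U : Set M}

namespace TAct

variable {α : V → M → M}

/-- A complement of the isotropy algebra gives a local action that is free at the fixed point. -/
theorem locAct (h : TAct α) (hUe : U ⊆ e.source) (hUo : IsOpen U) {x : M} (hxU : x ∈ U)
    (hx : e x = 0) {d : ℕ} (j : (Fin d → ℝ) →ₗ[ℝ] V) (hj : Function.Injective j) {r₁ : ℝ}
    (hr₁ : 0 < r₁) (hfree : ∀ w, ‖j w‖ ≤ r₁ → α (j w) x = x → j w = 0) {A : Type*} {u : A → V}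
    (hu : ∀ a, ∀ y ∈ U, α (u a) y ∈ U) :
    ∃ r ρ, LocAct {y | ∀ a, chartMap e U (α (u a)) y = y}
      (fun w y => e (α (j w) (e.symm y))) r ρ := by
  have hjc : Continuous j := j.continuous_of_finiteDimensional
  have hDo : IsOpen (e '' U) := e.isOpen_image_of_subset_source hUo hUe
  have hD0 : (0 : E) ∈ e '' U := ⟨x, hxU, hx⟩
  have hDt : e '' U ⊆ e.target := by
    rintro _ ⟨z, hz, rfl⟩
    exact e.map_source (hUe hz)
  have hx0 : e.symm 0 = x := by rw [← hx, e.left_inv (hUe hxU)]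
  have hc : ContinuousOn (fun p : (Fin d → ℝ) × E => α (j p.1) (e.symm p.2))
      (Set.univ ×ˢ (e '' U)) :=
    h.cont.comp_continuousOn (f := fun p : (Fin d → ℝ) × E => (j p.1, e.symm p.2))
      ((hjc.comp continuous_fst).continuousOn.prodMk
        (e.continuousOn_symm.comp continuousOn_snd fun p hp => hDt hp.2))
  have hop := hc.isOpen_inter_preimage (isOpen_univ.prod hDo) hUo
  have h0 : ((0 : Fin d → ℝ), (0 : E)) ∈ (Set.univ ×ˢ (e '' U)) ∩
      (fun p : (Fin d → ℝ) × E => α (j p.1) (e.symm p.2)) ⁻¹' U := by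
    refine ⟨⟨trivial, hD0⟩, ?_⟩
    change α (j 0) (e.symm 0) ∈ U
    rwa [hx0, map_zero, h.zero]
  have hjn : ∀ᶠ w in 𝓝 (0 : Fin d → ℝ), ‖j w‖ < r₁ :=
    (hjc.norm.tendsto 0).eventually_lt_const (by rwa [map_zero, norm_zero])
  obtain ⟨r, hr, hrj⟩ := Metric.nhds_basis_closedBall.mem_iff.1 hjn
  obtain ⟨ε, hε, hεs⟩ := Metric.nhds_basis_closedBall.mem_iff.1 (hop.mem_nhds h0)
  have hU : ∀ w y, ‖w‖ ≤ ε → ‖y‖ ≤ ε → y ∈ e '' U ∧ α (j w) (e.symm y) ∈ U := by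
    intro w y hw hy
    have h1 := hεs (show (w, y) ∈ Metric.closedBall _ _ by
      rw [Prod.mk_zero_zero, mem_closedBall_zero_iff, Prod.norm_mk]
      exact max_le hw hy)
    exact ⟨h1.1.2, h1.2⟩
  refine ⟨min r ε, ε, lt_min hr hε, hε, ?_, fun y hy => ?_, fun v s y hv hs hvs hy _ => ?_,
    fun v hv hv0 => ?_, fun v hv y hyX hy a => ?_⟩
  · refine e.continuousOn.comp (hc.mono ?_) ?_
    · rintro ⟨w, y⟩ ⟨hw, hy⟩
      rw [mem_closedBall_zero_iff] at hw hy
      exact ⟨trivial, (hU w y (hw.trans (min_le_right _ _)) hy).1⟩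
    · rintro ⟨w, y⟩ ⟨hw, hy⟩
      rw [mem_closedBall_zero_iff] at hw hy
      exact hUe (hU w y (hw.trans (min_le_right _ _)) hy).2
  · rw [map_zero, h.zero, e.right_inv (hDt (hU 0 y (by simpa using hε.le) hy).1)]
  · rw [e.left_inv (hUe (hU s y (hs.trans (min_le_right _ _)) hy).2), map_add, h.add]
  · have h1 : e (α (j v) (e.symm 0)) = 0 := hv0
    have h2 := (hU v 0 (hv.trans (min_le_right _ _)) (by simpa using hε.le)).2
    rw [hx0] at h1 h2
    refine hj ?_
    rw [map_zero]
    refine hfree v (le_of_lt (hrj ?_)) (e.injOn (hUe h2) (hUe hxU) (h1.trans hx.symm))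
    rw [mem_closedBall_zero_iff]
    exact hv.trans (min_le_left _ _)
  · obtain ⟨⟨z, hz, rfl⟩, h2⟩ := hU v y (hv.trans (min_le_right _ _)) hy
    have h3 : chartMap e U (α (u a)) (e z) = e z := hyX a
    rw [chartMap_apply hUe _ hz] at h3
    have h4 : α (u a) z = z := e.injOn (hUe (hu a z hz)) (hUe hz) h3
    rw [e.left_inv (hUe hz)] at h2 ⊢
    rw [chartMap_apply hUe _ h2, ← h.add, add_comm, h.add, h4]

/-- For an effective torus action, the rank of the torus and the dimension of an isotropy group
add up to at most the dimension of the manifold. -/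
theorem finrank_add_le [FiniteDimensional ℝ V] {n : ℕ}
    [ChartedSpace (EuclideanSpace ℝ (Fin n)) M] [PreconnectedSpace M] (h : TAct α)
    [DiscreteTopology (h.kerOn Set.univ)] [IsZLattice ℝ (h.kerOn Set.univ)] (x : M) :
    finrank ℝ V + finrank ℝ (linPart (h.kerOn {x})) ≤ n := by
  have : T1Space M := ChartedSpace.t1Space (EuclideanSpace ℝ (Fin n)) M
  have : LocallyConnectedSpace M :=
    ChartedSpace.locallyConnectedSpace (EuclideanSpace ℝ (Fin n)) M
  set H := linPart (h.kerOn {x}) with hH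
  have hHx : ∀ v ∈ H, α v x = x := fun v hv => mem_of_mem_linPart hv x rfl
  obtain ⟨e, hxe, hx⟩ : ∃ e : OpenPartialHomeomorph M (EuclideanSpace ℝ (Fin n)),
      x ∈ e.source ∧ e x = 0 := by
    let φ := chartAt (EuclideanSpace ℝ (Fin n)) x
    refine ⟨φ.trans (Homeomorph.addRight (-φ x)).toOpenPartialHomeomorph, ?_, ?_⟩
    · simp [φ]
    · simp
  obtain ⟨C, hC, hCH, hCL⟩ := exists_compact_cover_sub (h.kerOn Set.univ)
    (span_inter_linPart (h.kerOn Set.univ) (h.isClosed_kerOn {x})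
      (h.kerOn_anti (Set.subset_univ _)))
  obtain ⟨U, hUe, hUo, hUc, hxU, hHU⟩ := h.exists_tube hHx hC hCH hCL e.open_source hxe
  have hLU := h.kerOn_anti (Set.subset_univ U)
  have hlin : linPart (h.kerOn U) = ⊥ := by
    rw [← span_inter_linPart (h.kerOn Set.univ) (h.isClosed_kerOn U) hLU, Submodule.span_eq_bot]
    rintro v ⟨hv, hvU⟩
    have h1 := h.mem_linPart_of_open n hv hUo ⟨x, hxU⟩ hvU
    rwa [linPart_eq_bot, Submodule.mem_bot] at h1
  have := discreteTopology_of_linPart (h.isClosed_kerOn U) hlin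
  have hspan : Submodule.span ℝ ((h.kerOn U : Set V) ∩ H) = H := by
    refine le_antisymm (Submodule.span_le.2 fun v hv => hv.2) ?_
    conv_lhs => rw [hH, ← span_inter_linPart (h.kerOn Set.univ) (h.isClosed_kerOn {x})
      (h.kerOn_anti (Set.subset_univ _))]
    exact Submodule.span_mono (Set.inter_subset_inter_left _ hLU)
  have := discreteTopology_comapSub (h.kerOn U) H
  have : IsZLattice ℝ (comapSub (h.kerOn U) H) := ⟨span_comapSub hspan⟩
  obtain ⟨u, hu0, hadd, hinj⟩ := exists_halves (comapSub (h.kerOn U) H)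
  have hact := h.act hUe hUo hUc hxU hx hHx hHU (A := Fin (finrank ℝ H) → ZMod 2)
    (fun a => ZModModule.add_self a) (u := fun a => (u a : V)) (fun a => (u a).2)
    (by rw [hu0]; rfl) (fun a b => hadd a b) (fun a ha => hinj a ha)
  obtain ⟨m, hm, hmn⟩ := hact.exists_pure_top
  obtain ⟨W, hW⟩ := Submodule.exists_isCompl H
  obtain ⟨r₁, hr₁, hs⟩ := exists_no_small (h.isClosed_kerOn {x}) hW.disjoint
  let j : (Fin (finrank ℝ W) → ℝ) →ₗ[ℝ] V :=
    W.subtype ∘ₗ (finBasis ℝ W).equivFun.symm.toLinearMap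
  obtain ⟨r, ρ, hloc⟩ := h.locAct hUe hUo hxU hx j
    (W.injective_subtype.comp (finBasis ℝ W).equivFun.symm.injective) hr₁
    (fun w hw hwx => hs _ ((finBasis ℝ W).equivFun.symm w).2 hw fun y hy => by
      rw [show y = x from hy]
      exact hwx) (u := fun a => (u a : V)) fun a => hHU _ (u a).2
  have hvan := hloc.van
  have hlt : finrank ℝ W < m := by
    by_contra! hle
    exact hm.1.not_van (hvan m hle)
  have h5 := Submodule.finrank_add_eq_of_isCompl hW
  rw [finrank_fintype_fun_eq_card, Fintype.card_fin] at hmn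
  omega

end TAct

end

end InfChain

/-! ## Tori -/

namespace InfChain

open Filter Topology Module

noncomputable section

/-- The exponential map of the torus. -/
def torusExp (k : ℕ) : (Fin k → ℝ) →+ Torus k where
  toFun v i := (v i : AddCircle (1 : ℝ))
  map_zero' := rfl
  map_add' _ _ := rfl

lemma torusExp_apply {k : ℕ} (v : Fin k → ℝ) (i : Fin k) :
    torusExp k v i = (v i : AddCircle (1 : ℝ)) := rfl

lemma continuous_torusExp (k : ℕ) : Continuous (torusExp k) :=
  continuous_pi fun i => (AddCircle.continuous_mk' (1 : ℝ)).comp (continuous_apply i)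

lemma torusExp_surjective (k : ℕ) : Function.Surjective (torusExp k) := fun g => by
  choose v hv using fun i => QuotientAddGroup.mk_surjective (g i)
  exact ⟨v, funext hv⟩

lemma torusExp_eq_zero_iff {k : ℕ} {v : Fin k → ℝ} :
    torusExp k v = 0 ↔ ∀ i, ∃ m : ℤ, (m : ℝ) = v i := by
  simp only [funext_iff, torusExp_apply, Pi.zero_apply, AddCircle.coe_eq_zero_iff,
    zsmul_eq_mul, mul_one]

lemma eq_zero_of_torusExp_eq_zero {k : ℕ} {v : Fin k → ℝ} (h : torusExp k v = 0)
    (hv : ‖v‖ ≤ 1 / 2) : v = 0 := by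
  funext i
  obtain ⟨m, hm⟩ := torusExp_eq_zero_iff.1 h i
  have h1 : |v i| ≤ 1 / 2 := (norm_le_pi_norm v i).trans hv
  have h2 : |(m : ℝ)| < 1 := by rw [hm]; linarith
  have h3 : m = 0 := Int.abs_lt_one_iff.1 (by exact_mod_cast h2)
  rw [← hm, h3]; simp

/-- A continuous homomorphism of tori lifts to a linear map of their Lie algebras. -/
theorem exists_linear_lift {d k : ℕ} (f : Torus d →+ Torus k) (hf : Continuous f) :
    ∃ F : (Fin d → ℝ) →ₗ[ℝ] (Fin k → ℝ), ∀ v, torusExp k (F v) = f (torusExp d v) := by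
  have key (i : Fin k) : ∃ F : (Fin d → ℝ) → ℝ, Continuous F ∧ F 0 = 0 ∧
      ∀ v, (F v : AddCircle (1 : ℝ)) = f (torusExp d v) i := by
    obtain ⟨F, ⟨hF0, hF⟩, -⟩ :=
      (AddCircle.isCoveringMap_coe (1 : ℝ)).existsUnique_continuousMap_lifts
        (⟨fun v => f (torusExp d v) i, (continuous_apply i).comp
          (hf.comp (continuous_torusExp d))⟩ : C(Fin d → ℝ, AddCircle (1 : ℝ))) 0 0 (by simp)
    exact ⟨F, F.continuous, hF0, congrFun hF⟩
  choose F hFc hF0 hF using key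
  have hF' (v) : torusExp k (fun i => F i v) = f (torusExp d v) := funext fun i => hF i v
  have hadd (v w) : (fun i => F i (v + w)) = (fun i => F i v) + fun i => F i w := by
    have h0 (v w) : torusExp k ((fun i => F i (v + w)) - (fun i => F i v) - fun i => F i w) = 0 := by
      simp only [map_sub, hF', map_add]; abel
    funext i
    have hc : IsPreconnected (Set.range fun s : ℝ => F i (s • v + w) - F i (s • v) - F i w) :=
      isPreconnected_range (by have := hFc i; fun_prop)
    have hsub : (Set.range fun s : ℝ => F i (s • v + w) - F i (s • v) - F i w) ⊆
        Set.range ((↑) : ℤ → ℝ) := by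
      rintro _ ⟨s, rfl⟩
      exact torusExp_eq_zero_iff.1 (h0 (s • v) w) i
    have h1 := (Set.countable_range ((↑) : ℤ → ℝ)).isTotallyDisconnected _ hsub hc
      (Set.mem_range_self 1) (Set.mem_range_self 0)
    simp only [one_smul, zero_smul, zero_add, hF0, sub_zero, sub_self] at h1
    simp only [Pi.add_apply]
    linarith
  let A : (Fin d → ℝ) →+ (Fin k → ℝ) :=
    { toFun := fun v i => F i v, map_zero' := funext hF0, map_add' := hadd }
  exact ⟨(A.toRealLinearMap (continuous_pi hFc)).toLinearMap, hF'⟩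

theorem linear_lift_injective {d k : ℕ} {f : Torus d →+ Torus k} (hf : Function.Injective f)
    {F : (Fin d → ℝ) →ₗ[ℝ] (Fin k → ℝ)} (hF : ∀ v, torusExp k (F v) = f (torusExp d v)) :
    Function.Injective F := by
  rw [injective_iff_map_eq_zero]
  intro v hv
  have h0 (s : ℝ) : torusExp d (s • v) = 0 := by
    apply hf
    rw [← hF, map_smul, hv, smul_zero, map_zero, map_zero]
  by_contra hne
  have hpos : 0 < ‖v‖ := norm_pos_iff.2 hne
  have h1 := eq_zero_of_torusExp_eq_zero (h0 (1 / 2 / ‖v‖)) (by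
    rw [norm_smul, Real.norm_of_nonneg (by positivity)]
    exact (div_mul_cancel₀ _ hpos.ne').le)
  rcases smul_eq_zero.1 h1 with h | h
  · have : 0 < 1 / 2 / ‖v‖ := by positivity
    exact absurd h this.ne'
  · exact hne h

lemma tAct_torusExp {k : ℕ} {M : Type*} [TopologicalSpace M] [AddAction (Torus k) M]
    (hcont : Continuous fun p : Torus k × M => p.1 +ᵥ p.2) :
    TAct fun (v : Fin k → ℝ) (x : M) => torusExp k v +ᵥ x where
  cont := hcont.comp (((continuous_torusExp k).comp continuous_fst).prodMk continuous_snd)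
  zero y := by rw [map_zero, zero_vadd]
  add v w y := by rw [map_add, add_vadd]

/-- The rank of an effective torus action plus the dimension of a torus in an isotropy group is at
most the dimension of the manifold. -/
theorem torus_rank_add_le {n k d : ℕ} {M : Type*} [TopologicalSpace M]
    [ChartedSpace (EuclideanSpace ℝ (Fin n)) M] [ConnectedSpace M] [AddAction (Torus k) M]
    (hcont : Continuous fun p : Torus k × M => p.1 +ᵥ p.2)
    (heff : ∀ g : Torus k, (∀ x : M, g +ᵥ x = x) → g = 0) {x : M}
    (f : Torus d →+ Torus k) (hf : Continuous f) (hinj : Function.Injective f)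
    (hx : ∀ t, f t +ᵥ x = x) : k + d ≤ n := by
  have h := tAct_torusExp hcont
  have hker (v) (hv : v ∈ h.kerOn Set.univ) : torusExp k v = 0 :=
    heff _ fun y => hv y trivial
  have : DiscreteTopology (h.kerOn Set.univ) :=
    discreteTopology_of_small (r := 1 / 2) (by norm_num) fun q hq hqr =>
      eq_zero_of_torusExp_eq_zero (hker q hq) hqr
  have : IsZLattice ℝ (h.kerOn Set.univ) := ⟨by
    rw [eq_top_iff, ← (Pi.basisFun ℝ (Fin k)).span_eq]
    refine Submodule.span_mono ?_
    rintro _ ⟨i, rfl⟩ y -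
    have h0 : torusExp k (Pi.basisFun ℝ (Fin k) i) = 0 := torusExp_eq_zero_iff.2 fun j => by
      refine ⟨if j = i then 1 else 0, ?_⟩
      simp [Pi.single_apply]
    change torusExp k _ +ᵥ y = y
    rw [h0, zero_vadd]⟩
  obtain ⟨F, hF⟩ := exists_linear_lift f hf
  have hle := h.finrank_add_le (n := n) x
  have hd : finrank ℝ (LinearMap.range F) ≤ finrank ℝ (linPart (h.kerOn {x})) := by
    refine Submodule.finrank_mono ?_
    rintro _ ⟨v, rfl⟩ s y rfl
    change torusExp k (s • F v) +ᵥ y = y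
    rw [← map_smul, hF, hx]
  rw [LinearMap.finrank_range_of_inj (linear_lift_injective hinj hF)] at hd
  simp only [finrank_fin_fun] at hle hd
  omega

lemma torus_le_of_injective {d k : ℕ} (f : Torus d →+ Torus k) (hf : Continuous f)
    (hinj : Function.Injective f) : d ≤ k := by
  obtain ⟨F, hF⟩ := exists_linear_lift f hf
  simpa using LinearMap.finrank_le_finrank_of_injective (linear_lift_injective hinj hF)

/-- The dimension of a subset of a torus is attained. -/
lemma exists_torusDim {l : ℕ} {H : Set (Torus l)} (h0 : (0 : Torus l) ∈ H) :
    ∃ f : Torus (torusDim H) →+ Torus l,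
      Continuous f ∧ Function.Injective f ∧ Set.range f ⊆ H := by
  refine Nat.sSup_mem (s := {d : ℕ | ∃ f : Torus d →+ Torus l,
    Continuous f ∧ Function.Injective f ∧ Set.range f ⊆ H}) ⟨0, 0, continuous_zero, ?_, ?_⟩
    ⟨l, ?_⟩
  · exact Function.injective_of_subsingleton _
  · rintro _ ⟨_, rfl⟩
    exact h0
  · rintro d ⟨f, hf, hinj, -⟩
    exact torus_le_of_injective f hf hinj

end

end InfChain

/-- Ishida: if a torus `T^k` acts effectively on a connected
smooth `n`-manifold `M` and a subtorus `T^l ⊆ T^k` (embedded via `ι`) acts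
maximally, i.e. some point has `T^l`-isotropy group of dimension `n − l`, then
`T^l = T^k`. -/
theorem subtorus_eq_of_maximal_subaction
    (n k l : ℕ) (M : Type) [TopologicalSpace M]
    [ChartedSpace (EuclideanSpace ℝ (Fin n)) M] [ConnectedSpace M]
    [AddAction (Torus k) M]
    (hcont : Continuous fun p : Torus k × M => p.1 +ᵥ p.2)
    (heff : ∀ g : Torus k, (∀ x : M, g +ᵥ x = x) → g = 0)
    (ι : Torus l →+ Torus k) (hι : Continuous ι) (hinj : Function.Injective ι)
    (hmax : ∃ x : M, torusDim {t : Torus l | ι t +ᵥ x = x} = n - l) :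
    ι.range = ⊤ := by
  obtain ⟨x, hx⟩ := hmax
  obtain ⟨f, hf, hfinj, hfr⟩ := InfChain.exists_torusDim (H := {t : Torus l | ι t +ᵥ x = x})
    (show ι 0 +ᵥ x = x by rw [map_zero, zero_vadd])
  have hn := InfChain.torus_rank_add_le (n := n) hcont heff (ι.comp f) (hι.comp hf) (hinj.comp hfinj)
    fun t => hfr ⟨t, rfl⟩
  have hlk := InfChain.torus_le_of_injective ι hι hinj
  obtain rfl : l = k := by omega
  obtain ⟨F, hF⟩ := InfChain.exists_linear_lift ι hι
  have hFs := LinearMap.surjective_of_injective (InfChain.linear_lift_injective hinj hF)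
  rw [AddMonoidHom.range_eq_top]
  intro g
  obtain ⟨v, rfl⟩ := InfChain.torusExp_surjective l g
  obtain ⟨w, rfl⟩ := hFs v
  exact ⟨_, (hF w).symm⟩
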